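/- Let q ≥ 3 be a prime power, n ≥ 1 and k integers with 1 ≤ k < q − 1, and set ν = gcd(k, q−1). Let f : F_q → F_q be a bijection and g ∈ F_q[x] a polynomial of degree k such that x ↦ f(x) + g(x) is also a bijection of F_q. Suppose there exist a, b, d ∈ F_q with ad − b ≠ 0 and a subset S ⊆ F_q ∪ {∞} with |S| ≤ n and −d ∈ S, such that f(z) = (az + b)/(z + d) for all z ∈ F_q \ S. Then n·k + k(k−1)·√q ≥ q − ν − n, where √q denotes the real square root of q. -/

import Mathlib

namespace PlaneCurve

open Polynomial

universe v

/-- Exponents `(t, s)` of the monomials of weight at most `k (k + 1)`, where the two variables have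
weights `k` and `k + 1`. -/
def expSet (k : ℕ) : Finset (ℕ × ℕ) :=
  (Finset.range (k + 2) ×ˢ Finset.range (k + 1)).filter
    fun p => k * p.1 + (k + 1) * p.2 ≤ k * (k + 1)

lemma weight_le_of_mem_expSet {k : ℕ} {p : ℕ × ℕ} (hp : p ∈ expSet k) :
    k * p.1 + (k + 1) * p.2 ≤ k * (k + 1) :=
  (Finset.mem_filter.1 hp).2

lemma snd_le_of_mem_expSet {k : ℕ} {p : ℕ × ℕ} (hp : p ∈ expSet k) : p.2 ≤ k := by
  have := (Finset.mem_product.1 (Finset.mem_filter.1 hp).1).2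
  simp at this
  omega

lemma fst_eq_zero_of_mem_expSet {k : ℕ} (hk : 1 ≤ k) {p : ℕ × ℕ} (hp : p ∈ expSet k)
    (h : p.2 = k) : p.1 = 0 := by
  have := weight_le_of_mem_expSet hp
  rw [h] at this
  have : k * p.1 ≤ 0 := by nlinarith
  rcases Nat.eq_zero_or_pos p.1 with h | h
  · exact h
  · nlinarith

lemma zero_mem_expSet (k : ℕ) : (0, k) ∈ expSet k := by
  simp [expSet]; ring_nf; rfl

section phi

variable {L R S : Type*} [Field L] [CommRing R] [Algebra L R] [CommRing S] [Algebra L S]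

/-- The value at `(x, y)` of the polynomial with coefficients `c`. -/
def phi (k : ℕ) (c : ℕ × ℕ → L) (x y : R) : R :=
  ∑ p ∈ expSet k, c p • (x ^ p.1 * y ^ p.2)

lemma map_phi (k : ℕ) (c : ℕ × ℕ → L) (x y : R) (f : R →ₐ[L] S) :
    f (phi k c x y) = phi k c (f x) (f y) := by
  simp [phi, map_sum, map_smul]

/-- The weight filtration generated by `x` in weight `k` and `y` in weight `k + 1`. -/
def fil (L : Type*) {R : Type*} [Field L] [CommRing R] [Algebra L R] (k : ℕ) (x y : R) (D : ℕ) :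
    Submodule L R :=
  Submodule.span L {z | ∃ a b : ℕ, k * a + (k + 1) * b ≤ D ∧ z = x ^ a * y ^ b}

lemma fil_mono {k : ℕ} {x y : R} {D D' : ℕ} (h : D ≤ D') : fil L k x y D ≤ fil L k x y D' :=
  Submodule.span_mono fun _ ⟨a, b, h1, h2⟩ => ⟨a, b, h1.trans h, h2⟩

lemma monomial_mem_fil {k : ℕ} (x y : R) {a b D : ℕ} (h : k * a + (k + 1) * b ≤ D) :
    x ^ a * y ^ b ∈ fil L k x y D :=
  Submodule.subset_span ⟨a, b, h, rfl⟩

lemma one_mem_fil {k : ℕ} (x y : R) (D : ℕ) : (1 : R) ∈ fil L k x y D := by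
  simpa using monomial_mem_fil (L := L) (k := k) x y (a := 0) (b := 0) (D := D) (by simp)

lemma left_mem_fil {k : ℕ} (x y : R) : x ∈ fil L k x y k := by
  simpa using monomial_mem_fil (L := L) (k := k) x y (a := 1) (b := 0) (D := k) (by simp)

lemma right_mem_fil {k : ℕ} (x y : R) : y ∈ fil L k x y (k + 1) := by
  simpa using monomial_mem_fil (L := L) (k := k) x y (a := 0) (b := 1) (D := k + 1) (by simp)

lemma mul_mem_fil {k : ℕ} {x y z w : R} {D D' : ℕ} (hz : z ∈ fil L k x y D)
    (hw : w ∈ fil L k x y D') : z * w ∈ fil L k x y (D + D') := by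
  have h := Submodule.mul_mem_mul hz hw
  rw [fil, fil, Submodule.span_mul_span] at h
  refine Submodule.span_mono ?_ h
  rintro _ ⟨_, ⟨a, b, h1, rfl⟩, _, ⟨a', b', h2, rfl⟩, rfl⟩
  refine ⟨a + a', b + b', by nlinarith, ?_⟩
  simp only []
  ring

lemma map_mem_fil {k : ℕ} {x y z : R} {D : ℕ} (f : R →ₐ[L] S) (hz : z ∈ fil L k x y D) :
    f z ∈ fil L k (f x) (f y) D := by
  have : fil L k x y D ≤ (fil L k (f x) (f y) D).comap f.toLinearMap := by
    rw [fil, Submodule.span_le]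
    rintro _ ⟨a, b, h, rfl⟩
    simpa using monomial_mem_fil (f x) (f y) h
  exact this hz

end phi

/-- `C` is the coordinate ring over `L` of the plane curve with equation `c`, with coordinate
functions `u` and `y`. -/
structure IsCurve {L C : Type v} [Field L] [CommRing C] [Algebra L C] (k : ℕ) (c : ℕ × ℕ → L)
    (u y : C) : Prop where
  rel : phi k c u y = 0
  indep : LinearIndependent L (fun p : ℕ × Fin k => u ^ p.1 * y ^ (p.2 : ℕ))
  span : ⊤ ≤ Submodule.span L (Set.range (fun p : ℕ × Fin k => u ^ p.1 * y ^ (p.2 : ℕ)))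
  lift : ∀ (R : Type v) [CommRing R] [Algebra L R] (x z : R), phi k c x z = 0 →
    ∃ θ : C →ₐ[L] R, θ u = x ∧ θ y = z

section existence

variable {L : Type v} [Field L]

/-- The equation of the curve as a polynomial in two variables. -/
noncomputable def poly (k : ℕ) (c : ℕ × ℕ → L) : L[X][X] := phi k c (C X) X

/-- The equation, specialised at a given value of the first coordinate. -/
noncomputable def fiberPoly {R : Type*} [CommRing R] [Algebra L R] (k : ℕ) (c : ℕ × ℕ → L) (x : R) :
    R[X] :=
  phi k c (C x) X

lemma fiberPoly_monic {R : Type*} [CommRing R] [Nontrivial R] [Algebra L R] {k : ℕ} (hk : 1 ≤ k)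
    {c : ℕ × ℕ → L} (hc : c (0, k) = 1) (x : R) :
    (fiberPoly k c x).Monic ∧ (fiberPoly k c x).natDegree = k := by
  have h : fiberPoly k c x = X ^ k + ∑ p ∈ (expSet k).erase (0, k),
      c p • ((C x : R[X]) ^ p.1 * X ^ p.2) := by
    rw [fiberPoly, phi, ← Finset.add_sum_erase _ _ (zero_mem_expSet k)]
    simp [hc]
  have hd : (∑ p ∈ (expSet k).erase (0, k), c p • ((C x : R[X]) ^ p.1 * X ^ p.2)).degree <
      (k : WithBot ℕ) := by
    refine Polynomial.degree_lt_iff_coeff_zero _ _ |>.2 fun m hm => ?_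
    rw [finsetSum_coeff]
    refine Finset.sum_eq_zero fun p hp => ?_
    have hp' := Finset.mem_erase.1 hp
    have h1 : p.2 < k := by
      refine lt_of_le_of_ne (snd_le_of_mem_expSet hp'.2) fun h => hp'.1 ?_
      exact Prod.ext (fst_eq_zero_of_mem_expSet hk hp'.2 h) h
    rw [coeff_smul, ← C_pow, coeff_C_mul, coeff_X_pow, if_neg (by omega)]
    simp
  rw [h]
  refine ⟨monic_X_pow_add hd, ?_⟩
  rw [natDegree_add_eq_left_of_degree_lt (by simpa using hd), natDegree_X_pow]

lemma exists_isCurve {k : ℕ} (hk : 1 ≤ k) {c : ℕ × ℕ → L} (hc : c (0, k) = 1)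
    (hirr : Irreducible (poly k c)) :
    ∃ (A : Type v) (_ : CommRing A) (_ : Algebra L A) (u y : A), IsDomain A ∧
      IsCurve k c u y := by
  have hm : (poly k c).Monic ∧ (poly k c).natDegree = k := fiberPoly_monic hk hc (X : L[X])
  have key : ∀ (R : Type v) [CommRing R] [Algebra L[X] R] [Algebra L R] [IsScalarTower L L[X] R]
      (z : R), aeval z (poly k c) = phi k c (algebraMap L[X] R X) z := by
    intro R _ _ _ _ z
    have := map_phi k c (C X) X ((aeval z : L[X][X] →ₐ[L[X]] R).restrictScalars L)
    simpa [poly] using this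
  have hroot : phi k c (algebraMap L[X] (AdjoinRoot (poly k c)) X)
      (AdjoinRoot.root (poly k c)) = 0 := by
    rw [← key]; simp
  refine ⟨AdjoinRoot (poly k c), inferInstance, inferInstance, algebraMap L[X] _ X,
    AdjoinRoot.root _, ?_, hroot, ?_, ?_, ?_⟩
  · exact AdjoinRoot.isDomain_of_prime hirr.prime
  · have hb := ((Polynomial.basisMonomials L).smulTower
      (AdjoinRoot.powerBasis' hm.1).basis).linearIndependent
    have hb' := hb.comp (Prod.map id (Fin.cast (by simp [hm.2])) :
      ℕ × Fin k → ℕ × Fin (AdjoinRoot.powerBasis' hm.1).dim)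
      (Function.injective_id.prodMap (Fin.cast_injective _))
    convert hb' using 1
    funext p
    simp [Algebra.smul_def, ← X_pow_eq_monomial]
  · rw [← ((Polynomial.basisMonomials L).smulTower (AdjoinRoot.powerBasis' hm.1).basis).span_eq,
      Submodule.span_le]
    rintro _ ⟨p, rfl⟩
    refine Submodule.subset_span ⟨(p.1, Fin.cast (by simp [hm.2]) p.2), ?_⟩
    simp [Algebra.smul_def, ← X_pow_eq_monomial]
  · intro R _ _ x z h
    let _ : Algebra L[X] R := (aeval x).toAlgebra
    have hx : algebraMap L[X] R X = x := by
      change aeval x X = x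
      simp
    have _ : IsScalarTower L L[X] R := IsScalarTower.of_algebraMap_eq fun a => by
      change _ = aeval x (C a)
      simp
    have hz : aeval z (poly k c) = 0 := by rw [key, hx, h]
    refine ⟨(AdjoinRoot.liftAlgHom (poly k c) (Algebra.ofId L[X] R) z (by
      simpa [aeval_def] using hz)).restrictScalars L, ?_, ?_⟩
    · rw [AlgHom.restrictScalars_apply]
      exact (AlgHom.commutes _ _).trans hx
    · simp

end existence

/-- Indices of the basis monomials of weight at most `D`. -/
def filIdx (k D : ℕ) : Finset (ℕ × Fin k) :=
  (Finset.range (D + 1) ×ˢ Finset.univ).filter fun p => k * p.1 + (k + 1) * (p.2 : ℕ) ≤ D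

lemma mem_filIdx {k D : ℕ} (p : ℕ × Fin k) :
    p ∈ filIdx k D ↔ k * p.1 + (k + 1) * (p.2 : ℕ) ≤ D := by
  have hk : 0 < k := p.2.pos
  simp only [filIdx, Finset.mem_filter, Finset.mem_product, Finset.mem_range, Finset.mem_univ,
    and_true, and_iff_right_iff_imp]
  intro h
  nlinarith

lemma weight_injective (k : ℕ) :
    Function.Injective fun p : ℕ × Fin k => k * p.1 + (k + 1) * (p.2 : ℕ) := by
  rintro ⟨a, b⟩ ⟨a', b'⟩ h
  have hk : 0 < k := b.pos
  have e : ∀ a b : ℕ, k * a + (k + 1) * b = k * (a + b) + b := fun a b => by ring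
  simp only [e] at h
  have h1 : (b : ℕ) = b' := by
    have := congrArg (· % k) h
    simpa [Nat.mul_add_mod, Nat.mod_eq_of_lt b.2, Nat.mod_eq_of_lt b'.2] using this
  have h2 : k * (a + b) = k * (a' + b') := by omega
  have h3 := Nat.eq_of_mul_eq_mul_left hk h2
  refine Prod.ext (by simp only []; omega) (Fin.ext h1)

lemma card_filIdx_add_le (k N D : ℕ) : (filIdx k (N + D)).card ≤ (filIdx k N).card + D := by
  classical
  have h1 : (filIdx k (N + D) \ filIdx k N).card ≤ (Finset.Ioc N (N + D)).card := by
    refine Finset.card_le_card_of_injOn _ ?_ (weight_injective k).injOn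
    intro p hp
    simp only [Finset.coe_sdiff, Set.mem_sdiff, Finset.mem_coe, mem_filIdx] at hp
    simp only [Finset.coe_Ioc, Set.mem_Ioc]
    omega
  have h2 : filIdx k (N + D) ⊆ (filIdx k (N + D) \ filIdx k N) ∪ filIdx k N := by
    intro p hp
    simp only [Finset.mem_union, Finset.mem_sdiff]
    tauto
  have h3 := (Finset.card_le_card h2).trans (Finset.card_union_le _ _)
  simp at h1
  omega

lemma card_filIdx_le (k D : ℕ) : (filIdx k D).card ≤ D + 1 := by
  have h1 : (filIdx k D).card ≤ (Finset.range (D + 1)).card := by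
    refine Finset.card_le_card_of_injOn _ ?_ (weight_injective k).injOn
    intro p hp
    simp only [Finset.mem_coe, mem_filIdx] at hp
    simp only [Finset.coe_range, Set.mem_Iio]
    omega
  simpa using h1

/-- Every large enough integer is the weight of a basis monomial. -/
lemma exists_weight_eq {k i : ℕ} (hk : 1 ≤ k) (hi : k * (k - 1) ≤ i) :
    ∃ p : ℕ × Fin k, k * p.1 + (k + 1) * (p.2 : ℕ) = i := by
  have h1 := Nat.div_add_mod i k
  have h2 := Nat.mod_lt i hk
  have h3 : k - 1 ≤ i / k := by
    rw [Nat.le_div_iff_mul_le hk, mul_comm]; exact hi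
  refine ⟨(i / k - i % k, ⟨i % k, h2⟩), ?_⟩
  obtain ⟨r, hr⟩ : ∃ r, i / k = i % k + r := ⟨i / k - i % k, by omega⟩
  simp only [hr, Nat.add_sub_cancel_left]
  rw [hr] at h1
  nlinarith

lemma le_card_filIdx {k : ℕ} (hk : 1 ≤ k) (D : ℕ) :
    D + 1 ≤ (filIdx k D).card + k * (k - 1) := by
  classical
  have h1 : Finset.Ico (k * (k - 1)) (D + 1) ⊆
      (filIdx k D).image fun p : ℕ × Fin k => k * p.1 + (k + 1) * (p.2 : ℕ) := by
    intro i hi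
    rw [Finset.mem_Ico] at hi
    obtain ⟨p, hp⟩ := exists_weight_eq hk hi.1
    refine Finset.mem_image.2 ⟨p, ?_, hp⟩
    rw [mem_filIdx]
    omega
  have h2 := (Finset.card_le_card h1).trans Finset.card_image_le
  simp at h2
  omega

section curve

variable {L A : Type v} [Field L] [CommRing A] [Algebra L A] {k : ℕ} {c : ℕ × ℕ → L} {u y : A}

lemma IsCurve.pow_eq (h : IsCurve k c u y) (hc : c (0, k) = 1) :
    y ^ k = - ∑ p ∈ (expSet k).erase (0, k), c p • (u ^ p.1 * y ^ p.2) := by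
  have := h.rel
  rw [phi, ← Finset.add_sum_erase _ _ (zero_mem_expSet k), hc] at this
  simp only [pow_zero, one_mul, one_smul] at this
  exact eq_neg_of_add_eq_zero_left this

lemma IsCurve.fil_eq (h : IsCurve k c u y) (hk : 1 ≤ k) (hc : c (0, k) = 1) (D : ℕ) :
    fil L k u y D = Submodule.span L
      ((fun p : ℕ × Fin k => u ^ p.1 * y ^ (p.2 : ℕ)) '' (filIdx k D : Set (ℕ × Fin k))) := by
  apply le_antisymm
  · rw [fil, Submodule.span_le]
    have key : ∀ b a : ℕ, k * a + (k + 1) * b ≤ D → u ^ a * y ^ b ∈ Submodule.span L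
      ((fun p : ℕ × Fin k => u ^ p.1 * y ^ (p.2 : ℕ)) '' (filIdx k D : Set (ℕ × Fin k))) := by
      intro b
      induction b using Nat.strong_induction_on with
      | _ b ih =>
        intro a hab
        by_cases hb : b < k
        · exact Submodule.subset_span ⟨(a, ⟨b, hb⟩), (mem_filIdx _).2 hab, rfl⟩
        · obtain ⟨r, rfl⟩ : ∃ r, b = r + k := ⟨b - k, by omega⟩
          rw [pow_add, h.pow_eq hc, mul_neg, mul_neg, Finset.mul_sum, Finset.mul_sum]
          refine Submodule.neg_mem _ (Submodule.sum_mem _ fun p hp => ?_)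
          have hp' := Finset.mem_erase.1 hp
          have h1 : p.2 < k := by
            refine lt_of_le_of_ne (snd_le_of_mem_expSet hp'.2) fun h => hp'.1 ?_
            exact Prod.ext (fst_eq_zero_of_mem_expSet hk hp'.2 h) h
          have h2 := weight_le_of_mem_expSet hp'.2
          have h3 := ih (r + p.2) (by omega) (a + p.1) (by nlinarith)
          rw [mul_smul_comm, mul_smul_comm]
          refine Submodule.smul_mem _ _ ?_
          convert h3 using 1
          ring
    rintro _ ⟨a, b, hab, rfl⟩
    exact key b a hab
  · rw [Submodule.span_le]
    rintro _ ⟨p, hp, rfl⟩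
    exact monomial_mem_fil u y ((mem_filIdx p).1 hp)

lemma IsCurve.finrank_fil (h : IsCurve k c u y) (hk : 1 ≤ k) (hc : c (0, k) = 1) (D : ℕ) :
    Module.finrank L (fil L k u y D) = (filIdx k D).card := by
  classical
  rw [h.fil_eq hk hc]
  have := finrank_span_eq_card (h.indep.comp (Subtype.val : (filIdx k D) → ℕ × Fin k)
    Subtype.val_injective)
  rw [Set.range_comp, Subtype.range_coe_subtype] at this
  simpa using this

lemma IsCurve.finite_fil (h : IsCurve k c u y) (hk : 1 ≤ k) (hc : c (0, k) = 1) (D : ℕ) :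
    Module.Finite L (fil L k u y D) := by
  rw [h.fil_eq hk hc]
  exact FiniteDimensional.span_of_finite L ((Finset.finite_toSet _).image _)

lemma IsCurve.exists_mem_fil (h : IsCurve k c u y) (z : A) : ∃ D, z ∈ fil L k u y D := by
  have hz : z ∈ Submodule.span L (Set.range (fun p : ℕ × Fin k => u ^ p.1 * y ^ (p.2 : ℕ))) :=
    h.span trivial
  induction hz using Submodule.span_induction with
  | mem x hx =>
    obtain ⟨p, rfl⟩ := hx
    exact ⟨_, monomial_mem_fil u y le_rfl⟩
  | zero => exact ⟨0, zero_mem _⟩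
  | add a b _ _ ha hb =>
    obtain ⟨D, hD⟩ := ha
    obtain ⟨E, hE⟩ := hb
    exact ⟨max D E, add_mem (fil_mono (le_max_left _ _) hD) (fil_mono (le_max_right _ _) hE)⟩
  | smul r a _ ha =>
    obtain ⟨D, hD⟩ := ha
    exact ⟨D, Submodule.smul_mem _ _ hD⟩

/-- A subspace of `fil D` meeting `fil N` trivially has dimension at most `D - N`. -/
lemma IsCurve.finrank_le_of_disjoint (h : IsCurve k c u y) (hk : 1 ≤ k) (hc : c (0, k) = 1)
    {D N : ℕ} (E : Submodule L A) (hE : E ≤ fil L k u y (N + D))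
    (hd : Disjoint E (fil L k u y N)) : Module.finrank L E ≤ D := by
  have := h.finite_fil hk hc (N + D)
  have := h.finite_fil hk hc N
  have : Module.Finite L E := Submodule.finiteDimensional_of_le hE
  have h2 := Submodule.finrank_sup_add_finrank_inf_eq E (fil L k u y N)
  rw [hd.eq_bot, finrank_bot, add_zero] at h2
  have h3 : Module.finrank L (E ⊔ fil L k u y N : Submodule L A) ≤
      Module.finrank L (fil L k u y (N + D)) :=
    Submodule.finrank_mono (sup_le hE (fil_mono (by omega)))
  rw [h2, h.finrank_fil hk hc, h.finrank_fil hk hc] at h3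
  have := card_filIdx_add_le k N D
  omega

/-- The length over `L` of the quotient by an ideal. -/
noncomputable def colen (L : Type*) {A : Type*} [Field L] [CommRing A] [Algebra L A] (I : Ideal A) :
    ℕ∞ :=
  Module.length L (A ⧸ I)

/-- Bézout: an ideal containing a nonzero element of weight at most `D` has colength at most
`D`. -/
lemma IsCurve.colen_le [IsDomain A] (h : IsCurve k c u y) (hk : 1 ≤ k) (hc : c (0, k) = 1)
    {D : ℕ} {f : A} (hf : f ≠ 0) (hfD : f ∈ fil L k u y D) {I : Ideal A} (hI : f ∈ I) :
    colen L I ≤ D := by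
  classical
  by_contra hlt
  rw [not_le] at hlt
  have h1 : ((D + 1 : ℕ) : Cardinal) ≤ Module.rank L (A ⧸ I) := by
    rw [colen, Module.length_eq_rank] at hlt
    have := Order.add_one_le_of_lt hlt
    rw [← Cardinal.natCast_le_toENat]
    exact_mod_cast this
  obtain ⟨s, hs, hli⟩ := (le_rank_iff_exists_linearIndependent_finset).1 h1
  choose g hg using fun x : A ⧸ I => Ideal.Quotient.mk_surjective x
  choose d hd using fun z : A => h.exists_mem_fil z
  set N := s.sup fun x => d (g x) with hN
  have hli' : LinearIndependent L fun x : s => g x := by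
    have : LinearIndependent L ((Ideal.Quotient.mkₐ L I).toLinearMap ∘ fun x : s => g x) := by
      have e : ((Ideal.Quotient.mkₐ L I).toLinearMap ∘ fun x : s => g x) = Subtype.val := by
        funext x
        simp [hg]
      rw [e]
      exact hli
    exact LinearIndependent.of_comp _ this
  set E := Submodule.span L (Set.range fun x : s => g x) with hE
  have hEdim : Module.finrank L E = D + 1 := by
    rw [hE, finrank_span_eq_card hli', Fintype.card_coe, hs]
  have hEN : E ≤ fil L k u y N := by
    rw [hE, Submodule.span_le]
    rintro _ ⟨x, rfl⟩
    exact fil_mono (Finset.le_sup (f := fun x => d (g x)) x.2) (hd (g x))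
  have hdisj : Disjoint E (I.restrictScalars L) := by
    rw [Submodule.disjoint_def]
    intro z hz hzI
    rw [hE] at hz
    rw [Submodule.mem_span_range_iff_exists_fun] at hz
    obtain ⟨a, rfl⟩ := hz
    have h0 : (Ideal.Quotient.mkₐ L I) (∑ i : s, a i • g i) = 0 := by
      rw [Ideal.Quotient.mkₐ_eq_mk]
      exact Ideal.Quotient.eq_zero_iff_mem.2 hzI
    rw [map_sum] at h0
    simp only [map_smul, Ideal.Quotient.mkₐ_eq_mk, hg] at h0
    have := Fintype.linearIndependent_iff.1 hli a h0
    simp [this]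
  set T := (fil L k u y N).map (LinearMap.mulLeft L f) with hT
  have hTdim : Module.finrank L T = (filIdx k N).card := by
    rw [← h.finrank_fil hk hc]
    exact (Submodule.equivMapOfInjective (LinearMap.mulLeft L f) (mul_right_injective₀ hf)
      (fil L k u y N)).finrank_eq.symm
  have := h.finite_fil hk hc (N + D)
  have := h.finite_fil hk hc N
  have hTI : T ≤ I.restrictScalars L := by
    rintro _ ⟨z, _, rfl⟩
    exact I.mul_mem_right z hI
  have hTD : T ≤ fil L k u y (N + D) := by
    rintro _ ⟨z, hz, rfl⟩
    rw [add_comm]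
    exact mul_mem_fil hfD hz
  have hED : E ≤ fil L k u y (N + D) := hEN.trans (fil_mono (by omega))
  have : Module.Finite L E := Submodule.finiteDimensional_of_le hED
  have : Module.Finite L T := Submodule.finiteDimensional_of_le hTD
  have h2 := Submodule.finrank_sup_add_finrank_inf_eq E T
  rw [(hdisj.mono_right hTI).eq_bot, finrank_bot, add_zero] at h2
  have h3 : Module.finrank L (E ⊔ T : Submodule L A) ≤ _ := Submodule.finrank_mono (sup_le hED hTD)
  rw [h2, h.finrank_fil hk hc, hEdim, hTdim] at h3
  have := card_filIdx_add_le k N D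
  omega

end curve

section colength

variable {L A : Type*} [Field L] [CommRing A] [Algebra L A]

lemma colen_anti {I J : Ideal A} (h : I ≤ J) : colen L J ≤ colen L I := by
  refine Module.length_le_of_surjective ((Submodule.factor h).restrictScalars L) ?_
  exact Submodule.factor_surjective h

/-- Additivity of colength along multiplication by `a`. -/
lemma colen_eq_add {I J : Ideal A} {a : A} (hJ : ∀ h, h ∈ J ↔ h * a ∈ I) :
    colen L I = colen L J + colen L (I ⊔ Ideal.span {a}) := by
  have hle : J ≤ Submodule.comap (LinearMap.mulRight A a) I := fun h hh => (hJ h).1 hh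
  let f : (A ⧸ J) →ₗ[A] A ⧸ I := Submodule.mapQ J I (LinearMap.mulRight A a) hle
  let g : (A ⧸ I) →ₗ[A] A ⧸ (I ⊔ Ideal.span {a}) := Submodule.factor le_sup_left
  have hf : ∀ x : A, f (Submodule.Quotient.mk x) = Submodule.Quotient.mk (x * a) := fun x => rfl
  have hg : ∀ x : A, g (Submodule.Quotient.mk x) = Submodule.Quotient.mk x := fun x => rfl
  have hinj : Function.Injective f := by
    rw [injective_iff_map_eq_zero]
    intro x hx
    obtain ⟨x, rfl⟩ := Submodule.Quotient.mk_surjective _ x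
    rw [hf, Submodule.Quotient.mk_eq_zero] at hx
    rwa [Submodule.Quotient.mk_eq_zero, hJ]
  have hsurj : Function.Surjective g := by
    intro x
    obtain ⟨x, rfl⟩ := Submodule.Quotient.mk_surjective _ x
    exact ⟨_, hg x⟩
  have hex : Function.Exact f g := by
    intro x
    obtain ⟨x, rfl⟩ := Submodule.Quotient.mk_surjective _ x
    rw [hg, Submodule.Quotient.mk_eq_zero, Submodule.mem_sup]
    constructor
    · rintro ⟨i, hi, z, hz, rfl⟩
      obtain ⟨r, rfl⟩ := Ideal.mem_span_singleton'.1 hz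
      refine ⟨Submodule.Quotient.mk r, ?_⟩
      rw [hf, Submodule.Quotient.eq, show r * a - (i + r * a) = -i by ring]
      exact I.neg_mem hi
    · rintro ⟨r, hr⟩
      obtain ⟨r, rfl⟩ := Submodule.Quotient.mk_surjective _ r
      rw [hf, eq_comm, Submodule.Quotient.eq] at hr
      exact ⟨x - r * a, hr, r * a, Ideal.mul_mem_left _ _ (Ideal.mem_span_singleton_self a),
        by ring⟩
  exact Module.length_eq_add_of_exact (f.restrictScalars L) (g.restrictScalars L) hinj hsurj hex

lemma colen_sup_mul_le (I : Ideal A) (a b : A) :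
    colen L (I ⊔ Ideal.span {a * b}) ≤
      colen L (I ⊔ Ideal.span {a}) + colen L (I ⊔ Ideal.span {b}) := by
  let J : Ideal A := Submodule.comap (LinearMap.mulRight A a) (I ⊔ Ideal.span {a * b})
  have hJ : ∀ h, h ∈ J ↔ h * a ∈ I ⊔ Ideal.span {a * b} := fun h => Iff.rfl
  rw [colen_eq_add hJ, add_comm]
  refine add_le_add (colen_anti ?_) (colen_anti ?_)
  · exact sup_le_sup_right le_sup_left _
  · refine sup_le (fun x hx => ?_) ?_
    · exact (hJ x).2 (Submodule.mem_sup_left (I.mul_mem_right a hx))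
    · rw [Ideal.span_singleton_le_iff_mem, hJ, mul_comm]
      exact Submodule.mem_sup_right (Ideal.mem_span_singleton_self _)

lemma colen_top : colen L (⊤ : Ideal A) = 0 := by
  rw [colen, Module.length_eq_zero_iff]
  exact Ideal.Quotient.subsingleton_iff.2 rfl

lemma colen_sup_pow_le (I : Ideal A) (a : A) (n : ℕ) :
    colen L (I ⊔ Ideal.span {a ^ n}) ≤ n * colen L (I ⊔ Ideal.span {a}) := by
  induction n with
  | zero => simp [colen_top]
  | succ n ih =>
    rw [pow_succ]
    refine (colen_sup_mul_le I _ _).trans ?_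
    push_cast
    rw [add_mul, one_mul]
    gcongr

lemma colen_sup_prod_le {ι : Type*} (I : Ideal A) (s : Finset ι) (a : ι → A) :
    colen L (I ⊔ Ideal.span {∏ i ∈ s, a i}) ≤ ∑ i ∈ s, colen L (I ⊔ Ideal.span {a i}) := by
  classical
  induction s using Finset.induction_on with
  | empty => simp [colen_top]
  | insert i s hi ih =>
    rw [Finset.prod_insert hi, Finset.sum_insert hi]
    exact (colen_sup_mul_le I _ _).trans (add_le_add le_rfl ih)

lemma colen_span_mul [IsDomain A] {a b : A} (ha : a ≠ 0) :
    colen L (Ideal.span {a * b}) = colen L (Ideal.span {b}) + colen L (Ideal.span {a}) := by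
  have hJ : ∀ h, h ∈ Ideal.span {b} ↔ h * a ∈ Ideal.span {a * b} := by
    intro h
    rw [Ideal.mem_span_singleton, Ideal.mem_span_singleton, mul_comm h a]
    exact (mul_dvd_mul_iff_left ha).symm
  rw [colen_eq_add hJ]
  congr 2
  rw [sup_eq_right, Ideal.span_singleton_le_span_singleton]
  exact dvd_mul_right _ _

lemma le_colen_span_prod [IsDomain A] {ι : Type*} (s : Finset ι) (a : ι → A)
    (ha : ∀ i ∈ s, a i ≠ 0) {N : ℕ} (hN : ∀ i ∈ s, (N : ℕ∞) ≤ colen L (Ideal.span {a i})) :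
    ((s.card * N : ℕ) : ℕ∞) ≤ colen L (Ideal.span {∏ i ∈ s, a i}) := by
  classical
  induction s using Finset.induction_on with
  | empty => simp
  | insert i s hi ih =>
    rw [Finset.prod_insert hi, colen_span_mul (ha i (Finset.mem_insert_self _ _)),
      Finset.card_insert_of_notMem hi, add_mul, one_mul]
    push_cast
    have := ih (fun j hj => ha j (Finset.mem_insert_of_mem hj))
      (fun j hj => hN j (Finset.mem_insert_of_mem hj))
    push_cast at this
    exact add_le_add this (hN i (Finset.mem_insert_self _ _))

lemma le_colen_span_pow [IsDomain A] {a : A} (ha : a ≠ 0) {N : ℕ}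
    (hN : (N : ℕ∞) ≤ colen L (Ideal.span {a})) (n : ℕ) :
    ((n * N : ℕ) : ℕ∞) ≤ colen L (Ideal.span {a ^ n}) := by
  have := le_colen_span_prod (L := L) (Finset.range n) (fun _ => a) (fun _ _ => ha)
    (fun _ _ => hN)
  simpa using this

/-- Colengths of comaximal ideals add up. -/
lemma colen_add_le_of_isCoprime {I J K : Ideal A} (hI : K ≤ I) (hJ : K ≤ J) (h : IsCoprime I J) :
    colen L I + colen L J ≤ colen L K := by
  rw [colen, colen, ← Module.length_prod]
  refine Module.length_le_of_surjective
    (((Submodule.factor hI).restrictScalars L).prod ((Submodule.factor hJ).restrictScalars L)) ?_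
  rintro ⟨x, z⟩
  obtain ⟨x, rfl⟩ := Submodule.Quotient.mk_surjective _ x
  obtain ⟨z, rfl⟩ := Submodule.Quotient.mk_surjective _ z
  obtain ⟨i, hi, j, hj, hij⟩ := Ideal.isCoprime_iff_exists.1 h
  refine ⟨Submodule.Quotient.mk (x * j + z * i), ?_⟩
  simp only [LinearMap.prod_apply, Function.prod_apply, LinearMap.coe_restrictScalars]
  refine Prod.ext ?_ ?_
  · change (Submodule.Quotient.mk (x * j + z * i) : A ⧸ I) = Submodule.Quotient.mk x
    rw [Submodule.Quotient.eq]
    have : x * j + z * i - x = (z - x) * i := by linear_combination x * hij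
    rw [this]
    exact I.mul_mem_left _ hi
  · change (Submodule.Quotient.mk (x * j + z * i) : A ⧸ J) = Submodule.Quotient.mk z
    rw [Submodule.Quotient.eq]
    have : x * j + z * i - z = (x - z) * j := by linear_combination z * hij
    rw [this]
    exact J.mul_mem_left _ hj

/-- If `p ^ e * a` lies in `I` and `a` is invertible modulo `p`, then `p ^ e` lies in `I` up to
a power of `p`. -/
lemma colen_sup_pow_le_of_mul_mem {I : Ideal A} {p a : A} {e : ℕ} (h : p ^ e * a ∈ I)
    (hcop : IsCoprime a p) (n : ℕ) :
    colen L (I ⊔ Ideal.span {p ^ n}) ≤ e * colen L (I ⊔ Ideal.span {p}) := by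
  refine le_trans (colen_anti ?_) (colen_sup_pow_le I p e)
  refine sup_le le_sup_left ?_
  rw [Ideal.span_singleton_le_iff_mem]
  obtain ⟨r, s, hrs⟩ := hcop.pow_right (n := n)
  have : p ^ e = r * (p ^ e * a) + p ^ e * s * p ^ n := by linear_combination (-p ^ e) * hrs
  rw [this]
  exact add_mem (Submodule.mem_sup_left (I.mul_mem_left _ h))
    (Submodule.mem_sup_right (Ideal.mul_mem_left _ _ (Ideal.mem_span_singleton_self _)))

end colength

section

variable {L A : Type*} [Field L] [CommRing A] [Algebra L A]

lemma colen_sup_pow_le_rootMultiplicity {I : Ideal A} {z : A} {p : L[X]} (hp : p ≠ 0)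
    (hI : aeval z p ∈ I) (a : L) (n : ℕ) :
    colen L (I ⊔ Ideal.span {(z - algebraMap L A a) ^ n}) ≤
      p.rootMultiplicity a * colen L (I ⊔ Ideal.span {z - algebraMap L A a}) := by
  obtain ⟨r, hr, hnd⟩ := exists_eq_pow_rootMultiplicity_mul_and_not_dvd p hp a
  have hcop : IsCoprime r (X - C a) :=
    ((irreducible_X_sub_C a).coprime_iff_not_dvd.2 hnd).symm
  have h1 := hcop.map (aeval z : L[X] →ₐ[L] A).toRingHom
  simp only [AlgHom.toRingHom_eq_coe, RingHom.coe_coe, map_sub, aeval_X, aeval_C] at h1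
  refine colen_sup_pow_le_of_mul_mem (a := aeval z r) ?_ h1 n
  rw [hr] at hI
  simpa using hI

lemma phi_sub_mem {k : ℕ} {c : ℕ × ℕ → L} {I : Ideal A} {x x' z z' : A} (hx : x - x' ∈ I)
    (hz : z - z' ∈ I) : phi k c x z - phi k c x' z' ∈ I := by
  rw [← Ideal.Quotient.eq] at *
  have h := fun a b : A => map_phi k c a b (Ideal.Quotient.mkₐ L I)
  simp only [Ideal.Quotient.mkₐ_eq_mk] at h
  rw [h, h, hx, hz]

end

section curve

variable {L A : Type v} [Field L] [CommRing A] [Algebra L A] {k : ℕ} {c : ℕ × ℕ → L} {u y : A}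

lemma IsCurve.colen_point_le_one (h : IsCurve k c u y) (a b : L) :
    colen L (Ideal.span {u - algebraMap L A a} ⊔ Ideal.span {y - algebraMap L A b}) ≤ 1 := by
  set I := Ideal.span {u - algebraMap L A a} ⊔ Ideal.span {y - algebraMap L A b} with hI
  have hs : Function.Surjective (Algebra.linearMap L (A ⧸ I)) := by
    rw [← LinearMap.range_eq_top, eq_top_iff]
    have : (⊤ : Submodule L (A ⧸ I)) =
        (Submodule.span L (Set.range (fun p : ℕ × Fin k => u ^ p.1 * y ^ (p.2 : ℕ)))).map
          (Ideal.Quotient.mkₐ L I).toLinearMap := by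
      rw [top_le_iff.1 h.span, Submodule.map_top]
      exact (LinearMap.range_eq_top.2 Ideal.Quotient.mk_surjective).symm
    rw [this, Submodule.map_le_iff_le_comap, Submodule.span_le]
    rintro _ ⟨p, rfl⟩
    refine ⟨a ^ p.1 * b ^ (p.2 : ℕ), ?_⟩
    have hu : Ideal.Quotient.mk I u = algebraMap L (A ⧸ I) a := by
      refine Ideal.Quotient.eq.2 ?_
      exact Submodule.mem_sup_left (Ideal.mem_span_singleton_self _)
    have hy : Ideal.Quotient.mk I y = algebraMap L (A ⧸ I) b := by
      refine Ideal.Quotient.eq.2 ?_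
      exact Submodule.mem_sup_right (Ideal.mem_span_singleton_self _)
    simp [hu, hy]
  refine (Module.length_le_of_surjective _ hs).trans ?_
  rw [Module.length_eq_finrank]
  simp

lemma IsCurve.colen_fiber (h : IsCurve k c u y) (hk : 1 ≤ k) (hc : c (0, k) = 1) (a : L) :
    (k : ℕ∞) ≤ colen L (Ideal.span {u - algebraMap L A a}) := by
  have hm : (fiberPoly k c a).Monic ∧ (fiberPoly k c a).natDegree = k := fiberPoly_monic hk hc a
  obtain ⟨θ, h1, h2⟩ := h.lift (AdjoinRoot (fiberPoly k c a)) (algebraMap L _ a)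
    (AdjoinRoot.root _) (by
      have := map_phi k c (C a) X (AdjoinRoot.mkₐ (fiberPoly k c a) : L[X] →ₐ[L] _)
      simp only [AdjoinRoot.coe_mkₐ, AdjoinRoot.mk_C, AdjoinRoot.mk_X] at this
      rw [← fiberPoly, AdjoinRoot.mk_self] at this
      exact this.symm)
  have hker : Ideal.span {u - algebraMap L A a} ≤ RingHom.ker θ := by
    rw [Ideal.span_singleton_le_iff_mem, RingHom.mem_ker]
    simp [h1]
  have hs : Function.Surjective (Ideal.Quotient.liftₐ _ θ fun x hx => hker hx) := by
    apply Ideal.Quotient.lift_surjective_of_surjective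
    intro x
    obtain ⟨p, rfl⟩ := AdjoinRoot.mk_surjective x
    refine ⟨aeval y p, ?_⟩
    change θ _ = _
    rw [← aeval_algHom_apply, h2, AdjoinRoot.aeval_eq]
  have := Module.length_le_of_surjective
    (Ideal.Quotient.liftₐ _ θ fun x hx => hker hx).toLinearMap hs
  refine le_trans ?_ this
  have := hm.1.finite_adjoinRoot
  rw [Module.length_eq_finrank, (AdjoinRoot.powerBasis' hm.1).finrank]
  simp [hm.2]

lemma IsCurve.colen_left_pow_le (h : IsCurve k c u y) (hk : 1 ≤ k) (hc : c (0, k) = 1) (a b : L)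
    (n : ℕ) :
    colen L (Ideal.span {u - algebraMap L A a} ⊔ Ideal.span {(y - algebraMap L A b) ^ n}) ≤
      (fiberPoly k c a).rootMultiplicity b := by
  refine (colen_sup_pow_le_rootMultiplicity (fiberPoly_monic hk hc a).1.ne_zero ?_ b n).trans ?_
  · have h1 : aeval y (fiberPoly k c a) = phi k c (algebraMap L A a) y := by
      simpa [fiberPoly] using map_phi k c (C a) X (aeval y : L[X] →ₐ[L] A)
    rw [h1, ← sub_zero (phi _ _ _ _), ← h.rel]
    refine phi_sub_mem ?_ (by simp)
    rw [← neg_mem_iff, neg_sub]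
    exact Ideal.mem_span_singleton_self _
  · exact (mul_le_mul_right (h.colen_point_le_one a b) _).trans (by simp)

lemma IsCurve.colen_right_pow_le (h : IsCurve k c u y) (a b : L)
    (hne : phi k c X (C b : L[X]) ≠ 0) (n : ℕ) :
    colen L (Ideal.span {y - algebraMap L A b} ⊔ Ideal.span {(u - algebraMap L A a) ^ n}) ≤
      (phi k c X (C b : L[X])).rootMultiplicity a := by
  refine (colen_sup_pow_le_rootMultiplicity hne ?_ a n).trans ?_
  · have h1 : aeval u (phi k c X (C b : L[X])) = phi k c u (algebraMap L A b) := by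
      simpa using map_phi k c X (C b) (aeval u : L[X] →ₐ[L] A)
    rw [h1, ← sub_zero (phi _ _ _ _), ← h.rel]
    refine phi_sub_mem (by simp) ?_
    rw [← neg_mem_iff, neg_sub]
    exact Ideal.mem_span_singleton_self _
  · rw [sup_comm]
    exact (mul_le_mul_right (h.colen_point_le_one a b) _).trans (by simp)

lemma IsCurve.colen_pow_pow_le_left (h : IsCurve k c u y) (hk : 1 ≤ k) (hc : c (0, k) = 1)
    (a b : L) (n : ℕ) :
    colen L (Ideal.span {(u - algebraMap L A a) ^ n} ⊔ Ideal.span {(y - algebraMap L A b) ^ n}) ≤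
      n * (fiberPoly k c a).rootMultiplicity b := by
  rw [sup_comm]
  refine (colen_sup_pow_le _ _ n).trans ?_
  rw [sup_comm]
  exact mul_le_mul_right (h.colen_left_pow_le hk hc a b n) _

lemma IsCurve.colen_pow_pow_le_right (h : IsCurve k c u y) (a b : L)
    (hne : phi k c X (C b : L[X]) ≠ 0) (n : ℕ) :
    colen L (Ideal.span {(u - algebraMap L A a) ^ n} ⊔ Ideal.span {(y - algebraMap L A b) ^ n}) ≤
      n * (phi k c X (C b : L[X])).rootMultiplicity a := by
  refine (colen_sup_pow_le _ _ n).trans ?_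
  rw [sup_comm]
  exact mul_le_mul_right (h.colen_right_pow_le a b hne n) _

/-- The ideal of all `h` with `h * z ∈ I`. -/
def quot (I : Ideal A) (z : A) : Ideal A := Submodule.comap (LinearMap.mulRight A z) I

lemma mem_quot {I : Ideal A} {z h : A} : h ∈ quot I z ↔ h * z ∈ I := Iff.rfl

lemma IsCurve.eq_zero_of_aeval_left (h : IsCurve k c u y) (hk : 1 ≤ k) {p : L[X]}
    (hp : aeval u p = 0) : p = 0 := by
  have h1 : LinearIndependent L fun t : ℕ => u ^ t := by
    have := h.indep.comp (fun t : ℕ => (t, (⟨0, hk⟩ : Fin k)))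
      (fun a b hab => (Prod.ext_iff.1 hab).1)
    simpa [Function.comp_def] using this
  rw [aeval_eq_sum_range] at hp
  have h2 := linearIndependent_iff'.1 h1 _ _ hp
  ext i
  by_cases hi : i ∈ Finset.range (p.natDegree + 1)
  · simpa using h2 i hi
  · rw [coeff_zero]
    exact coeff_eq_zero_of_natDegree_lt (by simpa using hi)

lemma IsCurve.sub_ne_zero (h : IsCurve k c u y) (hk : 1 ≤ k) (a : L) :
    u - algebraMap L A a ≠ 0 := by
  intro h0
  refine X_sub_C_ne_zero a (h.eq_zero_of_aeval_left hk ?_)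
  simpa using h0

lemma pow_card_sub_eq_prod {F A : Type*} [Field F] [Fintype F] [CommRing A] [Algebra F A] (z : A) :
    z ^ Fintype.card F - z = ∏ a : F, (z - algebraMap F A a) := by
  have h0 : (X ^ Fintype.card F - X : F[X]).Monic :=
    monic_X_pow_sub (by rw [degree_X]; exact_mod_cast Fintype.one_lt_card)
  have h1 := prod_multiset_X_sub_C_of_monic_of_roots_card_eq h0 (by
    rw [FiniteField.roots_X_pow_card_sub_X,
      FiniteField.X_pow_card_sub_X_natDegree_eq F Fintype.one_lt_card]
    rfl)
  rw [FiniteField.roots_X_pow_card_sub_X] at h1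
  have h2 := congrArg (aeval z) h1
  rw [← Finset.prod] at h2
  simpa [map_prod] using h2.symm

lemma colen_prod_pow_le {A : Type*} [CommRing A] [Algebra L A] [Fintype L] {u y : A} (s : Finset L)
    (μ : L → L → ℕ) (n : ℕ)
    (hμ : ∀ a ∈ s, ∀ b, colen L (Ideal.span {(u - algebraMap L A a) ^ n} ⊔
      Ideal.span {(y - algebraMap L A b) ^ n}) ≤ (n * μ a b : ℕ)) :
    colen L (Ideal.span {(∏ a ∈ s, (u - algebraMap L A a)) ^ n} ⊔
      Ideal.span {(y ^ Fintype.card L - y) ^ n}) ≤ (n * ∑ a ∈ s, ∑ b, μ a b : ℕ) := by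
  rw [sup_comm, ← Finset.prod_pow]
  refine (colen_sup_prod_le _ _ _).trans ?_
  rw [Finset.mul_sum]
  push_cast
  refine Finset.sum_le_sum fun a ha => ?_
  rw [pow_card_sub_eq_prod, ← Finset.prod_pow, sup_comm]
  refine (colen_sup_prod_le _ _ _).trans ?_
  rw [Finset.mul_sum]
  exact Finset.sum_le_sum fun b _ => by simpa using hμ a ha b

/-- Lower bound for the colength of the ideal of all `h` such that `h (y ^ q - y) ^ n` is divisible
by the `n`-th power of a product of linear factors in `u`. -/
lemma IsCurve.le_colen_quot [IsDomain A] [Fintype L] (h : IsCurve k c u y) (hk : 1 ≤ k)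
    (hc : c (0, k) = 1) (s : Finset L) (μ : L → L → ℕ) (n : ℕ)
    (hμ : ∀ a ∈ s, ∀ b, colen L (Ideal.span {(u - algebraMap L A a) ^ n} ⊔
      Ideal.span {(y - algebraMap L A b) ^ n}) ≤ (n * μ a b : ℕ)) :
    ((n * (s.card * k) : ℕ) : ℕ∞) ≤
      colen L (quot (Ideal.span {(∏ a ∈ s, (u - algebraMap L A a)) ^ n})
        ((y ^ Fintype.card L - y) ^ n)) + (n * ∑ a ∈ s, ∑ b, μ a b : ℕ) := by
  have h1 := le_colen_span_pow (L := L) (a := ∏ a ∈ s, (u - algebraMap L A a))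
    (Finset.prod_ne_zero_iff.2 fun a _ => h.sub_ne_zero hk a)
    (le_colen_span_prod s _ (fun a _ => h.sub_ne_zero hk a)
      fun a _ => h.colen_fiber hk hc a) n
  refine h1.trans ?_
  rw [colen_eq_add (fun x => mem_quot (z := (y ^ Fintype.card L - y) ^ n) (h := x))]
  exact add_le_add le_rfl (colen_prod_pow_le s μ n hμ)

end curve

section differences

variable {L R S : Type*} [Field L] [CommRing R] [Algebra L R] [CommRing S] [Algebra L S]

/-- Divided difference of `phi` in the second variable. -/
def ddY (k : ℕ) (c : ℕ × ℕ → L) (x z z' : R) : R :=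
  ∑ p ∈ expSet k, c p • (x ^ p.1 * ∑ j ∈ Finset.range p.2, z ^ j * z' ^ (p.2 - 1 - j))

/-- Divided difference of `phi` in the first variable. -/
def ddX (k : ℕ) (c : ℕ × ℕ → L) (x x' z : R) : R :=
  ∑ p ∈ expSet k, c p • ((∑ j ∈ Finset.range p.1, x ^ j * x' ^ (p.1 - 1 - j)) * z ^ p.2)

lemma ddY_mul (k : ℕ) (c : ℕ × ℕ → L) (x z z' : R) :
    ddY k c x z z' * (z - z') = phi k c x z - phi k c x z' := by
  simp only [ddY, phi, Finset.sum_mul, ← Finset.sum_sub_distrib, ← smul_sub]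
  refine Finset.sum_congr rfl fun p _ => ?_
  rw [smul_mul_assoc, mul_assoc, (Commute.all z z').geom_sum₂_mul, mul_sub]

lemma ddX_mul (k : ℕ) (c : ℕ × ℕ → L) (x x' z : R) :
    ddX k c x x' z * (x - x') = phi k c x z - phi k c x' z := by
  rw [ddX, phi, phi, Finset.sum_mul, ← Finset.sum_sub_distrib]
  refine Finset.sum_congr rfl fun p _ => ?_
  rw [← smul_sub, smul_mul_assoc, mul_right_comm, (Commute.all x x').geom_sum₂_mul, sub_mul]

lemma map_ddY (k : ℕ) (c : ℕ × ℕ → L) (x z z' : R) (f : R →ₐ[L] S) :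
    f (ddY k c x z z') = ddY k c (f x) (f z) (f z') := by
  simp [ddY, map_sum, map_smul]

lemma map_ddX (k : ℕ) (c : ℕ × ℕ → L) (x x' z : R) (f : R →ₐ[L] S) :
    f (ddX k c x x' z) = ddX k c (f x) (f x') (f z) := by
  simp [ddX, map_sum, map_smul]

lemma ddY_mul_eq_ddX_mul {k : ℕ} {c : ℕ × ℕ → L} {x x' z z' : R} (h : phi k c x z = 0)
    (h' : phi k c x' z' = 0) : ddY k c x' z z' * (z - z') = ddX k c x' x z * (x' - x) := by
  rw [ddY_mul, ddX_mul, h, h']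

section scalars

variable {K : Type*} [Field K] [Algebra L K] [Algebra K R] [IsScalarTower L K R]

lemma phi_algebraMap (k : ℕ) (c : ℕ × ℕ → L) (x z : R) :
    phi k (algebraMap L K ∘ c) x z = phi k c x z := by
  simp [phi]

lemma ddY_algebraMap (k : ℕ) (c : ℕ × ℕ → L) (x z z' : R) :
    ddY k (algebraMap L K ∘ c) x z z' = ddY k c x z z' := by
  simp [ddY]

lemma ddX_algebraMap (k : ℕ) (c : ℕ × ℕ → L) (x z z' : R) :
    ddX k (algebraMap L K ∘ c) x z z' = ddX k c x z z' := by
  simp [ddX]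

end scalars

lemma phi_pow_card [Fintype L] (k : ℕ) (c : ℕ × ℕ → L) (x z : R) :
    phi k c (x ^ Fintype.card L) (z ^ Fintype.card L) = phi k c x z ^ Fintype.card L := by
  have := map_phi k c x z (FiniteField.frobeniusAlgHom L R)
  simpa using this.symm

lemma ddY_pow_card [Fintype L] (k : ℕ) (c : ℕ × ℕ → L) (x z z' : R) :
    ddY k c (x ^ Fintype.card L) (z ^ Fintype.card L) (z' ^ Fintype.card L) =
      ddY k c x z z' ^ Fintype.card L := by
  have := map_ddY k c x z z' (FiniteField.frobeniusAlgHom L R)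
  simpa using this.symm

end differences

/-- A multiplicative increasing filtration. -/
structure IsFilt {L R : Type*} [Field L] [CommRing R] [Algebra L R] (V : ℕ → Submodule L R) :
    Prop where
  mono : Monotone V
  one : 1 ∈ V 0
  mul : ∀ {D D' z w}, z ∈ V D → w ∈ V D' → z * w ∈ V (D + D')

section filtrations

variable {L R : Type*} [Field L] [CommRing R] [Algebra L R] {V : ℕ → Submodule L R}

lemma isFilt_fil (k : ℕ) (x y : R) : IsFilt (fil L k x y) :=
  ⟨fun _ _ h => fil_mono h, one_mem_fil x y 0, mul_mem_fil⟩

lemma IsFilt.pow (h : IsFilt V) {D : ℕ} {z : R} (hz : z ∈ V D) (n : ℕ) : z ^ n ∈ V (n * D) := by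
  induction n with
  | zero => simpa using h.one
  | succ n ih =>
    rw [pow_succ, Nat.succ_mul]
    exact h.mul ih hz

lemma IsFilt.geom_sum (h : IsFilt V) {D : ℕ} {z z' : R} (hz : z ∈ V D) (hz' : z' ∈ V D) (n : ℕ) :
    ∑ j ∈ Finset.range n, z ^ j * z' ^ (n - 1 - j) ∈ V ((n - 1) * D) := by
  refine Submodule.sum_mem _ fun j hj => ?_
  have := h.mul (h.pow hz j) (h.pow hz' (n - 1 - j))
  rwa [← add_mul, Nat.add_sub_cancel' (by have := Finset.mem_range.1 hj; omega)] at this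

variable {k g w : ℕ}

lemma IsFilt.ddY_mem (h : IsFilt V) (hg : g + k + 1 = k * k) (c : ℕ × ℕ → L) {x z z' : R}
    (hx : x ∈ V (w * k)) (hz : z ∈ V (w * (k + 1))) (hz' : z' ∈ V (w * (k + 1))) :
    ddY k c x z z' ∈ V (w * (g + k)) := by
  refine Submodule.sum_mem _ fun p hp => Submodule.smul_mem _ _ ?_
  have hp' := weight_le_of_mem_expSet hp
  rcases hn : p.2 with _ | n
  · simp
  · rw [hn] at hp'
    refine h.mono ?_ (h.mul (h.pow hx p.1) (h.geom_sum hz hz' (n + 1)))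
    have : k * p.1 + (k + 1) * n ≤ g + k := by nlinarith
    calc _ = w * (k * p.1 + (k + 1) * n) := by simp; ring
      _ ≤ _ := Nat.mul_le_mul_left _ this

lemma IsFilt.ddX_mem (h : IsFilt V) (hg : g + k + 1 = k * k) (c : ℕ × ℕ → L) {x x' z : R}
    (hx : x ∈ V (w * k)) (hx' : x' ∈ V (w * k)) (hz : z ∈ V (w * (k + 1))) :
    ddX k c x x' z ∈ V (w * (g + k + 1)) := by
  refine Submodule.sum_mem _ fun p hp => Submodule.smul_mem _ _ ?_
  have hp' := weight_le_of_mem_expSet hp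
  rcases hn : p.1 with _ | n
  · simp
  · rw [hn] at hp'
    refine h.mono ?_ (h.mul (h.geom_sum hx hx' (n + 1)) (h.pow hz p.2))
    have : k * n + (k + 1) * p.2 ≤ g + k + 1 := by nlinarith
    calc _ = w * (k * n + (k + 1) * p.2) := by simp; ring
      _ ≤ _ := Nat.mul_le_mul_left _ this

/-- The filtration generated by `x, y` in weights `k, k + 1` and `x', y'` in weights
`w k, w (k + 1)`. -/
def bifil (L : Type*) {R : Type*} [Field L] [CommRing R] [Algebra L R] (k w : ℕ) (x y x' y' : R)
    (D : ℕ) : Submodule L R :=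
  Submodule.span L {z | ∃ a b a' b' : ℕ,
    (k * a + (k + 1) * b) + w * (k * a' + (k + 1) * b') ≤ D ∧
      z = (x ^ a * y ^ b) * (x' ^ a' * y' ^ b')}

lemma monomial_mem_bifil (x y x' y' : R) {a b a' b' D : ℕ}
    (h : (k * a + (k + 1) * b) + w * (k * a' + (k + 1) * b') ≤ D) :
    (x ^ a * y ^ b) * (x' ^ a' * y' ^ b') ∈ bifil L k w x y x' y' D :=
  Submodule.subset_span ⟨a, b, a', b', h, rfl⟩

lemma isFilt_bifil (x y x' y' : R) : IsFilt (bifil L k w x y x' y') where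
  mono D D' h := Submodule.span_mono fun _ ⟨a, b, a', b', h1, h2⟩ =>
    ⟨a, b, a', b', h1.trans h, h2⟩
  one := by
    simpa using monomial_mem_bifil (L := L) (k := k) (w := w) x y x' y'
      (a := 0) (b := 0) (a' := 0) (b' := 0) (D := 0) (by simp)
  mul := by
    intro D D' z t hz ht
    have h := Submodule.mul_mem_mul hz ht
    rw [bifil, bifil, Submodule.span_mul_span] at h
    refine Submodule.span_mono ?_ h
    rintro _ ⟨_, ⟨a, b, a', b', h1, rfl⟩, _, ⟨e, f, e', f', h2, rfl⟩, rfl⟩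
    refine ⟨a + e, b + f, a' + e', b' + f', ?_, ?_⟩
    · calc _ = (k * a + (k + 1) * b + w * (k * a' + (k + 1) * b')) +
          (k * e + (k + 1) * f + w * (k * e' + (k + 1) * f')) := by ring
        _ ≤ _ := add_le_add h1 h2
    · simp only []
      ring

lemma fst_mem_bifil (x y x' y' : R) : x ∈ bifil L k w x y x' y' k := by
  simpa using monomial_mem_bifil (L := L) (k := k) (w := w) x y x' y'
    (a := 1) (b := 0) (a' := 0) (b' := 0) (D := k) (by simp)

lemma snd_mem_bifil (x y x' y' : R) : y ∈ bifil L k w x y x' y' (k + 1) := by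
  simpa using monomial_mem_bifil (L := L) (k := k) (w := w) x y x' y'
    (a := 0) (b := 1) (a' := 0) (b' := 0) (D := k + 1) (by simp)

lemma fst_mem_bifil' (x y x' y' : R) : x' ∈ bifil L k w x y x' y' (w * k) := by
  simpa using monomial_mem_bifil (L := L) (k := k) (w := w) x y x' y'
    (a := 0) (b := 0) (a' := 1) (b' := 0) (D := w * k) (by simp)

lemma snd_mem_bifil' (x y x' y' : R) : y' ∈ bifil L k w x y x' y' (w * (k + 1)) := by
  simpa using monomial_mem_bifil (L := L) (k := k) (w := w) x y x' y'
    (a := 0) (b := 0) (a' := 0) (b' := 1) (D := w * (k + 1)) (by simp)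

end filtrations

section

variable {L R : Type*} [Field L] [CommRing R] [Algebra L R]

lemma eval_fiberPoly (k : ℕ) (c : ℕ × ℕ → L) (x z : R) :
    (fiberPoly k c x).eval z = phi k c x z := by
  have := map_phi k c (C x) X ((aeval z : R[X] →ₐ[R] R).restrictScalars L)
  simpa [fiberPoly, coe_aeval_eq_eval] using this

lemma eval_derivative_fiberPoly (k : ℕ) (c : ℕ × ℕ → L) (x z : R) :
    (derivative (fiberPoly k c x)).eval z = ddY k c x z z := by
  simp only [fiberPoly, phi, ddY, derivative_sum, eval_finsetSum, derivative_smul, eval_smul,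
    ← C_pow, derivative_C_mul, derivative_X_pow, eval_mul, eval_C, eval_pow, eval_X, map_natCast,
    eval_natCast]
  refine Finset.sum_congr rfl fun p _ => ?_
  congr 2
  have : ∀ j ∈ Finset.range p.2, z ^ j * z ^ (p.2 - 1 - j) = z ^ (p.2 - 1) := by
    intro j hj
    rw [← pow_add, Nat.add_sub_cancel' (by have := Finset.mem_range.1 hj; omega)]
  rw [Finset.sum_congr rfl this]
  simp

end

/-- The constant coefficient as a homomorphism of algebras over a subfield. -/
noncomputable def constHom (L K : Type*) [Field L] [Field K] [Algebra L K] :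
    PowerSeries K →ₐ[L] K :=
  { (PowerSeries.constantCoeff : PowerSeries K →+* K) with
    commutes' := fun r => by simp [PowerSeries.algebraMap_apply] }

lemma constHom_apply (L K : Type*) [Field L] [Field K] [Algebra L K] (s : PowerSeries K) :
    constHom L K s = PowerSeries.constantCoeff s := rfl

section

variable {L K : Type*} [Field L] [Field K] [Algebra L K] {k : ℕ} {c : ℕ × ℕ → L}

/-- A point of the curve with nonvanishing partial derivative lifts to a formal arc with prescribed
first coordinate. -/
lemma exists_arc (hk : 1 ≤ k) (hc : c (0, k) = 1) {u y : K} (h : phi k c u y = 0)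
    (h' : ddY k c u y y ≠ 0) :
    ∃ z : PowerSeries K, PowerSeries.constantCoeff z = y ∧
      phi k c (PowerSeries.C u + PowerSeries.X) z = 0 := by
  set x : PowerSeries K := PowerSeries.C u + PowerSeries.X with hx
  set I : Ideal (PowerSeries K) := Ideal.span {PowerSeries.X} with hI
  have hmem : ∀ s : PowerSeries K, s ∈ I ↔ PowerSeries.constantCoeff s = 0 := by
    intro s
    rw [hI, Ideal.mem_span_singleton, PowerSeries.X_dvd_iff]
  have hxu : PowerSeries.constantCoeff x = u := by simp [hx]
  obtain ⟨z, hz1, hz2⟩ := HenselianRing.is_henselian (I := I) (fiberPoly k c x)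
    (fiberPoly_monic hk hc x).1 (PowerSeries.C y) (by
      rw [hmem, eval_fiberPoly, ← constHom_apply L, map_phi, constHom_apply, constHom_apply, hxu,
        PowerSeries.constantCoeff_C, h]) (by
      refine IsUnit.map _ ?_
      rw [PowerSeries.isUnit_iff_constantCoeff, eval_derivative_fiberPoly, ← constHom_apply L,
        map_ddY, constHom_apply, constHom_apply, hxu, PowerSeries.constantCoeff_C]
      exact h'.isUnit)
  refine ⟨z, ?_, ?_⟩
  · rw [hmem, map_sub, PowerSeries.constantCoeff_C] at hz2
    exact sub_eq_zero.1 hz2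
  · rw [← eval_fiberPoly]
    exact hz1

/-- Extraction of the leading coefficient of an element of filtration degree `D`, after
multiplication by the partial derivative `ddY`. -/
lemma exists_eq_X_mul {g : ℕ} (hg : g + k + 1 = k * k) {u y : K}
    {z : PowerSeries K} (hz0 : PowerSeries.constantCoeff z = y)
    (h : phi k c (PowerSeries.C u + PowerSeries.X) z = 0) (h0 : phi k c u y = 0)
    {D : ℕ} {s : PowerSeries K}
    (hs : s ∈ bifil L k 1 (PowerSeries.C u) (PowerSeries.C y) (PowerSeries.C u + PowerSeries.X)
      z D) :
    ∃ s' ∈ bifil L k 1 (PowerSeries.C u) (PowerSeries.C y) (PowerSeries.C u + PowerSeries.X)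
      z (D + g), (s - PowerSeries.C (PowerSeries.constantCoeff s)) *
        ddY k c (PowerSeries.C u) z (PowerSeries.C y) = PowerSeries.X * s' := by
  set x0 : PowerSeries K := PowerSeries.C u with hx0
  set z0 : PowerSeries K := PowerSeries.C y with hz0'
  set x : PowerSeries K := x0 + PowerSeries.X with hx
  set V := bifil L k 1 x0 z0 x z with hV
  have hF : IsFilt V := isFilt_bifil _ _ _ _
  have m1 : x0 ∈ V (1 * k) := by simpa using fst_mem_bifil (L := L) (k := k) (w := 1) x0 z0 x z
  have m2 : z0 ∈ V (1 * (k + 1)) := by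
    simpa using snd_mem_bifil (L := L) (k := k) (w := 1) x0 z0 x z
  have m3 : x ∈ V (1 * k) := fst_mem_bifil' x0 z0 x z
  have m4 : z ∈ V (1 * (k + 1)) := snd_mem_bifil' x0 z0 x z
  have hψ : ddY k c x0 z z0 ∈ V (g + k) := by
    simpa using hF.ddY_mem hg c m1 m4 m2
  have hχ : ddX k c x0 x z ∈ V (g + k + 1) := by
    simpa using hF.ddX_mem hg c m1 m3 m4
  have hrel : ddY k c x0 z z0 * (z - z0) = ddX k c x0 x z * (x0 - x) := by
    refine ddY_mul_eq_ddX_mul h ?_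
    let f : K →ₐ[L] PowerSeries K := (Algebra.ofId K (PowerSeries K)).restrictScalars L
    have h1 := map_phi k c u y f
    rw [h0, map_zero] at h1
    exact h1.symm
  rw [one_mul] at m1 m2 m3 m4
  induction hs using Submodule.span_induction with
  | mem s hs =>
    obtain ⟨a, b, a', b', hD, rfl⟩ := hs
    rw [one_mul] at hD
    have hconst : PowerSeries.C (PowerSeries.constantCoeff ((x0 ^ a * z0 ^ b) *
        (x ^ a' * z ^ b'))) = (x0 ^ a * z0 ^ b) * (x0 ^ a' * z0 ^ b') := by
      simp [hx0, hz0', hx, hz0]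
    rw [hconst]
    set S1 := ∑ j ∈ Finset.range a', x ^ j * x0 ^ (a' - 1 - j) with hS1
    set S2 := ∑ j ∈ Finset.range b', z ^ j * z0 ^ (b' - 1 - j) with hS2
    have e1 : S1 * (x - x0) = x ^ a' - x0 ^ a' := (Commute.all x x0).geom_sum₂_mul a'
    have e2 : S2 * (z - z0) = z ^ b' - z0 ^ b' := (Commute.all z z0).geom_sum₂_mul b'
    have hxX : x - x0 = PowerSeries.X := by rw [hx]; ring
    refine ⟨(x0 ^ a * z0 ^ b) * (S1 * z ^ b' * ddY k c x0 z z0) -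
      (x0 ^ a * z0 ^ b) * (x0 ^ a' * S2 * ddX k c x0 x z), ?_, ?_⟩
    · refine Submodule.sub_mem _ ?_ ?_
      · rcases a' with _ | n
        · simp [hS1]
        · refine hF.mono ?_ (hF.mul (hF.mul (hF.pow m1 a) (hF.pow m2 b))
            (hF.mul (hF.mul (hF.geom_sum m3 m1 (n + 1)) (hF.pow m4 b')) hψ))
          simp only [Nat.add_sub_cancel]
          nlinarith
      · rcases b' with _ | n
        · simp [hS2]
        · refine hF.mono ?_ (hF.mul (hF.mul (hF.pow m1 a) (hF.pow m2 b))
            (hF.mul (hF.mul (hF.pow m1 a') (hF.geom_sum m4 m2 (n + 1))) hχ))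
          simp only [Nat.add_sub_cancel]
          nlinarith
    · rw [← hxX]
      linear_combination (-(x0 ^ a * z0 ^ b) * ddY k c x0 z z0 * z ^ b') * e1 -
        (x0 ^ a * z0 ^ b) * x0 ^ a' * ddY k c x0 z z0 * e2 +
        (x0 ^ a * z0 ^ b) * x0 ^ a' * S2 * hrel
  | zero => exact ⟨0, zero_mem _, by simp⟩
  | add s t _ _ hs ht =>
    obtain ⟨s', hs', e1⟩ := hs
    obtain ⟨t', ht', e2⟩ := ht
    refine ⟨s' + t', add_mem hs' ht', ?_⟩
    rw [map_add, map_add]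
    linear_combination e1 + e2
  | smul r s _ hs =>
    obtain ⟨s', hs', e1⟩ := hs
    refine ⟨r • s', Submodule.smul_mem _ _ hs', ?_⟩
    have : PowerSeries.C (PowerSeries.constantCoeff (r • s)) =
        r • PowerSeries.C (PowerSeries.constantCoeff s) := by
      rw [← constHom_apply L, map_smul, constHom_apply]
      rw [Algebra.smul_def, Algebra.smul_def, map_mul]
      rw [PowerSeries.algebraMap_apply]
    rw [this, ← smul_sub, smul_mul_assoc, e1, mul_smul_comm]

end

section leading

variable {L K : Type*} [Field L] [Field K] [Algebra L K] {k : ℕ} {c : ℕ × ℕ → L}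

/-- The constant coefficient of an element of filtration degree `D` has filtration degree `D`. -/
lemma constantCoeff_mem_fil {u y : K} {z : PowerSeries K} (hz0 : PowerSeries.constantCoeff z = y)
    {D : ℕ} {s : PowerSeries K}
    (hs : s ∈ bifil L k 1 (PowerSeries.C u) (PowerSeries.C y) (PowerSeries.C u + PowerSeries.X)
      z D) : PowerSeries.constantCoeff s ∈ fil L k u y D := by
  have : bifil L k 1 (PowerSeries.C u) (PowerSeries.C y) (PowerSeries.C u + PowerSeries.X) z D ≤
      (fil L k u y D).comap (constHom L K).toLinearMap := by
    rw [bifil, Submodule.span_le]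
    rintro _ ⟨a, b, a', b', h, rfl⟩
    have := monomial_mem_fil (L := L) (k := k) u y (a := a + a') (b := b + b') (D := D)
      (by nlinarith)
    simp only [SetLike.mem_coe, Submodule.mem_comap, AlgHom.toLinearMap_apply, constHom_apply,
      map_mul, map_pow, map_add, PowerSeries.constantCoeff_C, PowerSeries.constantCoeff_X,
      add_zero, hz0]
    convert this using 1
    ring
  exact this hs

lemma exists_mul_pow_eq {g : ℕ} (hg : g + k + 1 = k * k) {u y : K}
    {z : PowerSeries K} (hz0 : PowerSeries.constantCoeff z = y)
    (h : phi k c (PowerSeries.C u + PowerSeries.X) z = 0) (h0 : phi k c u y = 0)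
    {D : ℕ} {s : PowerSeries K}
    (hs : s ∈ bifil L k 1 (PowerSeries.C u) (PowerSeries.C y) (PowerSeries.C u + PowerSeries.X)
      z D) (i : ℕ) (hi : ∀ j < i, PowerSeries.coeff j s = 0) :
    ∃ s' ∈ bifil L k 1 (PowerSeries.C u) (PowerSeries.C y) (PowerSeries.C u + PowerSeries.X)
      z (D + i * g), s * ddY k c (PowerSeries.C u) z (PowerSeries.C y) ^ i =
        PowerSeries.X ^ i * s' ∧
        PowerSeries.coeff i s * ddY k c u y y ^ i = PowerSeries.constantCoeff s' := by
  set ψ := ddY k c (PowerSeries.C u) z (PowerSeries.C y) with hψ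
  have hψ0 : PowerSeries.constantCoeff ψ = ddY k c u y y := by
    rw [hψ, ← constHom_apply L, map_ddY]
    simp [constHom_apply, hz0]
  have key : ∀ s' : PowerSeries K, s * ψ ^ i = PowerSeries.X ^ i * s' →
      PowerSeries.coeff i s * ddY k c u y y ^ i = PowerSeries.constantCoeff s' := by
    intro s' he
    obtain ⟨t, rfl⟩ := PowerSeries.X_pow_dvd_iff.2 hi
    have hX : (PowerSeries.X : PowerSeries K) ^ i ≠ 0 := pow_ne_zero _ PowerSeries.X_ne_zero
    have : t * ψ ^ i = s' := mul_left_cancel₀ hX (by rw [← he]; ring)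
    rw [PowerSeries.coeff_X_pow_mul', ← this, map_mul, map_pow, hψ0]
    simp
  suffices ∃ s' ∈ bifil L k 1 (PowerSeries.C u) (PowerSeries.C y)
      (PowerSeries.C u + PowerSeries.X) z (D + i * g), s * ψ ^ i = PowerSeries.X ^ i * s' by
    obtain ⟨s', h1, h2⟩ := this
    exact ⟨s', h1, h2, key s' h2⟩
  clear key
  induction i with
  | zero => exact ⟨s, by simpa using hs, by simp⟩
  | succ i ih =>
    obtain ⟨s', h1, h2⟩ := ih fun j hj => hi j (by omega)
    have hs'0 : PowerSeries.constantCoeff s' = 0 := by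
      obtain ⟨t, rfl⟩ := PowerSeries.X_pow_dvd_iff.2 hi
      have hX : (PowerSeries.X : PowerSeries K) ^ i ≠ 0 := pow_ne_zero _ PowerSeries.X_ne_zero
      have : PowerSeries.X * (t * ψ ^ i) = s' := mul_left_cancel₀ hX (by rw [← h2]; ring)
      rw [← this]
      simp
    obtain ⟨s'', h3, h4⟩ := exists_eq_X_mul hg hz0 h h0 h1
    refine ⟨s'', by convert h3 using 2; ring, ?_⟩
    rw [hs'0, map_zero, sub_zero] at h4
    rw [pow_succ ψ, ← mul_assoc, h2, mul_assoc, h4]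
    ring

end leading

section codimension

lemma finrank_le_finrank_comap_add {L E R : Type*} [Field L] [AddCommGroup E] [Module L E]
    [Module.Finite L E] [AddCommGroup R] [Module L R] (ρ : E →ₗ[L] R) (P : Submodule L R)
    (T : Finset R) (h : ∀ e, ρ e ∈ P ⊔ Submodule.span L (T : Set R)) :
    Module.finrank L E ≤ Module.finrank L (P.comap ρ) + T.card := by
  classical
  set f := P.mkQ ∘ₗ ρ with hf
  have hker : LinearMap.ker f = P.comap ρ := by
    rw [hf, LinearMap.ker_comp, Submodule.ker_mkQ]
  have hr : LinearMap.range f ≤ Submodule.span L (T.image P.mkQ : Set (R ⧸ P)) := by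
    rintro _ ⟨e, rfl⟩
    have h1 := Submodule.mem_map_of_mem (f := P.mkQ) (h e)
    rw [Submodule.map_sup, Submodule.mkQ_map_self, bot_sup_eq, Submodule.map_span] at h1
    rw [Finset.coe_image]
    exact h1
  have h2 := LinearMap.finrank_range_add_finrank_ker f
  have h3 : Module.finrank L (LinearMap.range f) ≤ T.card := by
    have : Module.Finite L (Submodule.span L (T.image P.mkQ : Set (R ⧸ P))) :=
      FiniteDimensional.span_finset L _
    exact (Submodule.finrank_mono hr).trans
      ((finrank_span_finset_le_card _).trans Finset.card_image_le)
  rw [hker] at h2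
  omega

variable {L A R : Type v} [Field L] [CommRing A] [Algebra L A] [CommRing R] [Algebra L R] {k : ℕ}
  {c : ℕ × ℕ → L} {u y : A}

/-- Replacing the weights `(1, q)` by `(1, 1)` only loses a finite-dimensional part. -/
lemma IsCurve.exists_bifil_le (h : IsCurve k c u y) (hk : 1 ≤ k) (hc : c (0, k) = 1)
    (f f' : A →ₐ[L] R) (q D m : ℕ) :
    ∃ T : Finset R, T.card ≤ ∑ j ∈ Finset.range m, q * (m - j) ∧
      bifil L k (q + 1) (f u) (f y) (f' u) (f' y) (D + q * m) ≤
        bifil L k 1 (f u) (f y) (f' u) (f' y) D ⊔ Submodule.span L (T : Set R) := by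
  classical
  have hβ : ∃ β : ℕ → A, (∀ i, β i ∈ fil L k u y i) ∧
      ∀ p : ℕ × Fin k, u ^ p.1 * y ^ (p.2 : ℕ) = β (k * p.1 + (k + 1) * (p.2 : ℕ)) := by
    refine ⟨fun i => if hi : ∃ p : ℕ × Fin k, k * p.1 + (k + 1) * (p.2 : ℕ) = i then
      u ^ hi.choose.1 * y ^ (hi.choose.2 : ℕ) else 0, fun i => ?_, fun p => ?_⟩
    · dsimp only
      split_ifs with hi
      · exact monomial_mem_fil u y hi.choose_spec.le
      · exact zero_mem _
    · have hi : ∃ p' : ℕ × Fin k, k * p'.1 + (k + 1) * (p'.2 : ℕ) =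
        k * p.1 + (k + 1) * (p.2 : ℕ) := ⟨p, rfl⟩
      dsimp only
      rw [dif_pos hi, weight_injective k hi.choose_spec]
  obtain ⟨β, hβ1, hβ2⟩ := hβ
  have hfil : ∀ N, fil L k u y N ≤ Submodule.span L (β '' Set.Iic N) := by
    intro N
    rw [h.fil_eq hk hc N]
    refine Submodule.span_mono ?_
    rintro _ ⟨p, hp, rfl⟩
    exact ⟨_, (mem_filIdx p).1 hp, (hβ2 p).symm⟩
  refine ⟨(Finset.range m).biUnion fun j =>
    (Finset.Ico (D + 1 - j) (D + q * m + 1 - (q + 1) * j)).image fun i => f (β i) * f' (β j),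
    ?_, ?_⟩
  · refine Finset.card_biUnion_le.trans (Finset.sum_le_sum fun j hj => ?_)
    refine Finset.card_image_le.trans ?_
    rw [Nat.card_Ico]
    obtain ⟨r, rfl⟩ : ∃ r, m = j + r := ⟨m - j, by have := Finset.mem_range.1 hj; omega⟩
    rw [Nat.add_sub_cancel_left, mul_add, add_mul]
    omega
  · rw [bifil, Submodule.span_le]
    rintro _ ⟨a, b, a', b', hw, rfl⟩
    set Q := bifil L k 1 (f u) (f y) (f' u) (f' y) D ⊔ Submodule.span L
      (((Finset.range m).biUnion fun j => (Finset.Ico (D + 1 - j)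
        (D + q * m + 1 - (q + 1) * j)).image fun i => f (β i) * f' (β j) : Finset R) : Set R)
    have key : ∀ i j, i + (q + 1) * j ≤ D + q * m → f (β i) * f' (β j) ∈ Q := by
      intro i j hij
      by_cases hD : i + j ≤ D
      · refine Submodule.mem_sup_left ?_
        have h1 := map_mem_fil f (hβ1 i)
        have h2 := map_mem_fil f' (hβ1 j)
        have h3 := Submodule.mul_mem_mul h1 h2
        rw [fil, fil, Submodule.span_mul_span] at h3
        refine Submodule.span_mono ?_ h3
        rintro _ ⟨_, ⟨e, g, h4, rfl⟩, _, ⟨e', g', h5, rfl⟩, rfl⟩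
        exact ⟨e, g, e', g', by omega, rfl⟩
      · refine Submodule.mem_sup_right (Submodule.subset_span ?_)
        have hj : j < m := by
          by_contra hj
          rw [not_lt] at hj
          have : q * m ≤ q * j := Nat.mul_le_mul_left q hj
          rw [add_mul] at hij
          omega
        simp only [Finset.mem_coe, Finset.mem_biUnion, Finset.mem_range, Finset.mem_image,
          Finset.mem_Ico]
        exact ⟨j, hj, i, ⟨by omega, by omega⟩, rfl⟩
    have h1 : u ^ a * y ^ b ∈ Submodule.span L (β '' Set.Iic (k * a + (k + 1) * b)) :=
      hfil _ (monomial_mem_fil u y le_rfl)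
    have h2 : u ^ a' * y ^ b' ∈ Submodule.span L (β '' Set.Iic (k * a' + (k + 1) * b')) :=
      hfil _ (monomial_mem_fil u y le_rfl)
    have h3 := Submodule.mem_map_of_mem (f := f.toLinearMap) h1
    have h4 := Submodule.mem_map_of_mem (f := f'.toLinearMap) h2
    rw [Submodule.map_span] at h3 h4
    have h5 := Submodule.mul_mem_mul h3 h4
    rw [Submodule.span_mul_span] at h5
    simp only [AlgHom.toLinearMap_apply, map_mul, map_pow] at h5
    refine Submodule.span_le.2 ?_ h5
    rintro _ ⟨_, ⟨_, ⟨i, hi, rfl⟩, rfl⟩, _, ⟨_, ⟨j, hj, rfl⟩, rfl⟩, rfl⟩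
    refine key i j (le_trans ?_ hw)
    exact add_le_add hi (Nat.mul_le_mul_left _ hj)

end codimension

section vanishing

variable {L A : Type v} [Field L] [CommRing A] [Algebra L A] {k : ℕ} {c : ℕ × ℕ → L} {u y : A}

lemma rootMultiplicity_fiberPoly (hk : 1 ≤ k) (hc : c (0, k) = 1) {a b : L}
    (h : ddY k c a b b ≠ 0) : (fiberPoly k c a).rootMultiplicity b ≤ 1 := by
  have hm : (fiberPoly k c a).Monic ∧ (fiberPoly k c a).natDegree = k := fiberPoly_monic hk hc a
  by_contra hlt
  rw [not_le] at hlt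
  refine h ?_
  rw [← eval_derivative_fiberPoly]
  exact ((one_lt_rootMultiplicity_iff_isRoot hm.1.ne_zero).1 hlt).2

/-- The elements whose expansion along an arc vanishes to order `m` form an ideal of colength at
least `m`. -/
lemma le_colen_comap (Θ : A →ₐ[L] PowerSeries L) {a : L}
    (hΘ : Θ u = PowerSeries.C a + PowerSeries.X) (m : ℕ) :
    (m : ℕ∞) ≤ colen L (Ideal.comap Θ (Ideal.span {PowerSeries.X ^ m})) := by
  let φ : A →ₗ[L] (Fin m → L) := LinearMap.pi fun j => (PowerSeries.coeff (j : ℕ)) ∘ₗ Θ.toLinearMap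
  have hφ : (Ideal.comap Θ (Ideal.span {PowerSeries.X ^ m})).restrictScalars L ≤
      LinearMap.ker φ := by
    intro x hx
    rw [Submodule.restrictScalars_mem, Ideal.mem_comap, Ideal.mem_span_singleton,
      PowerSeries.X_pow_dvd_iff] at hx
    rw [LinearMap.mem_ker]
    ext j
    exact hx j j.2
  have hs : Function.Surjective φ := by
    intro w
    refine ⟨∑ j : Fin m, w j • (u - algebraMap L A a) ^ (j : ℕ), ?_⟩
    have h1 : Θ (u - algebraMap L A a) = PowerSeries.X := by
      rw [map_sub, hΘ, AlgHom.commutes, PowerSeries.algebraMap_apply]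
      simp
    ext i
    simp only [φ, LinearMap.pi_apply, LinearMap.comp_apply, AlgHom.toLinearMap_apply, map_sum,
      map_smul, map_pow, h1, PowerSeries.coeff_X_pow, smul_eq_mul, mul_ite, mul_one, mul_zero]
    rw [Finset.sum_eq_single i]
    · simp
    · intro j _ hj
      rw [if_neg]
      exact fun h => hj (Fin.ext h.symm)
    · simp
  have h2 : Module.length L (Fin m → L) = m := by
    rw [Module.length_pi]
    simp
  rw [← h2]
  refine Module.length_le_of_surjective
    (((Ideal.comap Θ (Ideal.span {PowerSeries.X ^ m})).restrictScalars L).liftQ φ hφ) ?_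
  intro w
  obtain ⟨x, rfl⟩ := hs w
  exact ⟨Submodule.Quotient.mk x, rfl⟩

/-- An auxiliary function of small degree which vanishes along an arc to high order and at a further
point is zero. -/
lemma IsCurve.eq_zero_of_mem [IsDomain A] (h : IsCurve k c u y) (hk : 1 ≤ k) (hc : c (0, k) = 1)
    {u0 u1 y0 : L} (hne : u0 ≠ u1) (h0 : ddY k c u0 y0 y0 ≠ 0) (Θ : A →ₐ[L] PowerSeries L)
    (hΘ : Θ u = PowerSeries.C u1 + PowerSeries.X) {n m a : ℕ} (hm : a + n < m) {T : A}
    (hT : T ∈ fil L k u y (a + n * k))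
    (h1 : T * (y - algebraMap L A y0) ^ n ∈ Ideal.span {(u - algebraMap L A u0) ^ n})
    (h2 : PowerSeries.X ^ m ∣ Θ T) : T = 0 := by
  by_contra hT0
  set I := quot (Ideal.span {(u - algebraMap L A u0) ^ n}) ((y - algebraMap L A y0) ^ n) with hI
  set J := Ideal.comap Θ (Ideal.span {PowerSeries.X ^ m}) with hJ
  have hcop : IsCoprime I J := by
    have e1 : IsCoprime (u - algebraMap L A u0) (u - algebraMap L A u1) := by
      have hne' : u1 - u0 ≠ 0 := _root_.sub_ne_zero.2 hne.symm
      refine ⟨algebraMap L A (u1 - u0)⁻¹, -algebraMap L A (u1 - u0)⁻¹, ?_⟩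
      have := congrArg (algebraMap L A) (inv_mul_cancel₀ hne')
      rw [map_mul, map_sub, map_one] at this
      linear_combination this
    have e2 := e1.pow (m := n) (n := m)
    rw [Ideal.isCoprime_iff_exists]
    obtain ⟨α, β, hαβ⟩ := e2
    refine ⟨α * (u - algebraMap L A u0) ^ n, ?_, β * (u - algebraMap L A u1) ^ m, ?_, hαβ⟩
    · rw [hI, mem_quot, mul_assoc, mul_left_comm]
      exact Ideal.mul_mem_right _ _ (Ideal.mem_span_singleton_self _)
    · rw [hJ, Ideal.mem_comap, map_mul, map_pow]
      have : Θ (u - algebraMap L A u1) = PowerSeries.X := by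
        rw [map_sub, hΘ, AlgHom.commutes, PowerSeries.algebraMap_apply]
        simp
      rw [this]
      exact Ideal.mul_mem_left _ _ (Ideal.mem_span_singleton_self _)
  have hTI : T ∈ I := h1
  have hTJ : T ∈ J := by
    rw [hJ, Ideal.mem_comap, Ideal.mem_span_singleton]
    exact h2
  have e3 : colen L I + colen L J ≤ colen L (Ideal.span {T}) :=
    colen_add_le_of_isCoprime ((Ideal.span_singleton_le_iff_mem _).2 hTI)
      ((Ideal.span_singleton_le_iff_mem _).2 hTJ) hcop
  have e4 : colen L (Ideal.span {T}) ≤ ((a + n * k : ℕ) : ℕ∞) :=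
    h.colen_le hk hc hT0 hT (Ideal.mem_span_singleton_self T)
  have e5 : ((n * k : ℕ) : ℕ∞) ≤ colen L I + n := by
    refine (le_colen_span_pow (h.sub_ne_zero hk u0) (h.colen_fiber hk hc u0) n).trans ?_
    rw [colen_eq_add (fun x => mem_quot (z := (y - algebraMap L A y0) ^ n) (h := x))]
    refine add_le_add le_rfl ((h.colen_pow_pow_le_left hk hc u0 y0 n).trans ?_)
    exact_mod_cast (Nat.mul_le_mul_left n (rootMultiplicity_fiberPoly hk hc h0)).trans (by simp)
  have e6 : (m : ℕ∞) ≤ colen L J := le_colen_comap Θ hΘ m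
  have e7 : ((n * k + m : ℕ) : ℕ∞) ≤ ((a + n * k + n : ℕ) : ℕ∞) := by
    push_cast at *
    calc ((n : ℕ∞) * k + m) ≤ (colen L I + n) + colen L J := add_le_add e5 e6
      _ = (colen L I + colen L J) + n := by ring
      _ ≤ _ := add_le_add (e3.trans e4) le_rfl
  have e8 : n * k + m ≤ a + n * k + n := by exact_mod_cast e7
  omega

lemma sum_pow_eq_zero {K C : Type*} [Field K] [CommRing C] [IsDomain C] [Algebra K C]
    (ev : C →ₐ[K] K) {p ψ : C} (hp : p ≠ 0) (hp0 : ev p = 0) (hψ : ev ψ ≠ 0) (n : ℕ) (r : ℕ → K)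
    (b : C) (h : ∑ i ∈ Finset.range n, r i • (ψ ^ (i + 1) * p ^ (n - 1 - i)) + b * p ^ n = 0) :
    (∀ i < n, r i = 0) ∧ b = 0 := by
  induction n with
  | zero => simpa using h
  | succ n ih =>
    have e : ∑ i ∈ Finset.range n, r i • (ψ ^ (i + 1) * p ^ (n + 1 - 1 - i)) =
        (∑ i ∈ Finset.range n, r i • (ψ ^ (i + 1) * p ^ (n - 1 - i))) * p := by
      rw [Finset.sum_mul]
      refine Finset.sum_congr rfl fun i hi => ?_
      rw [smul_mul_assoc, mul_assoc, ← pow_succ]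
      congr 3
      have := Finset.mem_range.1 hi
      omega
    rw [Finset.sum_range_succ, e] at h
    have hr : r n = 0 := by
      have := congrArg ev h
      simp only [Nat.add_sub_cancel, Nat.sub_self, pow_zero, mul_one, map_add, map_mul, hp0,
        mul_zero, map_smul, map_pow, zero_add, smul_eq_mul, map_zero, ne_eq, Nat.add_eq_zero_iff,
        one_ne_zero, and_false, not_false_eq_true, zero_pow, add_zero] at this
      exact (mul_eq_zero.1 this).resolve_right (pow_ne_zero _ hψ)
    rw [hr, zero_smul, add_zero, pow_succ, ← mul_assoc, ← add_mul] at h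
    obtain ⟨h1, h2⟩ := ih ((mul_eq_zero.1 h).resolve_right hp)
    refine ⟨fun i hi => ?_, h2⟩
    rcases Nat.lt_succ_iff_lt_or_eq.1 hi with hi | rfl
    exacts [h1 i hi, hr]

end vanishing

section forms

lemma finrank_le_sum_of_forms {L E K : Type*} [Field L] [AddCommGroup E] [Module L E]
    [Module.Finite L E] [AddCommGroup K] [Module L K] (ℓ : ℕ → E →ₗ[L] K) (m : ℕ)
    (hinj : ∀ e, (∀ j < m, ℓ j e = 0) → e = 0) (N : ℕ → ℝ)
    (hN : ∀ i < m, ∀ V : Submodule L E, (∀ e ∈ V, ∀ j < i, ℓ j e = 0) →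
      (Module.finrank L (V.map (ℓ i)) : ℝ) ≤ N i) :
    (Module.finrank L E : ℝ) ≤ ∑ i ∈ Finset.range m, N i := by
  have key : ∀ i ≤ m, ∃ V : Submodule L E, (∀ e ∈ V, ∀ j < i, ℓ j e = 0) ∧
      (Module.finrank L E : ℝ) ≤ ∑ j ∈ Finset.range i, N j + Module.finrank L V := by
    intro i
    induction i with
    | zero => exact fun _ => ⟨⊤, by simp, by simp⟩
    | succ i ih =>
      intro hi
      obtain ⟨V, h1, h2⟩ := ih (by omega)
      refine ⟨V ⊓ LinearMap.ker (ℓ i), ?_, ?_⟩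
      · rintro e ⟨he, he'⟩ j hj
        rcases Nat.lt_succ_iff_lt_or_eq.1 hj with hj | rfl
        exacts [h1 e he j hj, he']
      · have h3 := LinearMap.finrank_range_add_finrank_ker ((ℓ i).domRestrict V)
        rw [LinearMap.range_domRestrict, LinearMap.ker_domRestrict] at h3
        have h4 : Module.finrank L ((LinearMap.ker (ℓ i)).submoduleOf V) =
            Module.finrank L (V ⊓ LinearMap.ker (ℓ i) : Submodule L E) := by
          have h := Submodule.finrank_map_subtype_eq V ((LinearMap.ker (ℓ i)).submoduleOf V)
          rw [Submodule.submoduleOf, Submodule.map_comap_subtype] at h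
          exact h.symm
        have h5 := hN i (by omega) V h1
        rw [Finset.sum_range_succ]
        have h6 : (Module.finrank L V : ℝ) = Module.finrank L (V.map (ℓ i)) +
            Module.finrank L (V ⊓ LinearMap.ker (ℓ i) : Submodule L E) := by
          rw [← h4]
          exact_mod_cast h3.symm
        linarith
  obtain ⟨V, h1, h2⟩ := key m le_rfl
  have : V = ⊥ := by
    rw [Submodule.eq_bot_iff]
    exact fun e he => hinj e (h1 e he)
  subst this
  simpa using h2

end forms

/-- `h` is the normalized coefficient in degree `i` of a function on the square of the curve which
vanishes to order `i` along the diagonal. -/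
def IsLead {L K : Type*} [Field L] [Field K] [Algebra L K] (k : ℕ) (c : ℕ × ℕ → L) (u y : K)
    (z : PowerSeries K) (i : ℕ) (h : K) : Prop :=
  ∃ D, ∃ s ∈ bifil L k 1 (PowerSeries.C u) (PowerSeries.C y) (PowerSeries.C u + PowerSeries.X) z D,
    (∀ j < i, PowerSeries.coeff j s = 0) ∧ PowerSeries.coeff i s * ddY k c u y y ^ i = h

lemma coeff_mul_of_vanishing {K : Type*} [Field K] {i : ℕ} {s : PowerSeries K}
    (h : ∀ j < i, PowerSeries.coeff j s = 0) (t : PowerSeries K) :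
    PowerSeries.coeff i (s * t) = PowerSeries.coeff i s * PowerSeries.constantCoeff t := by
  obtain ⟨s, rfl⟩ := PowerSeries.X_pow_dvd_iff.2 h
  rw [mul_assoc, PowerSeries.coeff_X_pow_mul', PowerSeries.coeff_X_pow_mul']
  simp

section counting

variable {F B K A : Type v} [Field F] [CommRing B] [Algebra F B] [Field K] [Algebra F K]
  [CommRing A] [Algebra K A] {k : ℕ} {c : ℕ × ℕ → F} {u y : B} {U Y : A}

lemma exists_mem_fil_of_map (f : B →ₐ[F] K) {D : ℕ} {x : K}
    (hx : x ∈ fil F k (f u) (f y) D) : ∃ b ∈ fil F k u y D, f b = x := by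
  have : fil F k (f u) (f y) D ≤ (fil F k u y D).map f.toLinearMap := by
    rw [fil, Submodule.span_le]
    rintro _ ⟨a, b, h, rfl⟩
    exact ⟨u ^ a * y ^ b, monomial_mem_fil u y h, by simp⟩
  obtain ⟨b, hb, rfl⟩ := this hx
  exact ⟨b, hb, rfl⟩

/-- The normalized leading coefficient of a function on the square of the curve. -/
lemma IsCurve.exists_lead (h : IsCurve k c u y)
    {g : ℕ} (hg : g + k + 1 = k * k)
    (f : B →ₐ[F] K) (hf : Function.Injective f)
    {z : PowerSeries K} (hz0 : PowerSeries.constantCoeff z = f y)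
    (hz : phi k c (PowerSeries.C (f u) + PowerSeries.X) z = 0)
    {u0 y0 : B} (hne : f u0 ≠ f u) {n N D i : ℕ} {s t : PowerSeries K}
    (hs : s ∈ bifil F k 1 (PowerSeries.C (f u)) (PowerSeries.C (f y))
      (PowerSeries.C (f u) + PowerSeries.X) z N)
    (ht : t ∈ bifil F k 1 (PowerSeries.C (f u)) (PowerSeries.C (f y))
      (PowerSeries.C (f u) + PowerSeries.X) z D)
    (hst : s * (z - PowerSeries.C (f y0)) ^ n =
      t * (PowerSeries.C (f u) + PowerSeries.X - PowerSeries.C (f u0)) ^ n)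
    (hv : ∀ j < i, PowerSeries.coeff j s = 0) :
    ∃ b ∈ fil F k u y (N + i * g), f b = PowerSeries.coeff i s * ddY k c (f u) (f y) (f y) ^ i ∧
      IsLead k c (f u) (f y) z i (f b) ∧ ∃ b', b * (y - y0) ^ n = b' * (u - u0) ^ n := by
  have hphi : phi k c (f u) (f y) = 0 := by rw [← map_phi, h.rel, map_zero]
  set x : PowerSeries K := PowerSeries.C (f u) + PowerSeries.X with hx
  obtain ⟨s', h1, -, h2⟩ := exists_mul_pow_eq hg hz0 hz hphi hs i hv
  obtain ⟨b, hb, hb'⟩ := exists_mem_fil_of_map f (constantCoeff_mem_fil hz0 h1)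
  refine ⟨b, hb, by rw [hb', h2], ⟨N, s, hs, hv, by rw [hb', h2]⟩, ?_⟩
  have h5 : PowerSeries.constantCoeff (x - PowerSeries.C (f u0)) ≠ 0 := by
    simpa [hx, _root_.sub_ne_zero] using hne.symm
  have h6 : ∀ j < i, PowerSeries.coeff j t = 0 := by
    rw [← PowerSeries.X_pow_dvd_iff]
    have h7 : IsUnit ((x - PowerSeries.C (f u0)) ^ n) :=
      (PowerSeries.isUnit_iff_constantCoeff.2 h5.isUnit).pow n
    rw [← h7.dvd_mul_right, ← hst]
    exact (PowerSeries.X_pow_dvd_iff.2 hv).mul_right _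
  obtain ⟨t', h8, -, h9⟩ := exists_mul_pow_eq hg hz0 hz hphi ht i h6
  obtain ⟨b', -, hb''⟩ := exists_mem_fil_of_map f (constantCoeff_mem_fil hz0 h8)
  refine ⟨b', hf ?_⟩
  have h10 := congrArg (PowerSeries.coeff i) hst
  rw [coeff_mul_of_vanishing hv, coeff_mul_of_vanishing h6] at h10
  simp only [map_pow, map_sub, PowerSeries.constantCoeff_C, hz0, hx, map_add,
    PowerSeries.constantCoeff_X, add_zero] at h10
  rw [map_mul, map_mul, hb', hb'', ← h2, ← h9]
  simp only [map_pow, map_sub]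
  linear_combination ddY k c (f u) (f y) (f y) ^ i * h10

/-- Bound for the dimension of a space of functions on the square of the curve in terms of their
leading coefficients along the diagonal. -/
lemma IsCurve.finrank_le_of_lead (h : IsCurve k c u y) (hk : 1 ≤ k) (hc : c (0, k) = 1)
    {g : ℕ} (hg : g + k + 1 = k * k)
    (f : B →ₐ[F] K) (hf : Function.Injective f)
    {z : PowerSeries K} (hz0 : PowerSeries.constantCoeff z = f y)
    (hz : phi k c (PowerSeries.C (f u) + PowerSeries.X) z = 0)
    (hψ : ddY k c (f u) (f y) (f y) ≠ 0)
    {u0 y0 : B} (hne : f u0 ≠ f u) {n m N : ℕ}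
    {E : Type v} [AddCommGroup E] [Module F E] [Module.Finite F E] (ρ : E →ₗ[F] PowerSeries K)
    (hρ : ∀ e, ρ e ∈ bifil F k 1 (PowerSeries.C (f u)) (PowerSeries.C (f y))
      (PowerSeries.C (f u) + PowerSeries.X) z N)
    (hρ' : ∀ e, ∃ D, ∃ t ∈ bifil F k 1 (PowerSeries.C (f u)) (PowerSeries.C (f y))
      (PowerSeries.C (f u) + PowerSeries.X) z D,
      ρ e * (z - PowerSeries.C (f y0)) ^ n =
        t * (PowerSeries.C (f u) + PowerSeries.X - PowerSeries.C (f u0)) ^ n)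
    (hinj : ∀ e, (∀ j < m, PowerSeries.coeff j (ρ e) = 0) → e = 0)
    (M : ℕ → ℝ)
    (hM : ∀ i < m, ∀ L : Submodule F B, L ≤ fil F k u y (N + i * g) →
      (∀ x ∈ L, IsLead k c (f u) (f y) z i (f x) ∧ ∃ x', x * (y - y0) ^ n = x' * (u - u0) ^ n) →
      (Module.finrank F L : ℝ) ≤ M i) :
    (Module.finrank F E : ℝ) ≤ ∑ i ∈ Finset.range m, M i := by
  let ℓ : ℕ → E →ₗ[F] K := fun i =>
    { toFun := fun e => PowerSeries.coeff i (ρ e) * ddY k c (f u) (f y) (f y) ^ i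
      map_add' := fun e e' => by rw [map_add, map_add, add_mul]
      map_smul' := fun r e => by
        rw [map_smul, ← algebraMap_smul K r (ρ e), map_smul, algebraMap_smul, smul_mul_assoc,
          RingHom.id_apply] }
  have hℓ : ∀ i e, ℓ i e = PowerSeries.coeff i (ρ e) * ddY k c (f u) (f y) (f y) ^ i :=
    fun i e => rfl
  clear_value ℓ
  have hℓ0 : ∀ i e, ℓ i e = 0 → PowerSeries.coeff i (ρ e) = 0 := fun i e he =>
    (mul_eq_zero.1 ((hℓ i e).symm.trans he)).resolve_right (pow_ne_zero _ hψ)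
  refine finrank_le_sum_of_forms (L := F) (E := E) (K := K) ℓ m
    (fun e he => hinj e fun j hj => hℓ0 j e (he j hj)) M fun i hi V' hV' => ?_
  have hmem : ∀ e ∈ V', ∃ b ∈ fil F k u y (N + i * g), f b = ℓ i e ∧
      IsLead k c (f u) (f y) z i (f b) ∧ ∃ b', b * (y - y0) ^ n = b' * (u - u0) ^ n := by
    intro e he
    obtain ⟨D, t, ht, hst⟩ := hρ' e
    rw [hℓ]
    exact h.exists_lead hg f hf hz0 hz hne (hρ e) ht hst fun j hj => hℓ0 j e (hV' e he j hj)
  set L := (V'.map (ℓ i)).comap f.toLinearMap with hL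
  have hL1 : V'.map (ℓ i) ≤ L.map f.toLinearMap := by
    rintro _ ⟨e, he, rfl⟩
    obtain ⟨b, hb, hb', -⟩ := hmem e he
    exact ⟨b, ⟨e, he, hb'.symm⟩, hb'⟩
  have hL2 : ∀ b ∈ L, ∃ e ∈ V', ℓ i e = f b := fun b hb => hb
  have hL3 : L ≤ fil F k u y (N + i * g) := by
    intro b hb
    obtain ⟨e, he, heb⟩ := hL2 b hb
    obtain ⟨b', hb1, hb2, -⟩ := hmem e he
    rwa [← hf (hb2.trans heb)]
  have : Module.Finite F (fil F k u y (N + i * g)) := h.finite_fil hk hc _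
  have hfin : Module.Finite F L := Submodule.finiteDimensional_of_le hL3
  have hfin' : Module.Finite F (L.map f.toLinearMap) := Module.Finite.map _ _
  have h11 : Module.finrank F (V'.map (ℓ i)) ≤ Module.finrank F L :=
    (Submodule.finrank_mono hL1).trans (Submodule.finrank_map_le _ _)
  refine le_trans (by exact_mod_cast h11) (hM i hi L hL3 fun b hb => ?_)
  obtain ⟨e, he, heb⟩ := hL2 b hb
  obtain ⟨b', hb1, hb2, hb3⟩ := hmem e he
  rw [← hf (hb2.trans heb)]
  exact hb3

/-- Variant of `IsCurve.finrank_le_of_lead` for functions of bounded degree in different weights. -/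
lemma IsCurve.finrank_le_of_lead' (h : IsCurve k c u y) (hk : 1 ≤ k) (hc : c (0, k) = 1)
    {g : ℕ} (hg : g + k + 1 = k * k)
    (f : B →ₐ[F] K) (hf : Function.Injective f)
    {z : PowerSeries K} (hz0 : PowerSeries.constantCoeff z = f y)
    (hz : phi k c (PowerSeries.C (f u) + PowerSeries.X) z = 0)
    (hψ : ddY k c (f u) (f y) (f y) ≠ 0)
    {u0 y0 : B} (hne : f u0 ≠ f u) {n m N q : ℕ}
    {E : Type v} [AddCommGroup E] [Module F E] [Module.Finite F E] (ρ : E →ₗ[F] PowerSeries K)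
    (hρ : ∀ e, ρ e ∈ bifil F k (q + 1) (PowerSeries.C (f u)) (PowerSeries.C (f y))
      (PowerSeries.C (f u) + PowerSeries.X) z (N + q * m))
    (hρ' : ∀ e, ∃ D, ∃ t ∈ bifil F k 1 (PowerSeries.C (f u)) (PowerSeries.C (f y))
      (PowerSeries.C (f u) + PowerSeries.X) z D,
      ρ e * (z - PowerSeries.C (f y0)) ^ n =
        t * (PowerSeries.C (f u) + PowerSeries.X - PowerSeries.C (f u0)) ^ n)
    (hinj : ∀ e, (∀ j < m, PowerSeries.coeff j (ρ e) = 0) → e = 0)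
    (M : ℕ → ℝ)
    (hM : ∀ i < m, ∀ L : Submodule F B, L ≤ fil F k u y (N + i * g) →
      (∀ x ∈ L, IsLead k c (f u) (f y) z i (f x) ∧ ∃ x', x * (y - y0) ^ n = x' * (u - u0) ^ n) →
      (Module.finrank F L : ℝ) ≤ M i) :
    (Module.finrank F E : ℝ) ≤
      ∑ i ∈ Finset.range m, M i + ∑ i ∈ Finset.range m, (q * (m - i) : ℕ) := by
  let fc : B →ₐ[F] PowerSeries K := ((Algebra.ofId K (PowerSeries K)).restrictScalars F).comp f
  obtain ⟨fθ, hθ1, hθ2⟩ := h.lift (PowerSeries K) _ z hz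
  obtain ⟨S, hS1, hS2⟩ := h.exists_bifil_le hk hc fc fθ q N m
  rw [hθ1, hθ2] at hS2
  have e1 := finrank_le_finrank_comap_add ρ _ S fun e => hS2 (hρ e)
  set W := (bifil F k 1 (fc u) (fc y) (PowerSeries.C (f u) + PowerSeries.X) z N).comap ρ with hW
  have hW' : ∀ e ∈ W, ρ e ∈ bifil F k 1 (PowerSeries.C (f u)) (PowerSeries.C (f y))
    (PowerSeries.C (f u) + PowerSeries.X) z N := fun e he => he
  clear_value W
  have e2 : (Module.finrank F W : ℝ) ≤ ∑ i ∈ Finset.range m, M i :=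
    h.finrank_le_of_lead hk hc hg f hf hz0 hz hψ hne (ρ.comp W.subtype) (fun e => hW' e e.2)
      (fun e => hρ' e) (fun e he => Subtype.ext (hinj e he)) M hM
  have e3 : (Module.finrank F E : ℝ) ≤
      Module.finrank F W + ∑ i ∈ Finset.range m, (q * (m - i) : ℕ) := by
    have := e1.trans (Nat.add_le_add_left hS1 _)
    exact_mod_cast this
  linarith

/-- The basic inequality of the polynomial method: the dimension of a space of auxiliary functions
is at most the number of conditions for vanishing to order `m` along the diagonal. -/
theorem IsCurve.sum_finrank_le [IsDomain A] (h : IsCurve k c u y) (hk : 1 ≤ k) (hc : c (0, k) = 1)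
    {g : ℕ} (hg : g + k + 1 = k * k)
    (f : B →ₐ[F] K) (hf : Function.Injective f) (hC : IsCurve k (algebraMap F K ∘ c) U Y)
    {z : PowerSeries K} (hz0 : PowerSeries.constantCoeff z = f y)
    (hz : phi k c (PowerSeries.C (f u) + PowerSeries.X) z = 0)
    (hψ : ddY k c (f u) (f y) (f y) ≠ 0)
    (Θ : A →ₐ[K] PowerSeries K)
    (hU : Θ U = PowerSeries.C (f u) + PowerSeries.X) (hY : Θ Y = z)
    {u0 y0 : B} (hne : f u0 ≠ f u) (h0 : ddY k c (f u0) (f y0) (f y0) ≠ 0)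
    {n m a : ℕ} (hm : a + n < m)
    {ι : Type v} [Fintype ι] (T T' : ι → A)
    (hT : ∀ j, T j ∈ fil K k U Y (a + n * k))
    (hT1 : ∀ j, T j * (Y - algebraMap K A (f y0)) ^ n = T' j * (U - algebraMap K A (f u0)) ^ n)
    (hT2 : ∀ r : ι → K, ∑ j, r j • T j = 0 → r = 0)
    (V : ι → Submodule F B) (hV : ∀ j, Module.Finite F (V j)) {N q : ℕ}
    (hVT : ∀ j, ∀ x ∈ V j, f x • Θ (T j) ∈ bifil F k (q + 1) (PowerSeries.C (f u))
      (PowerSeries.C (f y)) (PowerSeries.C (f u) + PowerSeries.X) z (N + q * m))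
    (hVT' : ∀ j, ∀ x ∈ V j, ∃ D, f x • Θ (T' j) ∈ bifil F k 1 (PowerSeries.C (f u))
      (PowerSeries.C (f y)) (PowerSeries.C (f u) + PowerSeries.X) z D)
    (M : ℕ → ℝ)
    (hM : ∀ i < m, ∀ L : Submodule F B, L ≤ fil F k u y (N + i * g) →
      (∀ x ∈ L, IsLead k c (f u) (f y) z i (f x) ∧ ∃ x', x * (y - y0) ^ n = x' * (u - u0) ^ n) →
      (Module.finrank F L : ℝ) ≤ M i) :
    (∑ j, (Module.finrank F (V j) : ℝ)) ≤
      ∑ i ∈ Finset.range m, M i + ∑ i ∈ Finset.range m, (q * (m - i) : ℕ) := by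
  let ρ : (Π j, V j) →ₗ[F] PowerSeries K :=
    { toFun := fun e => ∑ j, f (e j : B) • Θ (T j)
      map_add' := fun e e' => by simp [add_smul, Finset.sum_add_distrib]
      map_smul' := fun r e => by simp [Finset.smul_sum] }
  have hρ : ∀ e, ρ e = ∑ j, f (e j : B) • Θ (T j) := fun e => rfl
  clear_value ρ
  have e0 : (∑ j, (Module.finrank F (V j) : ℝ)) = Module.finrank F (Π j, V j) := by
    rw [Module.finrank_pi_fintype]
    push_cast
    rfl
  rw [e0]
  refine h.finrank_le_of_lead' hk hc hg f hf hz0 hz hψ hne (q := q) (m := m) (n := n) ρ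
    (fun e => ?_) (fun e => ?_) (fun e he => ?_) M hM
  · rw [hρ]
    exact Submodule.sum_mem _ fun j _ => hVT j _ (e j).2
  · choose D hD using fun j => hVT' j _ (e j).2
    refine ⟨∑ j, D j, ∑ j, f (e j : B) • Θ (T' j),
      Submodule.sum_mem _ fun j _ => (isFilt_bifil _ _ _ _).mono
        (Finset.single_le_sum (fun _ _ => Nat.zero_le _) (Finset.mem_univ j)) (hD j), ?_⟩
    rw [hρ, Finset.sum_mul, Finset.sum_mul]
    refine Finset.sum_congr rfl fun j _ => ?_
    have := congrArg Θ (hT1 j)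
    simp only [map_mul, map_pow, map_sub, hU, hY, AlgHom.commutes,
      PowerSeries.algebraMap_apply, Algebra.algebraMap_self, RingHom.id_apply] at this
    rw [smul_mul_assoc, smul_mul_assoc, this]
  · have e3 : ∑ j, f (e j : B) • T j = 0 := by
      refine hC.eq_zero_of_mem hk (by simp [hc]) hne (by rwa [ddY_algebraMap]) Θ hU hm
        (Submodule.sum_mem _ fun j _ => Submodule.smul_mem _ _ (hT j)) (y0 := f y0) ?_ ?_
      · rw [Finset.sum_mul]
        refine Ideal.sum_mem _ fun j _ => ?_
        rw [smul_mul_assoc, hT1, Algebra.smul_def]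
        exact Ideal.mul_mem_left _ _ (Ideal.mul_mem_left _ _ (Ideal.mem_span_singleton_self _))
      · rw [PowerSeries.X_pow_dvd_iff]
        intro j hj
        have := he j hj
        rw [hρ] at this
        rw [← this, map_sum]
        simp only [map_smul]
    have e4 := hT2 _ e3
    refine funext fun j => Subtype.ext (hf ?_)
    rw [Pi.zero_apply, ZeroMemClass.coe_zero, map_zero]
    exact congrFun e4 j

end counting

section

variable {F B K A : Type v} [Field F] [CommRing B] [Algebra F B] [Field K] [Algebra F K]
  [CommRing A] [Algebra K A] {k : ℕ} {c : ℕ × ℕ → F} {u y : B} {U Y : A}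

lemma smul_mem_bifil (f : B →ₐ[F] K) {w D D' : ℕ} {x : B} (hx : x ∈ fil F k u y D)
    {z x' s : PowerSeries K}
    (hs : s ∈ bifil F k w (PowerSeries.C (f u)) (PowerSeries.C (f y)) x' z D') :
    f x • s ∈ bifil F k w (PowerSeries.C (f u)) (PowerSeries.C (f y)) x' z (D + D') := by
  let fc : B →ₐ[F] PowerSeries K := ((Algebra.ofId K (PowerSeries K)).restrictScalars F).comp f
  have h1 : fc x ∈ bifil F k w (fc u) (fc y) x' z D := by
    refine Submodule.span_mono ?_ (map_mem_fil fc hx)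
    rintro _ ⟨a, b, h, rfl⟩
    exact ⟨a, b, 0, 0, by simpa using h, by simp⟩
  rw [Algebra.smul_def]
  exact (isFilt_bifil _ _ _ _).mul h1 hs

lemma IsCurve.aux_indep [IsDomain A] {c : ℕ × ℕ → K} (hC : IsCurve k c U Y) (hk : 1 ≤ k)
    {u0 y0 : K} (h1 : phi k c u0 y0 = 0) (h0 : ddY k c u0 y0 y0 ≠ 0) {s n : ℕ}
    (p : Fin s → ℕ × Fin k) (hp : Function.Injective p)
    (r : Fin s ⊕ Fin n → K)
    (hr : ∑ l, r (Sum.inl l) • (U ^ (p l).1 * Y ^ ((p l).2 : ℕ) * (U - algebraMap K A u0) ^ n) +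
      ∑ i, r (Sum.inr i) • (ddY k c (algebraMap K A u0) Y (algebraMap K A y0) ^ ((i : ℕ) + 1) *
        (U - algebraMap K A u0) ^ (n - 1 - i)) = 0) : r = 0 := by
  obtain ⟨ev, hev1, hev2⟩ := hC.lift K u0 y0 h1
  set P := U - algebraMap K A u0 with hP
  set ψ := ddY k c (algebraMap K A u0) Y (algebraMap K A y0) with hψ
  have h3 : ev P = 0 := by rw [hP, map_sub, hev1, AlgHom.commutes]; simp
  have h4 : ev ψ ≠ 0 := by
    rw [hψ, map_ddY, hev2, AlgHom.commutes, AlgHom.commutes]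
    exact h0
  have h5 := sum_pow_eq_zero ev (hC.sub_ne_zero hk u0) h3 h4 n
    (fun i => if h : i < n then r (Sum.inr ⟨i, h⟩) else 0)
    (∑ l, r (Sum.inl l) • (U ^ (p l).1 * Y ^ ((p l).2 : ℕ))) (by
      rw [Finset.sum_range, Finset.sum_mul, add_comm, ← hr]
      congr 1
      · exact Finset.sum_congr rfl fun l _ => smul_mul_assoc _ _ _
      · exact Finset.sum_congr rfl fun i _ => by simp [hP])
  have h6 : LinearIndependent K (fun l => U ^ (p l).1 * Y ^ ((p l).2 : ℕ)) := by
    simpa [Function.comp_def] using hC.indep.comp p hp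
  have h7 := Fintype.linearIndependent_iff.1 h6 _ h5.2
  funext j
  rcases j with l | i
  · exact h7 l
  · simpa using h5.1 i i.2

set_option maxHeartbeats 2000000 in
/-- The polynomial method for the graph of Frobenius on a plane curve, before the asymptotic
analysis of the parameters. -/
theorem IsCurve.sum_le_sum [Fintype F] (h : IsCurve k c u y) (hk : 1 ≤ k) (hc : c (0, k) = 1)
    {g q : ℕ} (hg : g + k + 1 = k * k) (hq : Fintype.card F = q + 1)
    (f : B →ₐ[F] K) (hf : Function.Injective f)
    (hirr : Irreducible (poly k (algebraMap F K ∘ c)))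
    {z : PowerSeries K} (hz0 : PowerSeries.constantCoeff z = f y)
    (hz : phi k c (PowerSeries.C (f u) + PowerSeries.X) z = 0)
    (hψ : ddY k c (f u) (f y) (f y) ≠ 0) (hne : u ^ (q + 1) ≠ u)
    {n m a : ℕ} (hn : 1 ≤ n) (ha : n * g ≤ a) (hm : m = a + n + 1) (M : ℕ → ℝ)
    (hM : ∀ i < m, ∀ L : Submodule F B,
      L ≤ fil F k u y ((q + 1) * m + n * k * (q + 1) + i * g) →
      (∀ x ∈ L, IsLead k c (f u) (f y) z i (f x) ∧
        ∃ x', x * (y - y ^ (q + 1)) ^ n = x' * (u - u ^ (q + 1)) ^ n) →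
      (Module.finrank F L : ℝ) ≤ M i) :
    ∑ l ∈ Finset.range (a - g),
        (((q + 1) * m + q * m : ℝ) - (q + 1) * (g + 1 + l) - g) +
      ∑ i ∈ Finset.range n, (((q + 1) * m + q * m : ℝ) - (q + 1) * ((i + 1) * g) - g) ≤
      ∑ i ∈ Finset.range m, M i + ∑ i ∈ Finset.range m, (q * (m - i) : ℕ) := by
  have hphi : phi k c (f u) (f y) = 0 := by rw [← map_phi, h.rel, map_zero]
  have hc' : (algebraMap F K ∘ c) (0, k) = 1 := by simp [hc]
  obtain ⟨A, _, _, U, Y, _, hC⟩ := exists_isCurve hk hc' hirr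
  obtain ⟨Θ, hU, hY⟩ := hC.lift (PowerSeries K) (PowerSeries.C (f u) + PowerSeries.X) z
    (by rw [phi_algebraMap, hz])
  have hga : g ≤ a := le_trans (Nat.le_mul_of_pos_left g hn) ha
  have hkg : k * (k - 1) = g + 1 := by
    obtain ⟨k', rfl⟩ : ∃ k', k = k' + 1 := ⟨k - 1, by omega⟩
    simp only [Nat.add_sub_cancel]
    nlinarith
  choose p hp using fun l : Fin (a - g) => exists_weight_eq hk (i := g + 1 + l) (by omega)
  have hpinj : Function.Injective p := by
    intro l l' hl
    have h1 := hp l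
    rw [hl, hp l'] at h1
    exact Fin.ext (by omega)
  have h0 : ddY k c (f (u ^ (q + 1))) (f (y ^ (q + 1))) (f (y ^ (q + 1))) ≠ 0 := by
    rw [map_pow, map_pow, ← hq, ddY_pow_card]
    exact pow_ne_zero _ hψ
  have hphi0 : phi k c (f (u ^ (q + 1))) (f (y ^ (q + 1))) = 0 := by
    rw [map_pow, map_pow, ← hq, phi_pow_card, hphi, zero_pow Fintype.card_ne_zero]
  set u0 : A := algebraMap K A (f (u ^ (q + 1))) with hu0
  set y0 : A := algebraMap K A (f (y ^ (q + 1))) with hy0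
  set ψ := ddY k (algebraMap F K ∘ c) u0 Y y0 with hψ'
  set χ := ddX k (algebraMap F K ∘ c) u0 U Y with hχ'
  have hψχ : ψ * (Y - y0) = χ * (u0 - U) := by
    refine ddY_mul_eq_ddX_mul hC.rel ?_
    have h1 := map_phi k (algebraMap F K ∘ c) (f (u ^ (q + 1))) (f (y ^ (q + 1)))
      (Algebra.ofId K A)
    rw [phi_algebraMap, hphi0, map_zero] at h1
    exact h1.symm
  have hpow : ∀ (w : ℕ) (t : K), PowerSeries.C (t ^ w) = (PowerSeries.C t) ^ w :=
    fun w t => map_pow _ _ _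
  have hΘu : Θ u0 = PowerSeries.C (f u) ^ (q + 1) := by
    rw [hu0, AlgHom.commutes, PowerSeries.algebraMap_apply, map_pow, ← hpow]
    rfl
  have hΘy : Θ y0 = PowerSeries.C (f y) ^ (q + 1) := by
    rw [hy0, AlgHom.commutes, PowerSeries.algebraMap_apply, map_pow, ← hpow]
    rfl
  have hΘψ : Θ ψ = ddY k c (PowerSeries.C (f u) ^ (q + 1)) z (PowerSeries.C (f y) ^ (q + 1)) := by
    rw [hψ', map_ddY, ddY_algebraMap, hΘu, hΘy, hY]
  have hΘχ : Θ χ = ddX k c (PowerSeries.C (f u) ^ (q + 1)) (PowerSeries.C (f u) + PowerSeries.X)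
      z := by
    rw [hχ', map_ddX, ddX_algebraMap, hΘu, hU, hY]
  let T : Fin (a - g) ⊕ Fin n → A := Sum.elim
    (fun l => U ^ (p l).1 * Y ^ ((p l).2 : ℕ) * (U - u0) ^ n)
    (fun i => ψ ^ ((i : ℕ) + 1) * (U - u0) ^ (n - 1 - i))
  let T' : Fin (a - g) ⊕ Fin n → A := Sum.elim
    (fun l => U ^ (p l).1 * Y ^ ((p l).2 : ℕ) * (Y - y0) ^ n)
    (fun i => (-χ) ^ ((i : ℕ) + 1) * (Y - y0) ^ (n - 1 - i))
  let d : Fin (a - g) ⊕ Fin n → ℕ := Sum.elim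
    (fun l => (q + 1) * m + q * m - (q + 1) * (g + 1 + l))
    (fun i => (q + 1) * m + q * m - (q + 1) * ((i + 1) * g))
  have hd1 : ∀ l : Fin (a - g), (q + 1) * (g + 1 + l) ≤ (q + 1) * m := fun l =>
    Nat.mul_le_mul_left _ (by omega)
  have hd2 : ∀ i : Fin n, (i + 1) * g ≤ a := fun i =>
    (Nat.mul_le_mul_right g (by omega : (i : ℕ) + 1 ≤ n)).trans ha
  have hd3 : ∀ i : Fin n, (q + 1) * ((i + 1) * g) ≤ (q + 1) * m := fun i =>
    Nat.mul_le_mul_left _ ((hd2 i).trans (by omega))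
  have hB : ∀ w, IsFilt (bifil F k w (PowerSeries.C (f u)) (PowerSeries.C (f y))
      (PowerSeries.C (f u) + PowerSeries.X) z) := fun w => isFilt_bifil _ _ _ _
  have key := h.sum_finrank_le hk hc hg f hf hC hz0 hz hψ Θ hU hY (u0 := u ^ (q + 1))
    (y0 := y ^ (q + 1)) (fun e => hne (hf e)) h0 (n := n) (m := m) (a := a) (by omega)
    (ι := ULift.{v} (Fin (a - g) ⊕ Fin n)) (fun j => T j.down) (fun j => T' j.down)
    ?_ ?_ ?_ (fun j => fil F k u y (d j.down)) (fun j => h.finite_fil hk hc _)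
    (N := (q + 1) * m + n * k * (q + 1)) (q := q) ?_ ?_ M hM
  · refine le_trans ?_ key
    have e1 : ∑ j : ULift.{v} (Fin (a - g) ⊕ Fin n),
        (Module.finrank F (fil F k u y (d j.down)) : ℝ) =
        ∑ j : Fin (a - g) ⊕ Fin n, (Module.finrank F (fil F k u y (d j)) : ℝ) :=
      Equiv.sum_comp Equiv.ulift (fun j => (Module.finrank F (fil F k u y (d j)) : ℝ))
    rw [e1, Fintype.sum_sum_type, Finset.sum_range, Finset.sum_range]
    have e2 : ∀ j, (d j : ℝ) - g ≤ Module.finrank F (fil F k u y (d j)) := by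
      intro j
      rw [h.finrank_fil hk hc]
      have := le_card_filIdx hk (d j)
      rw [hkg] at this
      have h' : ((d j + 1 : ℕ) : ℝ) ≤ (((filIdx k (d j)).card + (g + 1) : ℕ) : ℝ) := by
        exact_mod_cast this
      push_cast at h'
      linarith
    refine add_le_add (Finset.sum_le_sum fun l _ => le_trans (le_of_eq ?_) (e2 _))
      (Finset.sum_le_sum fun i _ => le_trans (le_of_eq ?_) (e2 _))
    · simp only [d, Sum.elim_inl]
      rw [Nat.cast_sub ((hd1 l).trans (Nat.le_add_right _ _))]
      push_cast
      ring
    · simp only [d, Sum.elim_inr]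
      rw [Nat.cast_sub ((hd3 i).trans (Nat.le_add_right _ _))]
      push_cast
      ring
  · have hFil := isFilt_fil (L := K) k U Y
    have hP : U - u0 ∈ fil K k U Y k := Submodule.sub_mem _ (left_mem_fil _ _)
      (hFil.mono (Nat.zero_le k) (by
        rw [hu0, Algebra.algebraMap_eq_smul_one]
        exact Submodule.smul_mem _ _ hFil.one))
    have hψm : ψ ∈ fil K k U Y (g + k) := by
      have h1 : ∀ (t : K) D, algebraMap K A t ∈ fil K k U Y D := fun t D =>
        hFil.mono (Nat.zero_le D) (by
          rw [Algebra.algebraMap_eq_smul_one]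
          exact Submodule.smul_mem _ _ hFil.one)
      simpa using hFil.ddY_mem (w := 1) hg (algebraMap F K ∘ c) (h1 _ _)
        (by simpa using right_mem_fil (L := K) (k := k) U Y) (h1 _ _)
    rintro ⟨l | i⟩
    · refine hFil.mono ?_ (hFil.mul (monomial_mem_fil U Y (hp l).le) (hFil.pow hP n))
      have := l.2
      omega
    · refine hFil.mono ?_ (hFil.mul (hFil.pow hψm (i + 1)) (hFil.pow hP (n - 1 - i)))
      have h1 := hd2 i
      obtain ⟨r, hr⟩ : ∃ r, n = i + 1 + r := ⟨n - (i + 1), by omega⟩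
      have h2 : n - 1 - i = r := by omega
      have h3 : n * k = (i + 1) * k + r * k := by rw [← add_mul, ← hr]
      rw [h2, h3, mul_add]
      omega
  · rintro ⟨l | i⟩
    · simp only [T, T', Sum.elim_inl]
      ring
    · simp only [T, T', Sum.elim_inr]
      obtain ⟨r, hr⟩ : ∃ r, n = i + 1 + r := ⟨n - (i + 1), by omega⟩
      have h2 : n - 1 - i = r := by omega
      have h3 : ψ * (Y - y0) = -χ * (U - u0) := by rw [hψχ]; ring
      have h4 : (U - u0) ^ n = (U - u0) ^ ((i : ℕ) + 1) * (U - u0) ^ r := by rw [← pow_add, ← hr]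
      have h5 : (Y - y0) ^ n = (Y - y0) ^ ((i : ℕ) + 1) * (Y - y0) ^ r := by rw [← pow_add, ← hr]
      have h6 : ψ ^ ((i : ℕ) + 1) * (Y - y0) ^ ((i : ℕ) + 1) =
          (-χ) ^ ((i : ℕ) + 1) * (U - u0) ^ ((i : ℕ) + 1) := by
        rw [← mul_pow, h3, mul_pow]
      rw [h2, h4, h5]
      linear_combination (U - u0) ^ r * (Y - y0) ^ r * h6
  · intro r hr
    have e1 : ∑ j : ULift.{v} (Fin (a - g) ⊕ Fin n), r j • T j.down =
        ∑ j : Fin (a - g) ⊕ Fin n, r ⟨j⟩ • T j :=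
      Equiv.sum_comp Equiv.ulift (fun j => r ⟨j⟩ • T j)
    rw [e1, Fintype.sum_sum_type] at hr
    have := hC.aux_indep hk (u0 := f (u ^ (q + 1))) (y0 := f (y ^ (q + 1)))
      (by rwa [phi_algebraMap]) (by rwa [ddY_algebraMap]) p hpinj (fun j => r ⟨j⟩) hr
    funext ⟨j⟩
    exact congrFun this j
  · have hP : Θ (U - u0) ∈ bifil F k (q + 1) (PowerSeries.C (f u)) (PowerSeries.C (f y))
        (PowerSeries.C (f u) + PowerSeries.X) z ((q + 1) * k) := by
      rw [map_sub, hU, hΘu]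
      exact Submodule.sub_mem _ (fst_mem_bifil' _ _ _ _)
        ((hB _).pow (fst_mem_bifil _ _ _ _) (q + 1))
    have hψm : Θ ψ ∈ bifil F k (q + 1) (PowerSeries.C (f u)) (PowerSeries.C (f y))
        (PowerSeries.C (f u) + PowerSeries.X) z ((q + 1) * (g + k)) := by
      rw [hΘψ]
      exact (hB _).ddY_mem hg c ((hB _).pow (fst_mem_bifil _ _ _ _) (q + 1))
        (snd_mem_bifil' _ _ _ _) ((hB _).pow (snd_mem_bifil _ _ _ _) (q + 1))
    rintro ⟨l | i⟩ x hx
    · have h1 : Θ (U ^ (p l).1 * Y ^ ((p l).2 : ℕ)) ∈ bifil F k (q + 1) (PowerSeries.C (f u))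
          (PowerSeries.C (f y)) (PowerSeries.C (f u) + PowerSeries.X) z
          ((q + 1) * (g + 1 + l)) := by
        rw [map_mul, map_pow, map_pow, hU, hY]
        simpa using monomial_mem_bifil (L := F) (k := k) (w := q + 1) (PowerSeries.C (f u))
          (PowerSeries.C (f y)) (PowerSeries.C (f u) + PowerSeries.X) z (a := 0) (b := 0)
          (a' := (p l).1) (b' := (p l).2) (D := (q + 1) * (g + 1 + l)) (by simp [hp l])
      have h2 := smul_mem_bifil f hx ((hB _).mul h1 ((hB _).pow hP n))
      rw [← map_pow, ← map_mul] at h2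
      refine (hB _).mono ?_ h2
      simp only [d, Sum.elim_inl]
      have := hd1 l
      have h3 : n * ((q + 1) * k) = n * k * (q + 1) := by ring
      omega
    · have h2 := smul_mem_bifil f hx ((hB _).mul ((hB _).pow hψm (i + 1))
        ((hB _).pow hP (n - 1 - i)))
      rw [← map_pow, ← map_pow, ← map_mul] at h2
      refine (hB _).mono ?_ h2
      simp only [d, Sum.elim_inr]
      have h1 := hd3 i
      obtain ⟨r, hr⟩ : ∃ r, n = i + 1 + r := ⟨n - (i + 1), by omega⟩
      have h2 : n - 1 - i = r := by omega
      have h3 : n * k * (q + 1) = (i + 1) * ((q + 1) * k) + r * ((q + 1) * k) := by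
        rw [← add_mul, ← hr]; ring
      have h4 : (i + 1) * ((q + 1) * (g + k)) =
          (q + 1) * ((i + 1) * g) + (i + 1) * ((q + 1) * k) := by ring
      rw [h2, h3, h4]
      omega
  · have hB1 := hB 1
    have hx1 := fst_mem_bifil' (L := F) (k := k) (w := 1) (PowerSeries.C (f u))
      (PowerSeries.C (f y)) (PowerSeries.C (f u) + PowerSeries.X) z
    have hz1 := snd_mem_bifil' (L := F) (k := k) (w := 1) (PowerSeries.C (f u))
      (PowerSeries.C (f y)) (PowerSeries.C (f u) + PowerSeries.X) z
    have hu1 := hB1.pow (fst_mem_bifil (L := F) (k := k) (w := 1) (PowerSeries.C (f u))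
      (PowerSeries.C (f y)) (PowerSeries.C (f u) + PowerSeries.X) z) (q + 1)
    have hy1 := hB1.pow (snd_mem_bifil (L := F) (k := k) (w := 1) (PowerSeries.C (f u))
      (PowerSeries.C (f y)) (PowerSeries.C (f u) + PowerSeries.X) z) (q + 1)
    have hR : ∃ D, Θ (Y - y0) ∈ bifil F k 1 (PowerSeries.C (f u)) (PowerSeries.C (f y))
        (PowerSeries.C (f u) + PowerSeries.X) z D := by
      refine ⟨1 * (k + 1) + (q + 1) * (k + 1), ?_⟩
      rw [map_sub, hY, hΘy]
      exact Submodule.sub_mem _ (hB1.mono (by omega) hz1) (hB1.mono (by omega) hy1)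
    have hχm : ∃ D, Θ (-χ) ∈ bifil F k 1 (PowerSeries.C (f u)) (PowerSeries.C (f y))
        (PowerSeries.C (f u) + PowerSeries.X) z D := by
      refine ⟨(q + 1) * (g + k + 1), ?_⟩
      rw [map_neg, hΘχ]
      exact neg_mem (hB1.ddX_mem hg c hu1 (hB1.mono (Nat.mul_le_mul_right _ (by omega)) hx1)
        (hB1.mono (Nat.mul_le_mul_right _ (by omega)) hz1))
    obtain ⟨D1, hR⟩ := hR
    obtain ⟨D2, hχm⟩ := hχm
    rintro ⟨l | i⟩ x hx
    · have h3 : Θ (T' (Sum.inl l)) = Θ U ^ (p l).1 * Θ Y ^ ((p l).2 : ℕ) * Θ (Y - y0) ^ n := by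
        simp only [T', Sum.elim_inl, map_mul, map_pow]
      have h4 := hB1.mul (hB1.mul (hB1.pow hx1 (p l).1) (hB1.pow hz1 (p l).2)) (hB1.pow hR n)
      rw [← hU, ← hY, ← h3, hU, hY] at h4
      generalize Θ (T' (Sum.inl l)) = t at h4 ⊢
      exact ⟨_, smul_mem_bifil f hx h4⟩
    · have h3 : Θ (T' (Sum.inr i)) = Θ (-χ) ^ ((i : ℕ) + 1) * Θ (Y - y0) ^ (n - 1 - i) := by
        simp only [T', Sum.elim_inr, map_mul, map_pow]
      have h4 := hB1.mul (hB1.pow hχm (i + 1)) (hB1.pow hR (n - 1 - i))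
      rw [← h3] at h4
      generalize Θ (T' (Sum.inr i)) = t at h4 ⊢
      exact ⟨_, smul_mem_bifil f hx h4⟩

end

section

lemma nonpos_of_quadratic_le {r A B C D E₀ F₀ : ℝ} (hr : 0 ≤ r)
    (h : ∀ n : ℕ, 1 ≤ n → ∃ m : ℝ, r * n + 1 ≤ m ∧ m ≤ r * n + 2 ∧
      A * m ^ 2 + B * (m * n) + C * n ^ 2 + D * m + E₀ * n + F₀ ≤ 0) :
    A * r ^ 2 + B * r + C ≤ 0 := by
  by_contra! hX
  obtain ⟨n, hn⟩ := exists_nat_gt ((4 * |A| * r + 2 * |B| + |D| * r + |E₀| + 4 * |A| + 2 * |D| +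
    |F₀|) / (A * r ^ 2 + B * r + C))
  rw [div_lt_iff₀ hX] at hn
  have hn0 : (0 : ℝ) < n := by
    by_contra! h0
    have h1 : (n : ℝ) * (A * r ^ 2 + B * r + C) ≤ 0 := mul_nonpos_of_nonpos_of_nonneg h0 hX.le
    have : 0 ≤ 4 * |A| * r + 2 * |B| + |D| * r + |E₀| + 4 * |A| + 2 * |D| + |F₀| := by positivity
    linarith
  have hn1 : 1 ≤ n := by exact_mod_cast hn0
  obtain ⟨m, hm1, hm2, hm⟩ := h n hn1
  obtain ⟨δ, rfl⟩ : ∃ δ, m = r * n + δ := ⟨m - r * n, by ring⟩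
  have hδ1 : 1 ≤ δ := by linarith
  have hδ2 : δ ≤ 2 := by linarith
  have hn1' : (1 : ℝ) ≤ n := by exact_mod_cast hn1
  have b : ∀ t s S : ℝ, 0 ≤ s → s ≤ S → -(t * s) ≤ |t| * S := by
    intro t s S h0 h1
    have h2 : -t ≤ |t| := neg_le_abs t
    nlinarith [abs_nonneg t]
  have h1 := b A (2 * r * δ) (4 * r) (by positivity) (by nlinarith)
  have h2 := b B δ 2 (by positivity) hδ2
  have h3 := b D r r hr le_rfl
  have h4 := b E₀ 1 1 zero_le_one le_rfl
  have h5 := b A (δ ^ 2) 4 (by positivity) (by nlinarith)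
  have h6 := b D δ 2 (by positivity) hδ2
  have h7 := b F₀ 1 1 zero_le_one le_rfl
  have h8 : n * (-(A * (2 * r * δ)) - B * δ - D * r - E₀ * 1) ≤
      n * (|A| * (4 * r) + |B| * 2 + |D| * r + |E₀| * 1) :=
    mul_le_mul_of_nonneg_left (by linarith) hn0.le
  have h9 : (|A| * 4 + |D| * 2 + |F₀| * 1) ≤ n * (|A| * 4 + |D| * 2 + |F₀| * 1) :=
    le_mul_of_one_le_left (by positivity) hn1'
  nlinarith

variable {F B K : Type v} [Field F] [CommRing B] [Algebra F B] [Field K] [Algebra F K]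
  {k : ℕ} {c : ℕ × ℕ → F} {u y : B}

lemma IsCurve.finrank_le_of_forall (h : IsCurve k c u y) (hk : 1 ≤ k) (hc : c (0, k) = 1)
    {D : ℕ} (L : Submodule F B) (hL : L ≤ fil F k u y D) {Z : ℝ}
    (hZ : ∀ x ∈ L, x ≠ 0 → ∀ D' : ℕ, x ∈ fil F k u y D' → Z ≤ D') (h0 : 0 ≤ D + 1 - Z) :
    (Module.finrank F L : ℝ) ≤ D + 1 - Z := by
  rcases le_or_gt Z 0 with hZ0 | hZ0
  · have := h.finite_fil hk hc D
    have h1 := (Submodule.finrank_mono hL).trans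
      ((h.finrank_fil hk hc D).le.trans (card_filIdx_le k D))
    have h2 : (Module.finrank F L : ℝ) ≤ D + 1 := by exact_mod_cast h1
    linarith
  · obtain ⟨N, hN⟩ : ∃ N, ⌈Z⌉₊ = N + 1 :=
      ⟨⌈Z⌉₊ - 1, by have := Nat.ceil_pos.2 hZ0; omega⟩
    have hN1 : (N : ℝ) < Z := Nat.lt_ceil.1 (by omega)
    have hN2 : Z ≤ N + 1 := by
      have := Nat.le_ceil Z
      rw [hN] at this
      exact_mod_cast this
    have hdisj : Disjoint L (fil F k u y N) := by
      rw [Submodule.disjoint_def]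
      intro x hx hxN
      by_contra hx0
      have := hZ x hx hx0 N hxN
      linarith
    rcases le_or_gt N D with hND | hND
    · obtain ⟨E, rfl⟩ := Nat.exists_eq_add_of_le hND
      have h1 : (Module.finrank F L : ℝ) ≤ E := by
        exact_mod_cast h.finrank_le_of_disjoint hk hc L hL hdisj
      push_cast
      linarith
    · have h1 : L = ⊥ := by
        have := hdisj.eq_bot_of_le (hL.trans (fil_mono hND.le))
        exact this
      rw [h1, finrank_bot]
      simpa using h0

/-- A bound for the Frobenius correspondence on a plane curve. -/
theorem IsCurve.le_of_forall_lead [Fintype F] (h : IsCurve k c u y) (hk : 2 ≤ k)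
    (hc : c (0, k) = 1) {q : ℕ} (hq : Fintype.card F = q + 1)
    (f : B →ₐ[F] K) (hf : Function.Injective f)
    (hirr : Irreducible (poly k (algebraMap F K ∘ c)))
    {z : PowerSeries K} (hz0 : PowerSeries.constantCoeff z = f y)
    (hz : phi k c (PowerSeries.C (f u) + PowerSeries.X) z = 0)
    (hψ : ddY k c (f u) (f y) (f y) ≠ 0) (hne : u ^ (q + 1) ≠ u)
    {M γ : ℝ} (hM0 : 0 ≤ M) (hγ1 : γ ≤ 1)
    (hM : ∀ n i D : ℕ, ∀ x, x ≠ 0 → x ∈ fil F k u y D → IsLead k c (f u) (f y) z i (f x) →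
      (∃ x', x * (y - y ^ (q + 1)) ^ n = x' * (u - u ^ (q + 1)) ^ n) →
      n * (k * (q + 1) - M) + γ * i ≤ D)
    (hG : (k : ℝ) * (k - 1) ≤ √(q + 1)) :
    (q + 1) - k * (k - 1) * √(q + 1) + γ * √(q + 1) / 2 ≤ M := by
  obtain ⟨g, hg⟩ : ∃ g, g + k + 1 = k * k := ⟨k * k - (k + 1), by
    have : 2 * k ≤ k * k := Nat.mul_le_mul_right k hk
    omega⟩
  have hg' : (g : ℝ) + k + 1 = k * k := by exact_mod_cast hg
  have hg1 : 1 ≤ g := by nlinarith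
  have hg1' : (1 : ℝ) ≤ g := by exact_mod_cast hg1
  set r : ℝ := √(q + 1) with hr
  have hrr : r ^ 2 = q + 1 := Real.sq_sqrt (by positivity)
  have hr0 : 0 < r := Real.sqrt_pos.2 (by positivity)
  have hGg : (k : ℝ) * (k - 1) = g + 1 := by linarith
  rw [hGg] at hG ⊢
  have key := nonpos_of_quadratic_le (r := r) (A := -(1 + g - γ) / 2) (B := r ^ 2 - M)
    (C := -r ^ 2 * (1 + g) / 2)
    (D := -(2 * r ^ 2 - 1) * (1 + g) + r ^ 2 / 2 - g + (g - γ) / 2 - 1 - (r ^ 2 - 1) / 2)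
    (E₀ := -r ^ 2 * (1 + g) / 2) (F₀ := r ^ 2 * g * (g + 1) / 2 + g * (1 + g)) hr0.le ?_
  · have h1 : r * ((q + 1) - (g + 1) * r + γ * r / 2 - M) ≤ 0 := by
      refine le_trans (le_of_eq ?_) key
      rw [← hrr]
      ring
    have := nonpos_of_mul_nonpos_right h1 hr0
    linarith
  · intro n hn
    have hn' : (1 : ℝ) ≤ n := by exact_mod_cast hn
    have hrn : 0 ≤ r * n := by positivity
    refine ⟨(⌈r * n⌉₊ + 1 : ℕ), ?_, ?_, ?_⟩
    · push_cast
      have := Nat.le_ceil (r * n)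
      linarith
    · push_cast
      have := Nat.ceil_lt_add_one hrn
      linarith
    · have h1 : n * (g + 1) ≤ ⌈r * n⌉₊ := by
        have h2 : ((n * (g + 1) : ℕ) : ℝ) ≤ ⌈r * n⌉₊ := by
          refine le_trans ?_ (Nat.le_ceil _)
          push_cast
          nlinarith
        exact_mod_cast h2
      obtain ⟨m, hm⟩ : ∃ m, m = ⌈r * n⌉₊ + 1 := ⟨_, rfl⟩
      rw [← hm]
      obtain ⟨a, ha⟩ : ∃ a, m = a + n + 1 := ⟨m - n - 1, by
        have : n * (g + 1) = n * g + n := by ring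
        omega⟩
      have hna : n * g ≤ a := by
        have : n * (g + 1) = n * g + n := by ring
        omega
      have hga : g ≤ a := le_trans (Nat.le_mul_of_pos_left g hn) hna
      have main := h.sum_le_sum (by omega) hc hg hq f hf hirr hz0 hz hψ hne hn hna ha
        (fun i => (q + 1) * m + n * M + i * (g - γ) + 1) ?_
      · obtain ⟨e, rfl⟩ := Nat.exists_eq_add_of_le hga
        have hs : ∀ N : ℕ, ∑ i ∈ Finset.range N, (i : ℝ) = N * (N - 1) / 2 := by
          intro N
          induction N with
          | zero => simp
          | succ N ih => rw [Finset.sum_range_succ, ih]; push_cast; ring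
        have e1 : ∀ i ∈ Finset.range m, ((q * (m - i) : ℕ) : ℝ) = q * m - q * i := by
          intro i hi
          rw [Nat.cast_mul, Nat.cast_sub (Finset.mem_range.1 hi).le]
          ring
        rw [Nat.add_sub_cancel_left, Nat.cast_sum, Finset.sum_congr rfl e1] at main
        simp only [Finset.sum_add_distrib, Finset.sum_sub_distrib, ← Finset.mul_sum,
          ← Finset.sum_mul, hs, Finset.sum_const, Finset.card_range, nsmul_eq_mul] at main
        have hm' : (m : ℝ) = g + e + n + 1 := by exact_mod_cast ha
        have he : (e : ℝ) = m - g - n - 1 := by linarith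
        rw [he] at main
        have hQ : (q : ℝ) = r ^ 2 - 1 := by linarith
        rw [hQ] at main
        nlinarith [main]
      · intro i _ L hL hx
        have := h.finrank_le_of_forall (by omega) hc L hL (Z := n * (k * (q + 1) - M) + γ * i)
          (fun x hxL hx0 D hD => hM n i D x hx0 hD (hx x hxL).1 (hx x hxL).2) ?_
        · refine this.trans (le_of_eq ?_)
          push_cast
          ring
        · push_cast
          have h2 : 0 ≤ (i : ℝ) * (g - γ) := mul_nonneg (by positivity) (by linarith)
          have h3 : 0 ≤ n * M := by positivity
          have h4 : 0 ≤ ((q : ℝ) + 1) * m := by positivity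
          nlinarith

end

section fractionalCurve

variable {F : Type*} [Field F] {R : Type*} [CommRing R] [Algebra F R]

/-- The coefficients of the curve `∑ Hᵢ u^(k-i) (y + ⋯ + yⁱ) = e u^(k+1)`. -/
def coef (k : ℕ) (H : F[X]) (e : F) (p : ℕ × ℕ) : F :=
  if p.2 = 0 then (if p.1 = k + 1 then -e else 0)
  else if p.1 + p.2 ≤ k then H.coeff (k - p.1) else 0

lemma coef_map {K : Type*} [Field K] [Algebra F K] (k : ℕ) (H : F[X]) (e : F) :
    algebraMap F K ∘ coef k H e = coef k (H.map (algebraMap F K)) (algebraMap F K e) := by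
  funext p
  simp only [coef, Function.comp, coeff_map]
  split_ifs <;> simp

lemma coef_zero_self {k : ℕ} (hk : 1 ≤ k) {H : F[X]} (hH : H.coeff k = 1) (e : F) :
    coef k H e (0, k) = 1 := by
  simp [coef, hH, show k ≠ 0 by omega]

lemma coef_eq_zero {k : ℕ} {H : F[X]} {e : F} {p : ℕ × ℕ}
    (hp : p ∈ Finset.range (k + 2) ×ˢ Finset.range (k + 1)) (h : p ∉ expSet k) :
    coef k H e p = 0 := by
  have h1 : k * (k + 1) < k * p.1 + (k + 1) * p.2 := by
    by_contra! h2
    exact h (Finset.mem_filter.2 ⟨hp, h2⟩)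
  rw [coef]
  split_ifs with h2 h3 h4
  · rw [h2, h3] at h1
    omega
  · rfl
  · have : p.2 ≤ k := by omega
    nlinarith
  · rfl

lemma sum_expSet_coef {M : Type*} [AddCommMonoid M] {k : ℕ} {H : F[X]} {e : F} (φ : ℕ × ℕ → M)
    (hφ : ∀ p, coef k H e p = 0 → φ p = 0) :
    ∑ p ∈ expSet k, φ p =
      ∑ i ∈ Finset.range (k + 1), ∑ j ∈ Finset.range i, φ (k - i, j + 1) + φ (k + 1, 0) := by
  have h1 : ∑ p ∈ expSet k, φ p = ∑ p ∈ Finset.range (k + 2) ×ˢ Finset.range (k + 1), φ p :=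
    Finset.sum_subset (Finset.filter_subset _ _) fun p hp h => hφ p (coef_eq_zero hp h)
  rw [h1, Finset.sum_product, Finset.sum_range_succ]
  congr 1
  · rw [← Finset.sum_flip]
    refine Finset.sum_congr rfl fun i hi => ?_
    have hi' : i ≤ k := by simpa [Nat.lt_succ_iff] using hi
    rw [Finset.sum_range_succ', hφ (k - i, 0) (by simp [coef]; omega), add_zero]
    refine (Finset.sum_subset (Finset.range_subset_range.2 hi') fun j _ hj => hφ _ ?_).symm
    simp only [Finset.mem_range] at hj
    simp only [coef]
    rw [if_neg (by omega), if_neg (by omega)]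
  · rw [Finset.sum_range_succ', Finset.sum_eq_zero, zero_add]
    intro j _
    refine hφ _ ?_
    simp only [coef]
    rw [if_neg (by omega), if_neg (by omega)]

lemma phi_coef (k : ℕ) (H : F[X]) (e : F) (x y : R) :
    phi k (coef k H e) x y =
      ∑ i ∈ Finset.range (k + 1), H.coeff i • (x ^ (k - i) * ∑ j ∈ Finset.range i, y ^ (j + 1)) -
        e • x ^ (k + 1) := by
  rw [phi, sum_expSet_coef _ fun p hp => by rw [hp, zero_smul], sub_eq_add_neg]
  congr 1
  · refine Finset.sum_congr rfl fun i hi => ?_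
    have hi' : i ≤ k := by simpa [Nat.lt_succ_iff] using hi
    rw [Finset.mul_sum, Finset.smul_sum]
    refine Finset.sum_congr rfl fun j hj => ?_
    have hj' : j < i := Finset.mem_range.1 hj
    simp only [coef]
    rw [if_neg (by omega), if_pos (by omega), show k - (k - i) = i by omega]
  · simp [coef]

lemma sub_one_mul_phi_coef {k : ℕ} {H : F[X]} (hH : H.natDegree = k) (e : F) {x t : R}
    (hxt : x * t = 1) (y : R) :
    (y - 1) * (t ^ (k + 1) * phi k (coef k H e) x y) =
      t * y * (aeval (t * y) H - aeval t H) - (y - 1) * algebraMap F R e := by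
  have h1 : (t * x) ^ (k + 1) = 1 := by rw [mul_comm, hxt, one_pow]
  rw [phi_coef, mul_sub, mul_sub, Finset.mul_sum, Finset.mul_sum, aeval_eq_sum_range,
    aeval_eq_sum_range, hH, ← Finset.sum_sub_distrib, Finset.mul_sum]
  congr 1
  · refine Finset.sum_congr rfl fun i hi => ?_
    have hi' : i ≤ k := by simpa [Nat.lt_succ_iff] using hi
    have h2 : t ^ (k + 1) * x ^ (k - i) = t * t ^ i := by
      have : (t * x) ^ (k - i) = 1 := by rw [mul_comm, hxt, one_pow]
      calc t ^ (k + 1) * x ^ (k - i) = t * t ^ i * (t ^ (k - i) * x ^ (k - i)) := by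
            rw [show k + 1 = 1 + i + (k - i) by omega, pow_add, pow_add, pow_one]
            ring
        _ = _ := by rw [← mul_pow, this, mul_one]
    have h3 : (y - 1) * ∑ j ∈ Finset.range i, y ^ (j + 1) = y * (y ^ i - 1) := by
      rw [← mul_geom_sum, Finset.mul_sum, Finset.mul_sum, Finset.mul_sum]
      exact Finset.sum_congr rfl fun j _ => by ring
    calc (y - 1) * (t ^ (k + 1) * H.coeff i • (x ^ (k - i) * ∑ j ∈ Finset.range i, y ^ (j + 1)))
        = H.coeff i • (t ^ (k + 1) * x ^ (k - i) *
            ((y - 1) * ∑ j ∈ Finset.range i, y ^ (j + 1))) := by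
          rw [mul_smul_comm, mul_smul_comm]
          congr 1
          ring
      _ = _ := by
          rw [h2, h3, mul_pow, ← smul_sub, mul_smul_comm]
          congr 1
          ring
  · rw [mul_smul_comm, ← mul_pow, h1, Algebra.algebraMap_eq_smul_one]

end fractionalCurve

section irreducible

variable {L : Type*} [Field L]

lemma coeff_swap_poly (k : ℕ) (H : L[X]) (e : L) (m : ℕ) :
    (phi k (coef k H e) (X : L[X][X]) (C X)).coeff m =
      (if m ≤ k then C (H.coeff (k - m)) * ∑ j ∈ Finset.range (k - m), X ^ (j + 1) else 0) -
        (if m = k + 1 then C e else 0) := by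
  rw [phi_coef]
  simp only [coeff_sub, finsetSum_coeff, coeff_smul, coeff_X_pow]
  congr 1
  · have h1 : ∀ i, (X ^ (k - i) * ∑ j ∈ Finset.range i, (C X : L[X][X]) ^ (j + 1)) =
        C (∑ j ∈ Finset.range i, X ^ (j + 1)) * X ^ (k - i) := by
      intro i
      rw [map_sum, mul_comm]
      simp
    simp only [h1, coeff_C_mul_X_pow]
    split_ifs with hm
    · rw [Finset.sum_eq_single (k - m)]
      · rw [if_pos (by omega), smul_eq_C_mul]
      · intro i hi hne
        rw [if_neg, smul_zero]
        simp only [Finset.mem_range] at hi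
        omega
      · intro h
        simp at h
    · refine Finset.sum_eq_zero fun i hi => ?_
      rw [if_neg (by omega), smul_zero]
  · split_ifs
    · rw [smul_eq_C_mul, mul_one]
    · rw [smul_zero]

/-- The curve is irreducible, by Eisenstein's criterion with respect to its second coordinate. -/
lemma irreducible_poly_coef {k : ℕ} (hk : 1 ≤ k) {H : L[X]} (hH : H.coeff k = 1) {e : L}
    (he : e ≠ 0) : Irreducible (poly k (coef k H e)) := by
  have h1 : Bivariate.swap (poly k (coef k H e)) = phi k (coef k H e) (X : L[X][X]) (C X) := by
    have h2 := map_phi k (coef k H e) (C X : L[X][X]) X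
      (Bivariate.swap (R := L) : L[X][X] →ₐ[L] L[X][X])
    simp only [AlgEquiv.coe_toAlgHom, Bivariate.swap_X, Bivariate.swap_Y] at h2
    exact h2
  rw [← MulEquiv.irreducible_iff (Bivariate.swap (R := L)), h1]
  set P := phi k (coef k H e) (X : L[X][X]) (C X) with hP
  have hc : ∀ m, P.coeff m = _ := coeff_swap_poly k H e
  have hlead : P.coeff (k + 1) = C (-e) := by
    rw [hc, if_neg (by omega), if_pos rfl, zero_sub, C_neg]
  have hdeg : P.natDegree = k + 1 := by
    refine natDegree_eq_of_le_of_coeff_ne_zero ?_ (by rw [hlead]; simpa using he)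
    rw [natDegree_le_iff_coeff_eq_zero]
    intro N hN
    rw [hc, if_neg (by omega), if_neg (by omega), sub_zero]
  have hprime : (Ideal.span {(X : L[X])}).IsPrime :=
    (Ideal.span_singleton_prime X_ne_zero).2 prime_X
  have hsum : ∀ i, (X : L[X]) ∣ ∑ j ∈ Finset.range i, X ^ (j + 1) := fun i =>
    Finset.dvd_sum fun j _ => dvd_pow_self _ (by omega)
  refine IsEisensteinAt.irreducible (𝓟 := Ideal.span {X}) ⟨?_, ?_, ?_⟩ hprime ?_ (by omega)
  · rw [leadingCoeff, hdeg, hlead, Ideal.mem_span_singleton, X_dvd_iff]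
    simpa using he
  · intro m hm
    rw [hc, if_pos (by omega), if_neg (by omega), sub_zero, Ideal.mem_span_singleton]
    exact (hsum _).mul_left _
  · rw [hc, if_pos (by omega), if_neg (by omega), sub_zero, Ideal.span_singleton_pow,
      Ideal.mem_span_singleton, X_pow_dvd_iff]
    intro h
    have := h 1 (by omega)
    obtain ⟨k', rfl⟩ := Nat.exists_eq_add_of_le' hk
    simp [hH, finsetSum_coeff, coeff_X_pow, Finset.sum_range_succ'] at this
  · intro r hr
    have h2 := (C_dvd_iff_dvd_coeff _ _).1 hr (k + 1)
    rw [hlead] at h2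
    exact isUnit_of_dvd_unit h2 (isUnit_C.2 (neg_ne_zero.2 he).isUnit)

end irreducible

section

variable {F : Type v} [Field F]

lemma fiberPoly_coef_zero {R : Type*} [CommRing R] [Algebra F R] {k : ℕ} {H : F[X]}
    (hH : H.coeff k = 1) (e : F) :
    fiberPoly k (coef k H e) (0 : R) = ∑ j ∈ Finset.range k, X ^ (j + 1) := by
  rw [fiberPoly, phi_coef, map_zero, zero_pow (Nat.succ_ne_zero k), smul_zero, sub_zero,
    Finset.sum_range_succ, Nat.sub_self, pow_zero, one_mul, hH, one_smul, Finset.sum_eq_zero,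
    zero_add]
  intro i hi
  rw [zero_pow, zero_mul, smul_zero]
  have := Finset.mem_range.1 hi
  omega

lemma IsCurve.ddY_coef_ne_zero {B : Type v} [CommRing B] [Algebra F B] {k : ℕ} (hk : 1 ≤ k)
    {H : F[X]} (hH : H.coeff k = 1) {e : F} {u y : B} (h : IsCurve k (coef k H e) u y) :
    ddY k (coef k H e) u y y ≠ 0 := by
  have h0 : fiberPoly k (coef k H e) (0 : F) = _ := fiberPoly_coef_zero hH e
  obtain ⟨θ, h1, h2⟩ := h.lift F 0 0 (by
    rw [← eval_fiberPoly, h0]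
    simp [eval_finsetSum])
  intro h3
  have h4 := congrArg θ h3
  rw [map_ddY, h1, h2, map_zero, ← eval_derivative_fiberPoly, h0, ← coeff_zero_eq_eval_zero,
    coeff_derivative] at h4
  obtain ⟨k', rfl⟩ := Nat.exists_eq_add_of_le' hk
  simp [finsetSum_coeff, coeff_X_pow, Finset.sum_range_succ'] at h4

lemma rootMultiplicity_comp_C_mul_X_le {p : F[X]} (hp : p ≠ 0) {t : F} (ht : t ≠ 0) (b : F) :
    (p.comp (C t * X)).rootMultiplicity b ≤ p.rootMultiplicity (t * b) := by
  rw [le_rootMultiplicity_iff hp]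
  obtain ⟨r, hr⟩ := pow_rootMultiplicity_dvd (p.comp (C t * X)) b
  have h1 := congrArg (fun s => s.comp (C t⁻¹ * X)) hr
  have h2 : (C t * X).comp (C t⁻¹ * X) = (X : F[X]) := by
    rw [mul_comp, C_comp, X_comp, ← mul_assoc, ← C_mul, mul_inv_cancel₀ ht, C_1, one_mul]
  have h3 : (X - C b).comp (C t⁻¹ * X) = C t⁻¹ * (X - C (t * b)) := by
    rw [sub_comp, X_comp, C_comp, mul_sub, ← C_mul, inv_mul_cancel_left₀ ht]
  simp only [comp_assoc, h2, comp_X, mul_comp, pow_comp, h3] at h1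
  generalize (p.comp (C t * X)).rootMultiplicity b = N at h1 ⊢
  rw [mul_pow] at h1
  exact ⟨_, h1.trans (by rw [mul_comm (C t⁻¹ ^ N), mul_assoc])⟩

lemma sum_rootMultiplicity_le [Fintype F] (p : F[X]) (s : Finset F) :
    ∑ b ∈ s, p.rootMultiplicity b ≤ p.natDegree := by
  classical
  refine le_trans (Finset.sum_le_sum_of_subset (Finset.subset_univ s)) ?_
  simp only [← count_roots]
  rw [Multiset.sum_count_eq_card fun a _ => Finset.mem_univ a]
  exact card_roots' p

/-- The numerator of `H + e / X - w`. -/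
noncomputable def pencil (H : F[X]) (e w : F) : F[X] := X * (H - C w) + C e

/-- The numerator of the derivative of `H + e / X`. -/
noncomputable def ramPoly (H : F[X]) (e : F) : F[X] := X ^ 2 * derivative H - C e

lemma pencil_ne_zero (H : F[X]) {e : F} (he : e ≠ 0) (w : F) : pencil H e w ≠ 0 := by
  intro h
  have := congrArg (eval 0) h
  simp [pencil] at this
  exact he this

lemma ramPoly_ne_zero (H : F[X]) {e : F} (he : e ≠ 0) : ramPoly H e ≠ 0 := by
  intro h
  have := congrArg (eval 0) h
  simp [ramPoly] at this
  exact he this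

lemma natDegree_pencil_le (H : F[X]) (e w : F) : (pencil H e w).natDegree ≤ H.natDegree + 1 := by
  refine natDegree_add_le_of_degree_le ?_ (by simp)
  refine natDegree_mul_le.trans ?_
  have := natDegree_sub_C (p := H) (a := w)
  rw [this, natDegree_X, add_comm]

lemma natDegree_ramPoly_le {H : F[X]} (hH : 1 ≤ H.natDegree) (e : F) :
    (ramPoly H e).natDegree ≤ H.natDegree + 1 := by
  rw [ramPoly, natDegree_sub_C]
  refine natDegree_mul_le.trans ?_
  have := natDegree_derivative_le H
  rw [natDegree_X_pow]
  omega

lemma rootMultiplicity_pencil_le (H : F[X]) {e : F} (he : e ≠ 0) (w s : F) :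
    (pencil H e w).rootMultiplicity s ≤ 1 + (ramPoly H e).rootMultiplicity s := by
  have h1 : ramPoly H e = X * derivative (pencil H e w) - pencil H e w := by
    simp only [ramPoly, pencil, derivative_add, derivative_mul, derivative_X, derivative_sub,
      derivative_C]
    ring
  have h2 : (pencil H e w).rootMultiplicity s - 1 ≤ (ramPoly H e).rootMultiplicity s := by
    rw [le_rootMultiplicity_iff (ramPoly_ne_zero H he), h1]
    have h3 := pow_rootMultiplicity_dvd (pencil H e w) s
    refine dvd_sub (Dvd.dvd.mul_left (pow_sub_one_dvd_derivative_of_pow_dvd h3) _)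
      ((pow_dvd_pow _ (Nat.sub_le _ _)).trans h3)
  omega

lemma rootMultiplicity_pencil_eq_zero {H : F[X]} {e : F} (he : e ≠ 0) {w s : F}
    (h : s ≠ 0 → H.eval s + e / s ≠ w) : (pencil H e w).rootMultiplicity s = 0 := by
  refine rootMultiplicity_eq_zero fun h1 => ?_
  simp only [pencil, IsRoot.def, eval_add, eval_mul, eval_X, eval_sub, eval_C] at h1
  by_cases hs : s = 0
  · simp [hs] at h1
    exact he h1
  · refine h hs ?_
    field_simp
    linear_combination h1

lemma sum_rootMultiplicity_fiberPoly_add_one_le [Fintype F] {k : ℕ} (hk : 1 ≤ k) {H : F[X]}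
    (hd : H.natDegree = k) (hH : H.coeff k = 1) {e : F} (he : e ≠ 0) {t : F} (ht : t ≠ 0) :
    ∑ b : F, (fiberPoly k (coef k H e) t⁻¹).rootMultiplicity b + 1 ≤
      ∑ s, (pencil H e (H.eval t + e / t)).rootMultiplicity s := by
  classical
  set w := H.eval t + e / t with hw
  have h1 : (X - C 1) * (C (t ^ (k + 1)) * fiberPoly k (coef k H e) t⁻¹) =
      (pencil H e w).comp (C t * X) := by
    have h2 := sub_one_mul_phi_coef hd e (x := C t⁻¹) (t := C t)
      (by rw [← C_mul, inv_mul_cancel₀ ht, C_1]) (X : F[X])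
    have h3 : e = t * w - t * H.eval t := by rw [hw]; field_simp; ring
    have h4 : aeval (C t) H = C (H.eval t) := by
      rw [← algebraMap_eq, aeval_algebraMap_apply, coe_aeval_eq_eval]
    have h5 : aeval (C t * X) H = H.comp (C t * X) := by rw [comp, aeval_def]; rfl
    rw [h4, h5, algebraMap_eq] at h2
    have h6 : (C e : F[X]) = C t * C w - C t * C (H.eval t) := by
      rw [← C_mul, ← C_mul, ← C_sub, ← h3]
    rw [pencil, C_1, C_pow, fiberPoly, h2, add_comp, mul_comp, X_comp, sub_comp, C_comp, C_comp, h6]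
    ring
  have hmono := (fiberPoly_monic hk (coef_zero_self hk hH e) t⁻¹).1
  have h7 : C (t ^ (k + 1)) * fiberPoly k (coef k H e) t⁻¹ ≠ 0 :=
    mul_ne_zero (C_ne_zero.2 (pow_ne_zero _ ht)) hmono.ne_zero
  have h8 : ∀ b, (fiberPoly k (coef k H e) t⁻¹).rootMultiplicity b + (if b = 1 then 1 else 0) ≤
      (pencil H e w).rootMultiplicity (t * b) := by
    intro b
    refine le_trans (le_of_eq ?_)
      (rootMultiplicity_comp_C_mul_X_le (pencil_ne_zero H he w) ht b)
    rw [← h1, rootMultiplicity_mul (mul_ne_zero (X_sub_C_ne_zero 1) h7), rootMultiplicity_mul h7,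
      rootMultiplicity_C, rootMultiplicity_X_sub_C, zero_add, add_comm]
  have h9 : ∑ b, (pencil H e w).rootMultiplicity (t * b) =
      ∑ s, (pencil H e w).rootMultiplicity s :=
    Fintype.sum_equiv (Equiv.mulLeft₀ t ht) _ _ fun _ => rfl
  rw [← h9]
  refine le_trans (le_of_eq ?_) (Finset.sum_le_sum fun b _ => h8 b)
  rw [Finset.sum_add_distrib]
  simp

lemma sum_le_sum_add_mul {α β : Type*} [DecidableEq α] [DecidableEq β] {A T : Finset α}
    (hT : T ⊆ A) {f : α → β} (hf : Set.InjOn f T) (μ : β → α → ℕ) {N : ℕ}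
    (hN : ∀ w, ∑ s ∈ A, μ w s ≤ N) (h0 : ∀ w s, s ∈ A → f s ≠ w → μ w s = 0) :
    ∑ t ∈ A, ∑ s ∈ A, μ (f t) s ≤ ∑ s ∈ A, μ (f s) s + N * (A \ T).card := by
  rw [← Finset.sum_sdiff hT, add_comm]
  refine add_le_add ?_ ?_
  · rw [Finset.sum_comm]
    refine Finset.sum_le_sum fun s hs => ?_
    by_cases h : ∃ t ∈ T, f t = f s
    · obtain ⟨t, ht, hts⟩ := h
      rw [Finset.sum_eq_single t, hts]
      · intro t' ht' hne
        exact h0 _ _ hs fun h => hne (hf ht' ht (h.symm.trans hts.symm))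
      · exact fun h => absurd ht h
    · push Not at h
      rw [Finset.sum_eq_zero fun t ht => h0 _ _ hs (h t ht).symm]
      exact Nat.zero_le _
  · refine (Finset.sum_le_card_nsmul _ _ N fun t _ => hN _).trans (le_of_eq ?_)
    rw [smul_eq_mul, mul_comm]

/-- The number of rational points of the curve outside the line `u = 0`. -/
lemma sum_rootMultiplicity_fiberPoly_le [Fintype F] [DecidableEq F] {k : ℕ} (hk : 1 ≤ k) {H : F[X]}
    (hd : H.natDegree = k) (hH : H.coeff k = 1) {e : F} (he : e ≠ 0) {T : Finset F}
    (hT : (0 : F) ∉ T) (hinj : Set.InjOn (fun t => H.eval t + e / t) T) {n : ℕ}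
    (hn : Fintype.card F ≤ T.card + (n + 1)) :
    ∑ a ∈ Finset.univ.erase 0, ∑ b : F, (fiberPoly k (coef k H e) a).rootMultiplicity b ≤
      (k + 1) * n + (ramPoly H e).natDegree := by
  set A : Finset F := Finset.univ.erase 0 with hA
  have hTA : T ⊆ A := fun t ht => by
    simp only [hA, Finset.mem_erase, Finset.mem_univ, and_true]
    rintro rfl
    exact hT ht
  have hcard : (A \ T).card ≤ n := by
    rw [Finset.card_sdiff_of_subset hTA, hA, Finset.card_erase_of_mem (Finset.mem_univ _),
      Finset.card_univ]
    omega
  have h1 : ∑ a ∈ A, ∑ b : F, (fiberPoly k (coef k H e) a).rootMultiplicity b =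
      ∑ t ∈ A, ∑ b : F, (fiberPoly k (coef k H e) t⁻¹).rootMultiplicity b :=
    (Finset.sum_nbij' (fun t => t⁻¹) (fun t => t⁻¹) (by simp [hA]) (by simp [hA]) (by simp)
      (by simp) (fun _ _ => rfl)).symm
  have h0 : ∀ w, ∑ s, (pencil H e w).rootMultiplicity s =
      ∑ s ∈ A, (pencil H e w).rootMultiplicity s := by
    intro w
    rw [hA, ← Finset.add_sum_erase _ _ (Finset.mem_univ (0 : F)),
      rootMultiplicity_pencil_eq_zero he (fun h => absurd rfl h), zero_add]
  have h2 : ∑ t ∈ A, (∑ b : F, (fiberPoly k (coef k H e) t⁻¹).rootMultiplicity b + 1) ≤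
      ∑ t ∈ A, ∑ s ∈ A, (pencil H e (H.eval t + e / t)).rootMultiplicity s := by
    refine Finset.sum_le_sum fun t ht => ?_
    rw [← h0]
    exact sum_rootMultiplicity_fiberPoly_add_one_le hk hd hH he (Finset.ne_of_mem_erase ht)
  have h3 := sum_le_sum_add_mul hTA hinj (fun w s => (pencil H e w).rootMultiplicity s)
    (N := k + 1) (fun w => (sum_rootMultiplicity_le _ _).trans (hd ▸ natDegree_pencil_le H e w))
    (fun w s _ hw => rootMultiplicity_pencil_eq_zero he fun _ => hw)
  have h4 : ∑ s ∈ A, (pencil H e (H.eval s + e / s)).rootMultiplicity s ≤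
      ∑ s ∈ A, (1 + (ramPoly H e).rootMultiplicity s) :=
    Finset.sum_le_sum fun s _ => rootMultiplicity_pencil_le H he _ s
  have h5 := sum_rootMultiplicity_le (ramPoly H e) A
  have h6 : (k + 1) * (A \ T).card ≤ (k + 1) * n := Nat.mul_le_mul_left _ hcard
  rw [Finset.sum_add_distrib] at h2 h4
  rw [h1]
  omega

end

section

variable {F : Type v} [Field F] {k : ℕ} {H : F[X]} {e : F}

lemma coeff_phi_X_C (k : ℕ) (H : F[X]) (e b : F) (m : ℕ) :
    (phi k (coef k H e) (X : F[X]) (C b)).coeff m =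
      (if m ≤ k then H.coeff (k - m) * ∑ j ∈ Finset.range (k - m), b ^ (j + 1) else 0) -
        (if m = k + 1 then e else 0) := by
  have h1 := map_phi k (coef k H e) (X : F[X][X]) (C X) (mapAlgHom (aeval b : F[X] →ₐ[F] F))
  have h2 := congrArg (fun p => p.coeff m) h1
  simp only [coe_mapAlgHom, coeff_map, map_X, map_C] at h2
  rw [coeff_swap_poly] at h2
  simp only [RingHom.coe_coe, aeval_X] at h2
  rw [← h2, map_sub]
  congr 1
  · split_ifs <;> simp [eval_finsetSum]
  · split_ifs <;> simp

lemma phi_X_C_ne_zero (he : e ≠ 0) (b : F) : phi k (coef k H e) (X : F[X]) (C b) ≠ 0 := by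
  intro h
  have := coeff_phi_X_C k H e b (k + 1)
  rw [h, if_neg (by omega), if_pos rfl] at this
  simp at this
  exact he this

lemma rootMultiplicity_zero_le {p : F[X]} {m : ℕ} (h : p.coeff m ≠ 0) :
    p.rootMultiplicity 0 ≤ m := by
  by_contra! h1
  have h2 := pow_rootMultiplicity_dvd p 0
  rw [C_0, sub_zero, X_pow_dvd_iff] at h2
  exact h (h2 m h1)

lemma rootMultiplicity_phi_X_one_le (hd : H.natDegree = k) (hk : 1 ≤ k) (he : e ≠ 0) :
    (phi k (coef k H e) (X : F[X]) (C 1)).rootMultiplicity 0 + (ramPoly H e).natDegree ≤ k + 1 := by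
  have h1 := natDegree_ramPoly_le (hd.symm ▸ hk) e
  rw [hd] at h1
  have h2 : ∀ j ≤ k + 1, (phi k (coef k H e) (X : F[X]) (C 1)).coeff (k + 1 - j) =
      (ramPoly H e).coeff j := by
    intro j hj
    rw [coeff_phi_X_C, ramPoly, coeff_sub, coeff_X_pow_mul', coeff_C]
    obtain _ | _ | j := j
    · simp
    · simp
    · rw [if_pos (by omega), if_neg (by omega), if_pos (by omega), if_neg (by omega),
        coeff_derivative, show k - (k + 1 - (j + 1 + 1)) = j + 1 by omega]
      simp
  have h3 : (phi k (coef k H e) (X : F[X]) (C 1)).rootMultiplicity 0 ≤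
      k + 1 - (ramPoly H e).natDegree := by
    refine rootMultiplicity_zero_le ?_
    rw [h2 _ h1]
    exact leadingCoeff_ne_zero.2 (ramPoly_ne_zero H he)
  omega

lemma sub_one_mul_fiberPoly_coef_zero (hH : H.coeff k = 1) :
    (X - 1) * fiberPoly k (coef k H e) (0 : F) = X ^ (k + 1) - X := by
  rw [fiberPoly_coef_zero hH]
  have : ∑ j ∈ Finset.range k, (X : F[X]) ^ (j + 1) = X * ∑ j ∈ Finset.range k, X ^ j := by
    rw [Finset.mul_sum]
    exact Finset.sum_congr rfl fun j _ => by ring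
  rw [this, mul_left_comm, mul_geom_sum]
  ring

lemma pow_eq_one_of_rootMultiplicity_ne_zero (hH : H.coeff k = 1) {b : F} (hb : b ≠ 0)
    (h : (fiberPoly k (coef k H e) (0 : F)).rootMultiplicity b ≠ 0) : b ^ k = 1 := by
  have h1 : (fiberPoly k (coef k H e) (0 : F)).eval b = 0 := by
    by_contra h2
    exact h (rootMultiplicity_eq_zero h2)
  have h2 := congrArg (eval b) (sub_one_mul_fiberPoly_coef_zero (e := e) hH)
  rw [eval_mul, h1, mul_zero] at h2
  simp only [eval_sub, eval_pow, eval_X] at h2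
  have h3 : b * (b ^ k - 1) = 0 := by rw [h2]; ring
  exact sub_eq_zero.1 ((mul_eq_zero.1 h3).resolve_left hb)

lemma rootMultiplicity_fiberPoly_zero_zero (hk : 1 ≤ k) (hH : H.coeff k = 1) :
    (fiberPoly k (coef k H e) (0 : F)).rootMultiplicity 0 ≤ 1 := by
  refine rootMultiplicity_zero_le ?_
  rw [fiberPoly_coef_zero hH]
  obtain ⟨k', rfl⟩ := Nat.exists_eq_add_of_le' hk
  simp [finsetSum_coeff, coeff_X_pow, Finset.sum_range_succ']

lemma rootMultiplicity_fiberPoly_zero_le_one (hH : H.coeff k = 1) (hk : (k : F) ≠ 0) {b : F}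
    (hb : b ^ k = 1) : (fiberPoly k (coef k H e) (0 : F)).rootMultiplicity b ≤ 1 := by
  by_contra! h1
  have hp : fiberPoly k (coef k H e) (0 : F) ≠ 0 := by
    intro h
    simp [h] at h1
  obtain ⟨h2, h3⟩ := (one_lt_rootMultiplicity_iff_isRoot hp).1 h1
  have h4 := congrArg (fun p => (derivative p).eval b)
    (sub_one_mul_fiberPoly_coef_zero (e := e) hH)
  simp only [derivative_mul, eval_add, eval_mul, h2.eq_zero, h3.eq_zero, mul_zero, add_zero] at h4
  simp [hb] at h4
  exact hk h4.symm

lemma rootMultiplicity_phi_X_le_one (hk : 1 ≤ k) (hH : H.coeff k = 1)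
    (hH' : H.coeff (k - 1) ≠ 0) {b : F} (hb : b ^ k = 1) (hb1 : b ≠ 1) :
    (phi k (coef k H e) (X : F[X]) (C b)).rootMultiplicity 0 ≤ 1 := by
  refine rootMultiplicity_zero_le ?_
  rw [coeff_phi_X_C, if_pos hk, if_neg (by omega), sub_zero]
  refine mul_ne_zero hH' fun h => ?_
  have h1 : (b - 1) * ∑ j ∈ Finset.range (k - 1), b ^ (j + 1) = b ^ k - b := by
    obtain ⟨k', rfl⟩ := Nat.exists_eq_add_of_le' hk
    have : ∑ j ∈ Finset.range k', b ^ (j + 1) = b * ∑ j ∈ Finset.range k', b ^ j := by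
      rw [Finset.mul_sum]
      exact Finset.sum_congr rfl fun j _ => by ring
    rw [Nat.add_sub_cancel, this, mul_left_comm, mul_geom_sum]
    ring
  rw [h, mul_zero, hb] at h1
  exact hb1 (sub_eq_zero.1 h1.symm).symm

lemma card_pow_eq_one_le [Fintype F] [DecidableEq F] (hk : 1 ≤ k) :
    (Finset.univ.filter fun b : F => b ≠ 1 ∧ b ^ k = 1).card + 1 ≤
      Nat.gcd k (Fintype.card F - 1) := by
  set ν := Nat.gcd k (Fintype.card F - 1) with hν
  have hν0 : 0 < ν := Nat.gcd_pos_of_pos_left _ hk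
  have h1 : insert 1 (Finset.univ.filter fun b : F => b ≠ 1 ∧ b ^ k = 1) ⊆
      (nthRoots ν (1 : F)).toFinset := by
    intro b hb
    rw [Multiset.mem_toFinset, mem_nthRoots hν0]
    rw [Finset.mem_insert, Finset.mem_filter] at hb
    rcases hb with rfl | ⟨_, _, hb⟩
    · exact one_pow _
    · have hb0 : b ≠ 0 := by
        rintro rfl
        rw [zero_pow (by omega)] at hb
        exact zero_ne_one hb
      exact pow_gcd_eq_one.2 ⟨hb, FiniteField.pow_card_sub_one_eq_one b hb0⟩
  have h2 := Finset.card_le_card h1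
  rw [Finset.card_insert_of_notMem (by simp)] at h2
  exact h2.trans ((Multiset.toFinset_card_le _).trans (card_nthRoots _ _))

/-- The weight of the rational points on the line `u = 0`. -/
lemma sum_min_rootMultiplicity_le [Fintype F] (hk : 1 ≤ k) (hd : H.natDegree = k)
    (hH : H.coeff k = 1) (he : e ≠ 0)
    (hgood : ∀ b : F, b ≠ 1 → b ^ k = 1 → (k : F) ≠ 0 ∨ H.coeff (k - 1) ≠ 0) :
    ∑ b : F, min ((fiberPoly k (coef k H e) (0 : F)).rootMultiplicity b)
        ((phi k (coef k H e) (X : F[X]) (C b)).rootMultiplicity 0) + (ramPoly H e).natDegree ≤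
      k + 1 + Nat.gcd k (Fintype.card F - 1) := by
  classical
  have h1 := rootMultiplicity_phi_X_one_le (e := e) hd hk he
  have h2 := card_pow_eq_one_le (F := F) hk
  set r := (phi k (coef k H e) (X : F[X]) (C 1)).rootMultiplicity 0
  have h3 : ∀ b : F, min ((fiberPoly k (coef k H e) (0 : F)).rootMultiplicity b)
        ((phi k (coef k H e) (X : F[X]) (C b)).rootMultiplicity 0) ≤
      (if b = 0 then 1 else 0) + (if b = 1 then r else 0) +
        (if b ≠ 1 ∧ b ^ k = 1 then 1 else 0) := by
    intro b
    by_cases h0 : b = 0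
    · subst h0
      have := rootMultiplicity_fiberPoly_zero_zero (e := e) hk hH
      rw [if_pos rfl]
      omega
    by_cases h1 : b = 1
    · subst h1
      simp [r]
    by_cases h3 : b ^ k = 1
    · simp only [h0, h1, h3, if_false, ne_eq, not_false_eq_true, true_and, if_true, zero_add]
      rcases hgood b h1 h3 with h4 | h4
      · exact (min_le_left _ _).trans (rootMultiplicity_fiberPoly_zero_le_one hH h4 h3)
      · exact (min_le_right _ _).trans (rootMultiplicity_phi_X_le_one hk hH h4 h3 h1)
    · have : (fiberPoly k (coef k H e) (0 : F)).rootMultiplicity b = 0 := by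
        by_contra h4
        exact h3 (pow_eq_one_of_rootMultiplicity_ne_zero hH h0 h4)
      rw [this]
      simp
  have h4 := Finset.sum_le_sum fun b (_ : b ∈ Finset.univ) => h3 b
  rw [Finset.sum_add_distrib, Finset.sum_add_distrib, Finset.sum_ite_eq' , Finset.sum_ite_eq',
    ← Finset.card_filter] at h4
  simp only [Finset.mem_univ, if_true] at h4
  omega

end

section

variable {F : Type v} [Field F] [Fintype F] {k : ℕ} {H : F[X]} {e : F}

lemma mem_quot_of_mul_eq {B : Type v} [CommRing B] [Algebra F B] {q : ℕ}
    (hq : Fintype.card F = q + 1) {u y x : B} {n : ℕ}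
    (hx : ∃ x', x * (y - y ^ (q + 1)) ^ n = x' * (u - u ^ (q + 1)) ^ n) (s : Finset F) :
    x ∈ quot (Ideal.span {(∏ a ∈ s, (u - algebraMap F B a)) ^ n})
      ((y ^ Fintype.card F - y) ^ n) := by
  obtain ⟨x', hx'⟩ := hx
  have h1 : x * (y ^ (q + 1) - y) ^ n = x' * (u ^ (q + 1) - u) ^ n := by
    rw [← neg_sub y, ← neg_sub u, neg_pow, neg_pow (u - _), mul_left_comm, hx', mul_left_comm]
  rw [mem_quot, hq, h1, Ideal.mem_span_singleton, ← hq, pow_card_sub_eq_prod]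
  exact (pow_dvd_pow_of_dvd
    (Finset.prod_dvd_prod_of_subset _ _ _ (Finset.subset_univ s)) n).mul_left _

/-- The Frobenius bound, for the curve attached to a fractional linear transformation. -/
theorem coef_le_of_forall_lead (hk : 2 ≤ k) (hH : H.coeff k = 1) (he : e ≠ 0) {q : ℕ}
    (hq : Fintype.card F = q + 1) {M γ : ℝ} (hM0 : 0 ≤ M) (hγ1 : γ ≤ 1)
    (hM : ∀ (B : Type v) [CommRing B] [IsDomain B] [Algebra F B] (u y : B)
      (_ : IsCurve k (coef k H e) u y) (z : PowerSeries (FractionRing B))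
      (_ : PowerSeries.constantCoeff z = algebraMap B (FractionRing B) y)
      (_ : phi k (coef k H e) (PowerSeries.C (algebraMap B (FractionRing B) u) + PowerSeries.X) z
        = 0) (n i D : ℕ) (x : B), x ≠ 0 → x ∈ fil F k u y D →
      IsLead k (coef k H e) (algebraMap B (FractionRing B) u) (algebraMap B (FractionRing B) y)
        z i (algebraMap B (FractionRing B) x) →
      (∃ x', x * (y - y ^ (q + 1)) ^ n = x' * (u - u ^ (q + 1)) ^ n) →
      n * (k * (q + 1) - M) + γ * i ≤ D)
    (hG : (k : ℝ) * (k - 1) ≤ √(q + 1)) :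
    (q + 1) - k * (k - 1) * √(q + 1) + γ * √(q + 1) / 2 ≤ M := by
  have hk1 : 1 ≤ k := by omega
  have hc := coef_zero_self hk1 hH e
  obtain ⟨B, _, _, u, y, _, h⟩ := exists_isCurve hk1 hc (irreducible_poly_coef hk1 hH he)
  let f : B →ₐ[F] FractionRing B := IsScalarTower.toAlgHom F B (FractionRing B)
  have hf : Function.Injective f := IsFractionRing.injective B (FractionRing B)
  have hψ : ddY k (coef k H e) (f u) (f y) (f y) ≠ 0 := by
    rw [← map_ddY]
    exact (map_ne_zero_iff f hf).2 (h.ddY_coef_ne_zero hk1 hH)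
  obtain ⟨z, hz0, hz⟩ := exists_arc hk1 hc (by rw [← map_phi, h.rel, map_zero]) hψ
  have hne : u ^ (q + 1) ≠ u := by
    intro h1
    have h2 := h.eq_zero_of_aeval_left hk1 (p := X ^ Fintype.card F - X) (by
      rw [map_sub, map_pow, aeval_X, hq, h1, sub_self])
    exact FiniteField.X_pow_card_sub_X_ne_zero F Fintype.one_lt_card h2
  exact h.le_of_forall_lead hk hc hq f hf
    (by rw [coef_map]; exact irreducible_poly_coef hk1 (by simp [hH]) (by simpa using he))
    hz0 hz hψ hne hM0 hγ1 (hM B u y h z hz0 hz) hG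

theorem coef_bound_of_good (hk : 2 ≤ k) (hd : H.natDegree = k) (hH : H.coeff k = 1)
    (he : e ≠ 0) {T : Finset F}
    (hT : (0 : F) ∉ T) (hinj : Set.InjOn (fun t => H.eval t + e / t) T) {n : ℕ}
    (hn : Fintype.card F ≤ T.card + (n + 1))
    (hgood : ∀ b : F, b ≠ 1 → b ^ k = 1 → (k : F) ≠ 0 ∨ H.coeff (k - 1) ≠ 0)
    (hG : (k : ℝ) * (k - 1) ≤ √(Fintype.card F)) :
    (Fintype.card F : ℝ) - k * (k - 1) * √(Fintype.card F) ≤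
      (k + 1) * (n + 1) + Nat.gcd k (Fintype.card F - 1) := by
  classical
  obtain ⟨q, hq⟩ : ∃ q, Fintype.card F = q + 1 :=
    ⟨Fintype.card F - 1, by have := Fintype.card_pos (α := F); omega⟩
  have hk1 : 1 ≤ k := by omega
  have h1 := sum_rootMultiplicity_fiberPoly_le hk1 hd hH he hT hinj hn
  have h2 := sum_min_rootMultiplicity_le hk1 hd hH he hgood
  let μ : F → F → ℕ := fun a b => if a = 0 then
    min ((fiberPoly k (coef k H e) (0 : F)).rootMultiplicity b)
        ((phi k (coef k H e) (X : F[X]) (C b)).rootMultiplicity 0)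
    else (fiberPoly k (coef k H e) a).rootMultiplicity b
  have h3 : ∑ a, ∑ b, μ a b ≤ (k + 1) * (n + 1) + Nat.gcd k (Fintype.card F - 1) := by
    rw [← Finset.add_sum_erase _ _ (Finset.mem_univ (0 : F))]
    have h4 : ∑ a ∈ Finset.univ.erase 0, ∑ b, μ a b =
        ∑ a ∈ Finset.univ.erase 0, ∑ b : F, (fiberPoly k (coef k H e) a).rootMultiplicity b :=
      Finset.sum_congr rfl fun a ha => by simp only [μ, if_neg (Finset.ne_of_mem_erase ha)]
    rw [h4]
    simp only [μ, if_true]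
    rw [mul_add, mul_one]
    omega
  have hc := coef_zero_self hk1 hH e
  have main := coef_le_of_forall_lead hk hH he hq (M := (∑ a, ∑ b, μ a b : ℕ)) (γ := 0)
    (by positivity) zero_le_one ?_ (by rw [hq] at hG; exact_mod_cast hG)
  · have h3' : ((∑ a, ∑ b, μ a b : ℕ) : ℝ) ≤
        (k + 1) * (n + 1) + Nat.gcd k (Fintype.card F - 1) := by exact_mod_cast h3
    rw [hq] at h3' ⊢
    push_cast at h3' main ⊢
    linarith
  · intro B _ _ _ u y h z _ _ n i D x hx0 hxD _ hx
    have h5 := h.le_colen_quot hk1 hc Finset.univ μ n (by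
      intro a _ b
      by_cases ha : a = 0
      · subst ha
        simp only [μ, if_true]
        rcases min_choice ((fiberPoly k (coef k H e) (0 : F)).rootMultiplicity b)
          ((phi k (coef k H e) (X : F[X]) (C b)).rootMultiplicity 0) with hm | hm <;> rw [hm]
        · simpa using h.colen_pow_pow_le_left hk1 hc 0 b n
        · simpa using h.colen_pow_pow_le_right 0 b (phi_X_C_ne_zero he b) n
      · simp only [μ, if_neg ha]
        simpa using h.colen_pow_pow_le_left hk1 hc a b n)
    have h6 := h.colen_le hk1 hc hx0 hxD (mem_quot_of_mul_eq hq hx Finset.univ)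
    have h7 := h5.trans (add_le_add h6 le_rfl)
    have h8 : n * (Fintype.card F * k) ≤ D + n * ∑ a, ∑ b, μ a b := by exact_mod_cast h7
    rw [hq] at h8
    have h9 : ((n * ((q + 1) * k) : ℕ) : ℝ) ≤ (D + n * ∑ a, ∑ b, μ a b : ℕ) := by exact_mod_cast h8
    push_cast at h9 ⊢
    linarith

end

section series

variable {O K : Type*} [CommRing O] [Field K] [Algebra O K]

lemma exists_sub_evalEval_eq (x₀ z₀ : O) (p : O[X][X]) : ∃ α β : O[X][X],
    p = C (C (p.evalEval x₀ z₀)) + (C X - C (C x₀)) * α + (X - C (C z₀)) * β := by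
  obtain ⟨β, hβ⟩ := X_sub_C_dvd_sub_C_eval (a := C z₀) (p := p)
  obtain ⟨α, hα⟩ := X_sub_C_dvd_sub_C_eval (a := x₀) (p := p.eval (C z₀))
  refine ⟨C α, β, ?_⟩
  have h1 := congrArg (C : O[X] → O[X][X]) hα
  rw [C_sub, C_mul, C_sub] at h1
  rw [evalEval]
  linear_combination hβ + h1

lemma constantCoeff_aevalAeval {x z : PowerSeries K} {x₀ z₀ : O}
    (hx : PowerSeries.constantCoeff x = algebraMap O K x₀)
    (hz : PowerSeries.constantCoeff z = algebraMap O K z₀) (p : O[X][X]) :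
    PowerSeries.constantCoeff (aevalAeval x z p) = algebraMap O K (p.evalEval x₀ z₀) := by
  obtain ⟨α, β, h⟩ := exists_sub_evalEval_eq x₀ z₀ p
  conv_lhs => rw [h]
  simp [hx, hz, PowerSeries.algebraMap_apply]

/-- Leading coefficients, along an arc, of polynomial functions with integral coefficients. -/
lemma exists_coeff_mul_pow_eq (hO : Function.Injective (algebraMap O K)) {x z : PowerSeries K}
    {x₀ z₀ : O} (hx : PowerSeries.constantCoeff x = algebraMap O K x₀)
    (hz : PowerSeries.constantCoeff z = algebraMap O K z₀)
    (hδ : PowerSeries.coeff 1 x ≠ 0) {a b : O[X][X]}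
    (hab : aevalAeval x z ((C X - C (C x₀)) * a + (X - C (C z₀)) * b) = 0) (i : ℕ) :
    ∀ s : O[X][X], (∀ j < i, PowerSeries.coeff j (aevalAeval x z s) = 0) →
      ∃ r : O, PowerSeries.coeff i (aevalAeval x z s) * algebraMap O K (b.evalEval x₀ z₀) ^ i =
        PowerSeries.coeff 1 x ^ i * algebraMap O K r := by
  obtain ⟨t, ht⟩ : (PowerSeries.X : PowerSeries K) ∣ x - PowerSeries.C (algebraMap O K x₀) :=
    PowerSeries.X_dvd_iff.2 (by simp [hx])
  have ht1 : PowerSeries.constantCoeff t = PowerSeries.coeff 1 x := by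
    have := congrArg (PowerSeries.coeff 1) ht
    rw [show (1 : ℕ) = 0 + 1 from rfl, PowerSeries.coeff_succ_X_mul] at this
    simpa [PowerSeries.coeff_C] using this.symm
  have htu : IsUnit t := PowerSeries.isUnit_iff_constantCoeff.2 (by rw [ht1]; exact hδ.isUnit)
  induction i with
  | zero =>
    intro s _
    exact ⟨s.evalEval x₀ z₀, by simpa using constantCoeff_aevalAeval hx hz s⟩
  | succ i ih =>
    intro s hs
    have hs0 : s.evalEval x₀ z₀ = 0 := by
      apply hO
      rw [← constantCoeff_aevalAeval hx hz, map_zero,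
        ← PowerSeries.coeff_zero_eq_constantCoeff_apply]
      exact hs 0 (Nat.succ_pos _)
    obtain ⟨α, β, h⟩ := exists_sub_evalEval_eq x₀ z₀ s
    rw [hs0, C_0, C_0, zero_add] at h
    set s' := α * b - a * β
    have h1 : aevalAeval x z s * aevalAeval x z b =
        PowerSeries.X * (aevalAeval x z s' * t) := by
      rw [← map_mul]
      have h2 : s * b =
          (C X - C (C x₀)) * s' + ((C X - C (C x₀)) * a + (X - C (C z₀)) * b) * β := by
        rw [h]
        ring
      rw [h2, map_add, map_mul _ _ β, hab, zero_mul, add_zero, map_mul, mul_left_comm, ← mul_assoc]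
      rw [mul_comm, mul_assoc, ← ht, mul_comm]
      simp [PowerSeries.algebraMap_apply, mul_comm]
    have h3 : ∀ j < i, PowerSeries.coeff j (aevalAeval x z s') = 0 := by
      rw [← PowerSeries.X_pow_dvd_iff, ← htu.dvd_mul_right]
      have h4 := (PowerSeries.X_pow_dvd_iff.2 hs).mul_right (aevalAeval x z b)
      rw [h1, pow_succ'] at h4
      exact (mul_dvd_mul_iff_left PowerSeries.X_ne_zero).1 h4
    obtain ⟨r, hr⟩ := ih s' h3
    refine ⟨r, ?_⟩
    have h5 := congrArg (PowerSeries.coeff (i + 1)) h1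
    rw [coeff_mul_of_vanishing hs, PowerSeries.coeff_succ_X_mul, coeff_mul_of_vanishing h3, ht1,
      constantCoeff_aevalAeval hx hz] at h5
    rw [pow_succ', ← mul_assoc, h5, pow_succ']
    linear_combination PowerSeries.coeff 1 x * hr

end series

section blowup

variable {F P : Type*} [Field F] [CommRing P] [Algebra F P] {k : ℕ} {H : F[X]} {e ζ : F}

lemma sq_dvd_phi_X_C (hk : 1 ≤ k) (hH : H.coeff (k - 1) = 0) (hζ : ζ ≠ 1)
    (hζk : ζ ^ k = 1) : (X : F[X]) ^ 2 ∣ phi k (coef k H e) X (C ζ) := by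
  rw [X_pow_dvd_iff]
  intro d hd
  interval_cases d
  · have h1 : ∑ j ∈ Finset.range k, ζ ^ (j + 1) = 0 := by
      have h2 := geom_sum_mul ζ k
      rw [hζk, sub_self] at h2
      simp only [pow_succ]
      rw [← Finset.sum_mul, (mul_eq_zero.1 h2).resolve_right (sub_ne_zero.2 hζ), zero_mul]
    rw [coeff_phi_X_C]
    simp [h1]
  · rw [coeff_phi_X_C, hH]
    simp
    omega

lemma ddX_zero_eq_zero (hk : 1 ≤ k) (hH : H.coeff (k - 1) = 0) (hζ : ζ ≠ 1)
    (hζk : ζ ^ k = 1) : ddX k (coef k H e) 0 0 ζ = 0 := by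
  obtain ⟨g, hg⟩ := sq_dvd_phi_X_C (e := e) hk hH hζ hζk
  have h1 := ddX_mul k (coef k H e) (X : F[X]) 0 (C ζ)
  have h2 : phi k (coef k H e) (0 : F[X]) (C ζ) = 0 := by
    have := congrArg (fun p => aeval (0 : F[X]) p) hg
    simp only [map_mul, map_pow, map_phi, aeval_X, aeval_C] at this
    simpa [← C_eq_algebraMap] using this
  rw [h2, hg, sub_zero, sub_zero, sq, mul_comm, mul_assoc] at h1
  have h3 := congrArg (fun p => aeval (0 : F) p) (mul_left_cancel₀ X_ne_zero h1)
  simp only [map_ddX, map_mul, aeval_X, zero_mul, map_zero, aeval_C] at h3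
  exact h3

lemma ddY_zero_eq_zero (hH : H.coeff k = 1) (hk : (k : F) = 0) (hζ : ζ ≠ 1)
    (hζk : ζ ^ k = 1) : ddY k (coef k H e) 0 ζ ζ = 0 := by
  rw [← eval_derivative_fiberPoly]
  have h1 := congrArg (eval ζ) (sub_one_mul_fiberPoly_coef_zero (e := e) hH)
  have h2 := congrArg (fun p => (derivative p).eval ζ) (sub_one_mul_fiberPoly_coef_zero (e := e) hH)
  simp only [derivative_mul, eval_add, eval_mul] at h2
  simp [pow_succ, hζk, sub_ne_zero.2 hζ] at h1
  simpa [h1, hζk, hk, sub_ne_zero.2 hζ] using h2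

lemma dvd_ddY (hH : H.coeff k = 1) (hk : (k : F) = 0) (hζ : ζ ≠ 1)
    (hζk : ζ ^ k = 1) (t v w w' : P) :
    t ∣ ddY k (coef k H e) (t * v) (algebraMap F P ζ + t * w) (algebraMap F P ζ + t * w') := by
  rw [← Ideal.mem_span_singleton, ← Ideal.Quotient.eq_zero_iff_mem, ← Ideal.Quotient.mkₐ_eq_mk F,
    map_ddY]
  have ht : Ideal.Quotient.mkₐ F (Ideal.span {t}) t = 0 :=
    Ideal.Quotient.eq_zero_iff_mem.2 (Ideal.mem_span_singleton_self t)
  simp only [map_add, map_mul, ht, zero_mul, add_zero, AlgHom.commutes]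
  have := map_ddY k (coef k H e) 0 ζ ζ (Algebra.ofId F (P ⧸ Ideal.span {t}))
  rw [ddY_zero_eq_zero hH hk hζ hζk] at this
  simpa [Algebra.ofId_apply] using this.symm

lemma dvd_ddX (hk : 1 ≤ k) (hH : H.coeff (k - 1) = 0) (hζ : ζ ≠ 1)
    (hζk : ζ ^ k = 1) (t v v' w : P) :
    t ∣ ddX k (coef k H e) (t * v) (t * v') (algebraMap F P ζ + t * w) := by
  rw [← Ideal.mem_span_singleton, ← Ideal.Quotient.eq_zero_iff_mem, ← Ideal.Quotient.mkₐ_eq_mk F,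
    map_ddX]
  have ht : Ideal.Quotient.mkₐ F (Ideal.span {t}) t = 0 :=
    Ideal.Quotient.eq_zero_iff_mem.2 (Ideal.mem_span_singleton_self t)
  simp only [map_add, map_mul, ht, zero_mul, add_zero, AlgHom.commutes]
  have := map_ddX k (coef k H e) 0 0 ζ (Algebra.ofId F (P ⧸ Ideal.span {t}))
  rw [ddX_zero_eq_zero hk hH hζ hζk] at this
  simpa [Algebra.ofId_apply] using this.symm

/-- The curve has a singular point at `(0, ζ)`. -/
lemma sq_dvd_phi (hk1 : 1 ≤ k) (hH : H.coeff k = 1) (hk : (k : F) = 0) (hH' : H.coeff (k - 1) = 0)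
    (hζ : ζ ≠ 1) (hζk : ζ ^ k = 1) (t v w : P) :
    t ^ 2 ∣ phi k (coef k H e) (t * v) (algebraMap F P ζ + t * w) := by
  have h1 := ddY_mul k (coef k H e) (t * v) (algebraMap F P ζ + t * w) (algebraMap F P ζ)
  have h2 := dvd_ddY (e := e) hH hk hζ hζk t v w 0
  rw [mul_zero, add_zero] at h2
  rw [eq_add_of_sub_eq h1.symm, add_sub_cancel_left, sq]
  refine dvd_add (mul_dvd_mul h2 (dvd_mul_right _ _)) ?_
  have h3 := map_dvd (aeval (t * v) : F[X] →ₐ[F] P)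
    (sq_dvd_phi_X_C (e := e) hk1 hH' hζ hζk)
  simp only [map_phi, map_pow, aeval_X, aeval_C] at h3
  refine dvd_trans ?_ h3
  rw [mul_pow, sq]
  exact dvd_mul_right _ _

end blowup

lemma bifil_le {F R : Type*} [Field F] [CommRing R] [Algebra F R] (A : Subalgebra F R) (k w : ℕ)
    {x y x' y' : R} (hx : x ∈ A) (hy : y ∈ A) (hx' : x' ∈ A) (hy' : y' ∈ A) (D : ℕ) :
    bifil F k w x y x' y' D ≤ A.toSubmodule := by
  rw [bifil, Submodule.span_le]
  rintro _ ⟨a, b, a', b', -, rfl⟩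
  exact A.mul_mem (A.mul_mem (A.pow_mem hx _) (A.pow_mem hy _))
    (A.mul_mem (A.pow_mem hx' _) (A.pow_mem hy' _))

section charts

variable {F O K : Type*} [Field F] [CommRing O] [Algebra F O] [Field K] [Algebra O K]
  [Algebra F K] [IsScalarTower F O K] {k : ℕ} {H : F[X]} {e ζ : F}

lemma exists_coeff_mul_pow_eq_of_eq (hO : Function.Injective (algebraMap O K))
    {x z : PowerSeries K} {x₀ z₀ : O} (hx : PowerSeries.constantCoeff x = algebraMap O K x₀)
    (hz : PowerSeries.constantCoeff z = algebraMap O K z₀)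
    (hδ : PowerSeries.coeff 1 x ≠ 0) {p b : O[X][X]} {g : O[X]}
    (hp : p = C g + (X - C (C z₀)) * b) (hp0 : aevalAeval x z p = 0) {i : ℕ} {s : O[X][X]}
    (hs : ∀ j < i, PowerSeries.coeff j (aevalAeval x z s) = 0) :
    ∃ r : O, PowerSeries.coeff i (aevalAeval x z s) * algebraMap O K (b.evalEval x₀ z₀) ^ i =
      PowerSeries.coeff 1 x ^ i * algebraMap O K r := by
  have h1 : p.evalEval x₀ z₀ = 0 := by
    apply hO
    rw [← constantCoeff_aevalAeval hx hz, hp0, map_zero, map_zero]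
  have h2 : g.eval x₀ = 0 := by
    rw [hp] at h1
    simpa [evalEval_C] using h1
  obtain ⟨α, hα⟩ := X_sub_C_dvd_sub_C_eval (a := x₀) (p := g)
  rw [h2, C_0, sub_zero] at hα
  refine exists_coeff_mul_pow_eq (a := C α) hO hx hz hδ ?_ i s hs
  rw [← hp0, hp, hα, C_mul, C_sub]

end charts

/-- Implicit differentiation along an arc. -/
lemma coeff_one_mul_ddY {F K : Type*} [Field F] [Field K] [Algebra F K] {k : ℕ} {c : ℕ × ℕ → F}
    {u y : K} {z : PowerSeries K} (hz0 : PowerSeries.constantCoeff z = y)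
    (hz : phi k c (PowerSeries.C u + PowerSeries.X) z = 0) :
    PowerSeries.coeff 1 z * ddY k c u y y = - ddX k c u u y := by
  have h1 : phi k c u y = 0 := by
    have := congrArg (constHom F K) hz
    rw [map_phi, constHom_apply, constHom_apply, hz0] at this
    simpa [phi] using this
  let ι : K →ₐ[F] PowerSeries K := IsScalarTower.toAlgHom F K (PowerSeries K)
  have hι : ∀ x, ι x = PowerSeries.C x := fun x => by simp [ι]
  have h2 : phi k c (PowerSeries.C u) (PowerSeries.C y) = 0 := by
    rw [← hι, ← hι, ← map_phi, h1, map_zero]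
  have h3 := congrArg (PowerSeries.coeff 1) (ddY_mul_eq_ddX_mul hz h2)
  rw [mul_comm, coeff_mul_of_vanishing (by simp [hz0]), sub_add_cancel_left,
    mul_comm (ddX _ _ _ _ _), coeff_mul_of_vanishing (by simp),
    ← constHom_apply F K, ← constHom_apply F K, map_ddY,
    map_ddX] at h3
  simpa [constHom_apply, hz0, PowerSeries.coeff_C] using h3

section charts

variable {F O K : Type*} [Field F] [CommRing O] [IsDomain O] [Algebra F O] [Field K] [Algebra O K]
  [Algebra F K] [IsScalarTower F O K] {k : ℕ} {H : F[X]} {e ζ : F}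

lemma exists_lead_chart_left (hk1 : 1 ≤ k) (hH : H.coeff k = 1) (hk : (k : F) = 0)
    (hH' : H.coeff (k - 1) = 0) (hζ : ζ ≠ 1) (hζk : ζ ^ k = 1)
    (hO : Function.Injective (algebraMap O K)) {u v y : O} (hy : y = algebraMap F O ζ + u * v)
    (hu : u ≠ 0) {z : PowerSeries K} (hz0 : PowerSeries.constantCoeff z = algebraMap O K y)
    (hz : phi k (coef k H e) (PowerSeries.C (algebraMap O K u) + PowerSeries.X) z = 0)
    {i : ℕ} {h : K}
    (hh : IsLead k (coef k H e) (algebraMap O K u) (algebraMap O K y) z i h) :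
    ∃ r : O, h = algebraMap O K (u ^ i * r) := by
  obtain ⟨D, s, hs, hv, rfl⟩ := hh
  have hu' : algebraMap O K u ≠ 0 := (map_ne_zero_iff _ hO).2 hu
  set x : PowerSeries K := PowerSeries.C (algebraMap O K u) + PowerSeries.X with hx
  have hx0 : PowerSeries.constantCoeff x = algebraMap O K u := by simp [hx]
  have hx1 : PowerSeries.coeff 1 x = 1 := by simp [hx]
  have hxx : x * x⁻¹ = 1 := PowerSeries.mul_inv_cancel _ (by rwa [hx0])
  set t : PowerSeries K := (z - algebraMap F _ ζ) * x⁻¹ with ht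
  have hzt : z = algebraMap F _ ζ + x * t := by
    rw [ht]
    linear_combination (algebraMap F (PowerSeries K) ζ - z) * hxx
  have ht0 : PowerSeries.constantCoeff t = algebraMap O K v := by
    have h1 := congrArg PowerSeries.constantCoeff hzt
    rw [hz0, hy, map_add, map_add, map_mul, map_mul, hx0, ← constHom_apply F K (algebraMap F _ ζ),
      AlgHom.commutes, ← IsScalarTower.algebraMap_apply] at h1
    exact (mul_left_cancel₀ hu' (add_left_cancel h1)).symm
  let ev : O[X][X] →ₐ[F] PowerSeries K := (aevalAeval x t).restrictScalars F
  have hev : ∀ p, ev p = aevalAeval x t p := fun _ => rfl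
  obtain ⟨p, hp⟩ := sq_dvd_phi (e := e) hk1 hH hk hH' hζ hζk (C X : O[X][X]) 1 X
  obtain ⟨g, hg⟩ := sq_dvd_phi (e := e) hk1 hH hk hH' hζ hζk (X : O[X]) 1 (C v)
  obtain ⟨b, hb⟩ := dvd_ddY (e := e) hH hk hζ hζk (C X : O[X][X]) 1 X (C (C v))
  have hX : (C X : O[X][X]) ≠ 0 := C_ne_zero.2 X_ne_zero
  have hpb : p = C g + (X - C (C v)) * b := by
    have h1 := ddY_mul k (coef k H e) (C X * 1 : O[X][X]) (algebraMap F _ ζ + C X * X)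
      (algebraMap F _ ζ + C X * C (C v))
    have h2 := congrArg (CAlgHom (R := F) (A := O[X])) hg
    simp only [map_phi, map_add, map_mul, map_pow, AlgHom.commutes, CAlgHom_apply, C_1] at h2
    rw [hp, hb, h2] at h1
    refine mul_left_cancel₀ (pow_ne_zero 2 hX) ?_
    linear_combination -h1
  have hp0 : aevalAeval x t p = 0 := by
    have h1 := congrArg ev hp
    simp only [map_phi, map_add, map_mul, map_pow, AlgHom.commutes, mul_one] at h1
    simp only [hev, aevalAeval_X, aevalAeval_Y] at h1
    rw [← hzt, hz] at h1
    refine (mul_eq_zero.1 h1.symm).resolve_left (pow_ne_zero 2 ?_)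
    intro h2
    rw [h2, map_zero] at hx0
    exact hu' hx0.symm
  have hb0 : u * b.evalEval u v = ddY k (coef k H e) u y y := by
    let ee : O[X][X] →ₐ[F] O := (aevalAeval u v).restrictScalars F
    have hee : ∀ p, ee p = p.evalEval u v := fun p => by
      rw [← coe_aevalAeval_eq_evalEval]
      rfl
    have h1 := congrArg ee hb
    simp only [map_ddY, map_add, map_mul, AlgHom.commutes, mul_one] at h1
    simp only [hee] at h1
    simpa [evalEval_C, hy] using h1.symm
  obtain ⟨r', rfl⟩ : s ∈ ev.range := by
    refine bifil_le ev.range k 1 (D := D) ⟨C (C u), ?_⟩ ⟨C (C y), ?_⟩ ⟨C X, ?_⟩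
      ⟨algebraMap F _ ζ + C X * X, ?_⟩ hs
    · simp [hev, PowerSeries.algebraMap_apply]
    · simp [hev, PowerSeries.algebraMap_apply]
    · simp [hev]
    · change ev _ = z
      rw [map_add, map_mul, AlgHom.commutes, hev, hev, aevalAeval_X, aevalAeval_Y, ← hzt]
  obtain ⟨r, hr⟩ := exists_coeff_mul_pow_eq_of_eq hO hx0 ht0 (by simp [hx1]) hpb hp0 hv
  refine ⟨r, ?_⟩
  have h3 := map_ddY k (coef k H e) u y y (IsScalarTower.toAlgHom F O K)
  simp only [IsScalarTower.coe_toAlgHom'] at h3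
  rw [← h3, ← hb0, map_mul, mul_pow, mul_left_comm]
  change _ * (PowerSeries.coeff i (aevalAeval x t r') * _) = _
  rw [hr, hx1, one_pow, one_mul, map_mul, map_pow]

lemma exists_lead_chart_right (hk1 : 1 ≤ k) (hH : H.coeff k = 1) (hk : (k : F) = 0)
    (hH' : H.coeff (k - 1) = 0) (hζ : ζ ≠ 1) (hζk : ζ ^ k = 1)
    (hO : Function.Injective (algebraMap O K)) {w v y : O} (hy : y = algebraMap F O ζ + w)
    (hw : w ≠ 0) {z : PowerSeries K} (hz0 : PowerSeries.constantCoeff z = algebraMap O K y)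
    (hz : phi k (coef k H e) (PowerSeries.C (algebraMap O K (w * v)) + PowerSeries.X) z = 0)
    (hne : ddX k (coef k H e) (w * v) (w * v) y ≠ 0) {i : ℕ} {h : K}
    (hh : IsLead k (coef k H e) (algebraMap O K (w * v)) (algebraMap O K y) z i h) :
    ∃ r : O, h = algebraMap O K (w ^ i * r) := by
  obtain ⟨D, s, hs, hv, rfl⟩ := hh
  have hw' : algebraMap O K w ≠ 0 := (map_ne_zero_iff _ hO).2 hw
  set u := w * v with hu
  set x' : PowerSeries K := PowerSeries.C (algebraMap O K u) + PowerSeries.X with hx'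
  set x : PowerSeries K := z - algebraMap F _ ζ with hx
  have hzx : z = algebraMap F _ ζ + x := by rw [hx]; ring
  have hcζ : PowerSeries.constantCoeff (algebraMap F (PowerSeries K) ζ) = algebraMap F K ζ := by
    rw [← constHom_apply F K, AlgHom.commutes]
  have hx0 : PowerSeries.constantCoeff x = algebraMap O K w := by
    rw [hx, map_sub, hz0, hcζ, hy, map_add, ← IsScalarTower.algebraMap_apply, add_sub_cancel_left]
  have hxx : x * x⁻¹ = 1 := PowerSeries.mul_inv_cancel _ (by rwa [hx0])
  have hx1 : PowerSeries.coeff 1 x = PowerSeries.coeff 1 z := by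
    simp [hx, PowerSeries.algebraMap_apply]
  set t : PowerSeries K := x' * x⁻¹ with ht
  have hxt : x' = x * t := by
    rw [ht, mul_left_comm, hxx, mul_one]
  have ht0 : PowerSeries.constantCoeff t = algebraMap O K v := by
    have h1 := congrArg PowerSeries.constantCoeff hxt
    rw [map_mul, hx0, hx'] at h1
    simp only [map_add, PowerSeries.constantCoeff_C, PowerSeries.constantCoeff_X, add_zero, hu,
      map_mul] at h1
    exact (mul_left_cancel₀ hw' h1).symm
  let ev : O[X][X] →ₐ[F] PowerSeries K := (aevalAeval x t).restrictScalars F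
  have hev : ∀ p, ev p = aevalAeval x t p := fun _ => rfl
  let ee : O[X][X] →ₐ[F] O := (aevalAeval w v).restrictScalars F
  have hee : ∀ p, ee p = p.evalEval w v := fun p => by
    rw [← coe_aevalAeval_eq_evalEval]
    rfl
  obtain ⟨p, hp⟩ := sq_dvd_phi (e := e) hk1 hH hk hH' hζ hζk (C X : O[X][X]) X 1
  obtain ⟨g, hg⟩ := sq_dvd_phi (e := e) hk1 hH hk hH' hζ hζk (X : O[X]) (C v) 1
  obtain ⟨b, hb⟩ := dvd_ddX (e := e) hk1 hH' hζ hζk (C X : O[X][X]) X (C (C v)) 1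
  have hX : (C X : O[X][X]) ≠ 0 := C_ne_zero.2 X_ne_zero
  have hpb : p = C g + (X - C (C v)) * b := by
    have h1 := ddX_mul k (coef k H e) (C X * X : O[X][X]) (C X * C (C v))
      (algebraMap F _ ζ + C X * 1)
    have h2 := congrArg (CAlgHom (R := F) (A := O[X])) hg
    simp only [map_phi, map_add, map_mul, map_pow, AlgHom.commutes, CAlgHom_apply, C_1] at h2
    rw [hp, hb, h2] at h1
    refine mul_left_cancel₀ (pow_ne_zero 2 hX) ?_
    linear_combination -h1
  have hp0 : aevalAeval x t p = 0 := by
    have h1 := congrArg ev hp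
    simp only [map_phi, map_add, map_mul, map_pow, AlgHom.commutes, mul_one] at h1
    simp only [hev, aevalAeval_X, aevalAeval_Y] at h1
    rw [← hzx, ← hxt, hz] at h1
    refine (mul_eq_zero.1 h1.symm).resolve_left (pow_ne_zero 2 ?_)
    intro h2
    rw [h2, map_zero] at hx0
    exact hw' hx0.symm
  have hb0 : w * b.evalEval w v = ddX k (coef k H e) u u y := by
    have h1 := congrArg ee hb
    simp only [map_ddX, map_add, map_mul, AlgHom.commutes, mul_one] at h1
    simp only [hee] at h1
    simpa [evalEval_C, hy, hu] using h1.symm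
  have hY := map_ddY k (coef k H e) u y y (IsScalarTower.toAlgHom F O K)
  have hX := map_ddX k (coef k H e) u u y (IsScalarTower.toAlgHom F O K)
  simp only [IsScalarTower.coe_toAlgHom'] at hX hY
  have hslope : PowerSeries.coeff 1 z * algebraMap O K (ddY k (coef k H e) u y y) =
      - algebraMap O K (ddX k (coef k H e) u u y) := by
    rw [hX, hY]
    exact coeff_one_mul_ddY hz0 hz
  have hδ : PowerSeries.coeff 1 x ≠ 0 := by
    intro h1
    rw [← hx1, h1, zero_mul, eq_comm, neg_eq_zero, map_eq_zero_iff _ hO] at hslope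
    exact hne hslope
  obtain ⟨r', rfl⟩ : s ∈ ev.range := by
    refine bifil_le ev.range k 1 (D := D) ⟨C (C u), ?_⟩ ⟨C (C y), ?_⟩ ⟨C X * X, ?_⟩
      ⟨algebraMap F _ ζ + C X, ?_⟩ hs
    · simp [hev, PowerSeries.algebraMap_apply]
    · simp [hev, PowerSeries.algebraMap_apply]
    · change ev _ = x'
      rw [map_mul, hev, hev, aevalAeval_X, aevalAeval_Y, ← hxt]
    · change ev _ = z
      rw [map_add, AlgHom.commutes, hev, aevalAeval_X, ← hzx]
  obtain ⟨r, hr⟩ := exists_coeff_mul_pow_eq_of_eq hO hx0 ht0 hδ hpb hp0 hv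
  refine ⟨(-1) ^ i * r, mul_left_cancel₀ (pow_ne_zero i hδ) ?_⟩
  change _ * (PowerSeries.coeff i (aevalAeval x t r') * _) = _
  have h4 : (PowerSeries.coeff 1 x * algebraMap O K (ddY k (coef k H e) u y y)) ^ i =
      (-1) ^ i * algebraMap O K w ^ i * algebraMap O K (b.evalEval w v) ^ i := by
    rw [hx1, hslope, ← hb0, map_mul, ← mul_pow, ← mul_pow]
    congr 1
    ring
  rw [← hY, mul_left_comm, ← mul_pow, h4]
  simp only [map_mul, map_pow, map_neg, map_one]
  linear_combination (-1) ^ i * algebraMap O K w ^ i * hr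

end charts

lemma IsCurve.ddX_coef_ne_zero {F B : Type v} [Field F] [CommRing B] [Algebra F B] {k : ℕ}
    (hk : (k : F) = 0) {H : F[X]} {e : F} (he : e ≠ 0) {u y : B}
    (h : IsCurve k (coef k H e) u y) : ddX k (coef k H e) u u y ≠ 0 := by
  let I : Ideal F[X] := Ideal.span {X ^ (k + 1)}
  let t : F[X] ⧸ I := Ideal.Quotient.mkₐ F I X
  have ht : t ^ (k + 1) = 0 := by
    rw [← map_pow]
    exact Ideal.Quotient.eq_zero_iff_mem.2 (Ideal.mem_span_singleton_self _)
  obtain ⟨θ, h1, h2⟩ := h.lift (F[X] ⧸ I) t 0 (by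
    rw [phi_coef, ht]
    simp)
  intro h3
  have h4 := congrArg θ h3
  rw [map_ddX, h1, h2, map_zero, ddX, sum_expSet_coef _ fun p hp => by rw [hp, zero_smul],
    Finset.sum_eq_zero fun i _ => Finset.sum_eq_zero fun j _ => by simp, zero_add] at h4
  have h5 : ∑ j ∈ Finset.range (k + 1), t ^ j * t ^ (k + 1 - 1 - j) = t ^ k := by
    have h6 : ∀ j ∈ Finset.range (k + 1), t ^ j * t ^ (k + 1 - 1 - j) = t ^ k := fun j hj => by
      rw [← pow_add]
      congr 1
      have := Finset.mem_range.1 hj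
      omega
    rw [Finset.sum_congr rfl h6, Finset.sum_const, Finset.card_range, ← Nat.cast_smul_eq_nsmul F]
    push_cast
    rw [hk, zero_add, one_smul]
  rw [h5] at h4
  simp only [coef, if_true, pow_zero, mul_one, t] at h4
  rw [← map_pow, ← map_smul, Ideal.Quotient.mkₐ_eq_mk, Ideal.Quotient.eq_zero_iff_mem,
    Ideal.mem_span_singleton, X_pow_dvd_iff] at h4
  have := h4 k (Nat.lt_succ_self k)
  simp at this
  exact he this

section valuation

variable {F B : Type v} [Field F] [CommRing B] [Algebra F B]

/-- A proper ideal of a domain is contained in the maximal ideal of some valuation ring of its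
field of fractions. -/
lemma exists_valuationRing [IsDomain B] {I : Ideal B} (hI : I ≠ ⊤) :
    ∃ (O : Type v) (_ : CommRing O) (_ : IsDomain O) (_ : ValuationRing O) (_ : Algebra F O)
      (_ : Algebra O (FractionRing B)) (_ : IsScalarTower F O (FractionRing B)) (f : B →ₐ[F] O),
      Function.Injective (algebraMap O (FractionRing B)) ∧
      (∀ b, algebraMap O (FractionRing B) (f b) = algebraMap B (FractionRing B) b) ∧
      ∀ b ∈ I, ¬ IsUnit (f b) := by
  obtain ⟨M, hM, hIM⟩ := I.exists_le_maximal hI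
  have hM' := hM.isPrime
  let R := Localization.AtPrime M
  have hu : ∀ x : M.primeCompl, IsUnit (algebraMap B (FractionRing B) x) := fun x => by
    refine IsUnit.mk0 _ ((map_ne_zero_iff _ (IsFractionRing.injective B (FractionRing B))).2 ?_)
    intro h
    exact x.2 (h ▸ M.zero_mem)
  let φ : R →+* FractionRing B := IsLocalization.lift hu
  have hφ : ∀ b, φ (algebraMap B R b) = algebraMap B (FractionRing B) b :=
    fun b => IsLocalization.lift_eq hu b
  obtain ⟨A, hA, hloc⟩ := IsLocalRing.exists_factor_valuationRing φ
  let ψ : R →+* A := φ.codRestrict A.toSubring hA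
  let g : B →+* A := ψ.comp (algebraMap B R)
  let _ : Algebra F A := (g.comp (algebraMap F B)).toAlgebra
  have hg : ∀ b, algebraMap A (FractionRing B) (g b) = algebraMap B (FractionRing B) b := hφ
  have : IsScalarTower F A (FractionRing B) := IsScalarTower.of_algebraMap_eq fun x => by
    rw [IsScalarTower.algebraMap_apply F B (FractionRing B), ← hg]
    rfl
  refine ⟨A, inferInstance, inferInstance, inferInstance, inferInstance, inferInstance,
    inferInstance, { g with commutes' := fun x => rfl }, Subtype.val_injective, hg,
    fun b hb h => ?_⟩
  have h1 : IsUnit (algebraMap B R b) := hloc.map_nonunit _ h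
  exact (IsLocalization.AtPrime.isUnit_to_map_iff R M b).1 h1 (hIM hb)

lemma le_colen_comap_span_pow {O : Type*} [CommRing O] [IsDomain O] [IsLocalRing O] [Algebra F O]
    (f : B →ₐ[F] O) {u : B} (hu : ¬ IsUnit (f u)) {s : O} (hs0 : s ≠ 0) (hs : ¬ IsUnit s) {E : ℕ}
    (hE : f u ∣ s ^ E) {i r : ℕ} (hr : ∀ j < r, E * j < i) :
    (r : ℕ∞) ≤ colen F (Ideal.comap f (Ideal.span {s ^ i})) := by
  set J := Ideal.comap f (Ideal.span {s ^ i}) with hJ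
  let φ : (Fin r → F) →ₗ[F] B ⧸ J := (Ideal.Quotient.mkₐ F J).toLinearMap ∘ₗ
    (aeval u).toLinearMap ∘ₗ (degreeLT F r).subtype ∘ₗ (degreeLTEquiv F r).symm.toLinearMap
  have hφ : Function.Injective φ := by
    rw [injective_iff_map_eq_zero]
    intro c hc
    set p := (degreeLTEquiv F r).symm c with hp
    have h1 : aeval u (p : F[X]) ∈ J := Ideal.Quotient.eq_zero_iff_mem.1 hc
    rw [hJ, Ideal.mem_comap, Ideal.mem_span_singleton, ← aeval_algHom_apply] at h1
    by_contra hc0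
    have hp0 : (p : F[X]) ≠ 0 := by
      intro h2
      refine hc0 ((degreeLTEquiv F r).symm.map_eq_zero_iff.1 ?_)
      exact Subtype.ext h2
    obtain ⟨p', h2, h3⟩ := exists_eq_pow_rootMultiplicity_mul_and_not_dvd (p : F[X]) hp0 0
    rw [C_0, sub_zero] at h2 h3
    set j := (p : F[X]).rootMultiplicity 0
    rw [X_dvd_iff] at h3
    have h4 : IsUnit (aeval (f u) p') := by
      rw [← divX_mul_X_add p', map_add, map_mul, aeval_X, aeval_C]
      have h5 : IsUnit (algebraMap F O (p'.coeff 0)) := (IsUnit.mk0 _ h3).map _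
      by_contra h6
      refine (IsLocalRing.mem_maximalIdeal _).1 ?_ h5
      rw [← add_sub_cancel_left (aeval (f u) p'.divX * f u) (algebraMap F O (p'.coeff 0))]
      exact Ideal.sub_mem _ ((IsLocalRing.mem_maximalIdeal _).2 h6)
        (Ideal.mul_mem_left _ _ ((IsLocalRing.mem_maximalIdeal _).2 hu))
    have h5 : j < r := by
      have h6 := mem_degreeLT.1 p.2
      have h7 : p' ≠ 0 := by
        rintro rfl
        simp at h3
      rw [h2, degree_mul, degree_X_pow, degree_eq_natDegree h7] at h6
      have h8 : j + p'.natDegree < r := by exact_mod_cast h6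
      omega
    rw [h2, map_mul, map_pow, aeval_X, h4.dvd_mul_right] at h1
    have h6 := h1.trans (pow_dvd_pow_of_dvd hE j)
    rw [← pow_mul, pow_dvd_pow_iff hs0 hs] at h6
    exact absurd (hr j h5) (not_lt.2 h6)
  have h2 : Module.length F (Fin r → F) = r := by
    rw [Module.length_pi]
    simp
  rw [← h2]
  exact Module.length_le_of_injective φ hφ

end valuation

section

variable {F B : Type v} [Field F] [CommRing B] [IsDomain B] [Algebra F B] {k : ℕ} {H : F[X]}
  {e ζ : F}

/-- At a singular point `(0, ζ)`, a function which is a lead of order `i` belongs to an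
ideal of large colength. -/
lemma IsCurve.exists_ideal_of_isLead {u y : B} (h : IsCurve k (coef k H e) u y) (hk1 : 1 ≤ k)
    (hH : H.coeff k = 1) (he : e ≠ 0) (hk : (k : F) = 0) (hH' : H.coeff (k - 1) = 0) (hζ : ζ ≠ 1)
    (hζk : ζ ^ k = 1) (hroot : (fiberPoly k (coef k H e) (0 : F)).IsRoot ζ)
    {z : PowerSeries (FractionRing B)}
    (hz0 : PowerSeries.constantCoeff z = algebraMap B (FractionRing B) y)
    (hz : phi k (coef k H e) (PowerSeries.C (algebraMap B (FractionRing B) u) + PowerSeries.X) z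
        = 0) {i : ℕ} {x : B}
    (hx : IsLead k (coef k H e) (algebraMap B (FractionRing B) u) (algebraMap B (FractionRing B) y)
        z i (algebraMap B (FractionRing B) x)) :
    ∃ J : Ideal B, x ∈ J ∧ u ^ i ∈ J ∧
      ∀ r : ℕ, (∀ j < r, (fiberPoly k (coef k H e) (0 : F)).rootMultiplicity ζ * j < i) →
        (r : ℕ∞) ≤ colen F J := by
  set p := fiberPoly k (coef k H e) (0 : F) with hp
  set E := p.rootMultiplicity ζ with hE
  have hc := coef_zero_self hk1 hH e
  obtain ⟨θ, h1, h2⟩ := h.lift F 0 ζ (by rw [← eval_fiberPoly]; exact hroot)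
  have hI : Ideal.span {u, y - algebraMap F B ζ} ≠ ⊤ := by
    have h3 : Ideal.span {u, y - algebraMap F B ζ} ≤ RingHom.ker θ := by
      rw [Ideal.span_le]
      rintro b (rfl | rfl)
      · exact h1
      · change θ _ = 0
        rw [map_sub, h2, AlgHom.commutes]
        exact sub_self ζ
    intro h4
    have h5 := h3 (h4 ▸ Submodule.mem_top (x := (1 : B)))
    exact one_ne_zero ((map_one θ).symm.trans h5)
  obtain ⟨O, _, _, _, _, _, _, f, hO, hf, hunit⟩ := exists_valuationRing (F := F) hI
  have hfinj : Function.Injective f := fun a b hab => IsFractionRing.injective B (FractionRing B)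
    (by rw [← hf, ← hf, hab])
  have hu0 : f u ≠ 0 := by
    have := h.sub_ne_zero hk1 0
    rw [map_zero, sub_zero] at this
    exact (map_ne_zero_iff f hfinj).2 this
  have hu : ¬ IsUnit (f u) := hunit _ (Ideal.subset_span (by simp))
  set w := f (y - algebraMap F B ζ) with hw
  have hwu : ¬ IsUnit w := hunit _ (Ideal.subset_span (by simp))
  have hyw : f y = algebraMap F O ζ + w := by
    rw [hw, map_sub, AlgHom.commutes]
    ring
  have hrel : phi k (coef k H e) (f u) (f y) = 0 := by rw [← map_phi, h.rel, map_zero]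
  have hp0 : p ≠ 0 := (fiberPoly_monic hk1 hc (0 : F)).1.ne_zero
  -- the function `w ^ E` is divisible by `u`
  have hdvd : f u ∣ w ^ E := by
    obtain ⟨A, hA, hAζ⟩ := exists_eq_pow_rootMultiplicity_mul_and_not_dvd p hp0 ζ
    have h3 : f u ∣ phi k (coef k H e) 0 (f y) := by
      have h4 := ddX_mul k (coef k H e) (f u) 0 (f y)
      rw [hrel, sub_zero, zero_sub] at h4
      rw [← neg_neg (phi k (coef k H e) 0 (f y)), ← h4, dvd_neg]
      exact dvd_mul_left _ _
    have h4 : phi k (coef k H e) 0 (f y) = aeval (f y) p := by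
      have h5 := map_phi k (coef k H e) (C 0 : F[X]) X (aeval (f y) : F[X] →ₐ[F] O)
      rw [aeval_X, C_0, map_zero] at h5
      rw [hp, fiberPoly, C_0]
      exact h5.symm
    have h5 : IsUnit (aeval (f y) A) := by
      obtain ⟨A', hA'⟩ := X_sub_C_dvd_sub_C_eval (a := ζ) (p := A)
      have h6 : aeval (f y) A = w * aeval (f y) A' + algebraMap F O (A.eval ζ) := by
        rw [← sub_add_cancel A (C (A.eval ζ)), hA', map_add, map_mul, map_sub, aeval_X, aeval_C,
          aeval_C, hyw, add_sub_cancel_left]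
        simp
      have h7 : IsUnit (algebraMap F O (A.eval ζ)) :=
        (IsUnit.mk0 _ fun h8 => hAζ (dvd_iff_isRoot.2 h8)).map _
      by_contra h8
      refine (IsLocalRing.mem_maximalIdeal _).1 ?_ h7
      rw [← add_sub_cancel_left (w * aeval (f y) A') (algebraMap F O (A.eval ζ)), ← h6]
      exact Ideal.sub_mem _ ((IsLocalRing.mem_maximalIdeal _).2 h8)
        (Ideal.mul_mem_right _ _ ((IsLocalRing.mem_maximalIdeal _).2 hwu))
    rw [h4, hA, map_mul, map_pow, map_sub, aeval_X, aeval_C, hyw, add_sub_cancel_left, ← hyw,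
      h5.dvd_mul_right] at h3
    exact h3
  have key : ∀ s : O, s ≠ 0 → ¬ IsUnit s → s ∣ f u → f u ∣ s ^ E →
      (∃ r : O, algebraMap B (FractionRing B) x = algebraMap O (FractionRing B) (s ^ i * r)) →
      ∃ J : Ideal B, x ∈ J ∧ u ^ i ∈ J ∧
        ∀ r : ℕ, (∀ j < r, E * j < i) → (r : ℕ∞) ≤ colen F J := by
    rintro s hs0 hs hsu hus ⟨r, hr⟩
    rw [← hf] at hr
    refine ⟨Ideal.comap f (Ideal.span {s ^ i}), ?_, ?_, fun r hr =>
      le_colen_comap_span_pow f hu hs0 hs hus hr⟩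
    · rw [Ideal.mem_comap, hO hr, Ideal.mem_span_singleton]
      exact dvd_mul_right _ _
    · rw [Ideal.mem_comap, Ideal.mem_span_singleton, map_pow]
      exact pow_dvd_pow_of_dvd hsu i
  rw [← hf y] at hz0
  rw [← hf u] at hz
  rw [← hf u, ← hf y] at hx
  rcases ValuationRing.dvd_total (f u) w with ⟨v, hv⟩ | ⟨v, hv⟩
  · refine key (f u) hu0 hu dvd_rfl ?_ ?_
    · exact dvd_pow_self _ ((rootMultiplicity_pos hp0).2 hroot).ne'
    · exact exists_lead_chart_left hk1 hH hk hH' hζ hζk hO (hyw.trans (by rw [hv])) hu0 hz0 hz hx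
  · have hw0 : w ≠ 0 := by
      intro h3
      rw [hv, h3, zero_mul] at hu0
      exact hu0 rfl
    have hne : ddX k (coef k H e) (w * v) (w * v) (f y) ≠ 0 := by
      rw [← hv, ← map_ddX]
      exact (map_ne_zero_iff f hfinj).2 (h.ddX_coef_ne_zero hk he)
    rw [hv] at hz hx
    exact key w hw0 hwu ⟨v, hv⟩ hdvd
      (exists_lead_chart_right hk1 hH hk hH' hζ hζk hO hyw hw0 hz0 hz hne hx)

end

section

variable {F : Type v} [Field F] {k : ℕ} {H : F[X]} {e ζ : F}

lemma two_mul_rootMultiplicity_le [Fintype F] (hk : 1 ≤ k) (hH : H.coeff k = 1) (hζ : ζ ≠ 1)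
    (hζk : ζ ^ k = 1) : 2 * (fiberPoly k (coef k H e) (0 : F)).rootMultiplicity ζ ≤ k := by
  classical
  set E := (fiberPoly k (coef k H e) (0 : F)).rootMultiplicity ζ with hE
  have hζ0 : ζ ≠ 0 := by
    rintro rfl
    rw [zero_pow (by omega)] at hζk
    exact zero_ne_one hζk
  have hG : (X ^ k - 1 : F[X]) ≠ 0 := X_pow_sub_C_ne_zero hk 1
  have h1 : (X - C ζ) ^ E ∣ (X ^ k - 1) * X := by
    refine (pow_rootMultiplicity_dvd (fiberPoly k (coef k H e) (0 : F)) ζ).trans ?_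
    have h2 := sub_one_mul_fiberPoly_coef_zero (e := e) hH
    rw [show (X ^ k - 1 : F[X]) * X = X ^ (k + 1) - X by ring, ← h2]
    exact dvd_mul_left _ _
  have h2 : E ≤ (X ^ k - 1 : F[X]).rootMultiplicity ζ := by
    rw [le_rootMultiplicity_iff hG]
    refine IsCoprime.dvd_of_dvd_mul_right (IsCoprime.pow_left ?_) h1
    have := isCoprime_X_sub_C_of_isUnit_sub (a := ζ) (b := 0) (by simpa using hζ0.isUnit)
    rwa [C_0, sub_zero] at this
  have h3 : (X ^ k - 1 : F[X]).comp (C ζ⁻¹ * X) = X ^ k - 1 := by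
    rw [sub_comp, X_pow_comp, one_comp, mul_pow, ← C_pow, inv_pow, hζk, inv_one, C_1, one_mul]
  have h4 := rootMultiplicity_comp_C_mul_X_le hG (inv_ne_zero hζ0) ζ
  rw [h3, inv_mul_cancel₀ hζ0] at h4
  have h5 := sum_rootMultiplicity_le (X ^ k - 1 : F[X]) {1, ζ}
  rw [Finset.sum_pair hζ.symm, show (X ^ k - 1 : F[X]) = X ^ k - C 1 by simp,
    natDegree_X_pow_sub_C] at h5
  rw [show (X ^ k - 1 : F[X]) = X ^ k - C 1 by simp] at h2 h4
  omega

/-- The part of the curve over the nonzero rational values of `u`, together with a comaximal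
ideal. -/
lemma IsCurve.le_of_mem_ideal [Fintype F] {B : Type v} [CommRing B] [IsDomain B] [Algebra F B]
    {u y : B} [DecidableEq F] (h : IsCurve k (coef k H e) u y) (hk : 1 ≤ k) (hH : H.coeff k = 1)
    {q : ℕ} (hq : Fintype.card F = q + 1) {n i D r : ℕ} {x : B} (hx0 : x ≠ 0)
    (hxD : x ∈ fil F k u y D)
    (hx : ∃ x', x * (y - y ^ (q + 1)) ^ n = x' * (u - u ^ (q + 1)) ^ n) {J : Ideal B}
    (hxJ : x ∈ J) (huJ : u ^ i ∈ J) (hr : (r : ℕ∞) ≤ colen F J) :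
    n * (q * k) + r ≤ D + n * ∑ a ∈ Finset.univ.erase 0, ∑ b : F,
      (fiberPoly k (coef k H e) a).rootMultiplicity b := by
  have hc := coef_zero_self hk hH e
  set ϖ : B := ∏ a ∈ Finset.univ.erase 0, (u - algebraMap F B a) with hϖ
  set Q := quot (Ideal.span {ϖ ^ n}) ((y ^ Fintype.card F - y) ^ n) with hQ
  have h1 := h.le_colen_quot hk hc (Finset.univ.erase 0)
    (fun a b => (fiberPoly k (coef k H e) a).rootMultiplicity b) n
    fun a _ b => by simpa using h.colen_pow_pow_le_left hk hc a b n
  rw [← hϖ, ← hQ, Finset.card_erase_of_mem (Finset.mem_univ _), Finset.card_univ, hq,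
    Nat.add_sub_cancel] at h1
  have hxQ : x ∈ Q := mem_quot_of_mul_eq hq hx _
  have h2 : IsCoprime (u ^ i) (ϖ ^ n) := by
    refine IsCoprime.pow (IsCoprime.prod_right fun a ha => ?_)
    refine ⟨algebraMap F B a⁻¹, - algebraMap F B a⁻¹, ?_⟩
    have h3 : algebraMap F B a⁻¹ * algebraMap F B a = 1 := by
      rw [← map_mul, inv_mul_cancel₀ (Finset.ne_of_mem_erase ha), map_one]
    linear_combination h3
  have hcop : IsCoprime J Q := by
    obtain ⟨s, t, hst⟩ := h2
    refine Ideal.isCoprime_iff_exists.2 ⟨s * u ^ i, J.mul_mem_left s huJ, t * ϖ ^ n,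
      Q.mul_mem_left t ?_, hst⟩
    rw [hQ, mem_quot]
    exact Ideal.mul_mem_right _ _ (Ideal.mem_span_singleton_self _)
  have h3 := (colen_add_le_of_isCoprime (L := F) (K := J ⊓ Q) inf_le_left inf_le_right hcop).trans
    (h.colen_le hk hc hx0 hxD ⟨hxJ, hxQ⟩)
  have h4 := add_le_add h1 hr
  rw [add_right_comm, add_comm (colen F Q)] at h4
  exact_mod_cast h4.trans (add_le_add h3 le_rfl)

theorem coef_bound_of_bad [Fintype F] (hk : 2 ≤ k) (hd : H.natDegree = k) (hH : H.coeff k = 1)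
    (he : e ≠ 0) {T : Finset F}
    (hT : (0 : F) ∉ T) (hinj : Set.InjOn (fun t => H.eval t + e / t) T) {n : ℕ}
    (hn : Fintype.card F ≤ T.card + (n + 1))
    (hkF : (k : F) = 0) (hH' : H.coeff (k - 1) = 0) (hζ : ζ ≠ 1) (hζk : ζ ^ k = 1)
    (hG : (k : ℝ) * (k - 1) ≤ √(Fintype.card F)) :
    (Fintype.card F : ℝ) - k * (k - 1) * √(Fintype.card F) ≤
      (k + 1) * (n + 1) + Nat.gcd k (Fintype.card F - 1) := by
  classical
  obtain ⟨q, hq⟩ : ∃ q, Fintype.card F = q + 1 :=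
    ⟨Fintype.card F - 1, by have := Fintype.card_pos (α := F); omega⟩
  have hk1 : 1 ≤ k := by omega
  have hc := coef_zero_self hk1 hH e
  have h1 := sum_rootMultiplicity_fiberPoly_le hk1 hd hH he hT hinj hn
  have h2 := natDegree_ramPoly_le (hd.symm ▸ hk1) e
  have h3 := two_mul_rootMultiplicity_le (e := e) hk1 hH hζ hζk
  have hroot : (fiberPoly k (coef k H e) (0 : F)).IsRoot ζ := by
    have h4 := congrArg (eval ζ) (sub_one_mul_fiberPoly_coef_zero (e := e) hH)
    rw [eval_mul, eval_sub, eval_sub, eval_pow, eval_X, eval_one, pow_succ, hζk, one_mul, sub_self]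
      at h4
    exact (mul_eq_zero.1 h4).resolve_left (sub_ne_zero.2 hζ)
  have hE0 := (rootMultiplicity_pos (fiberPoly_monic hk1 hc (0 : F)).1.ne_zero).2 hroot
  set E := (fiberPoly k (coef k H e) (0 : F)).rootMultiplicity ζ with hE
  set M := ∑ a ∈ Finset.univ.erase 0, ∑ b : F, (fiberPoly k (coef k H e) a).rootMultiplicity b
    with hM
  have hE0' : (0 : ℝ) < E := by exact_mod_cast hE0
  have main := coef_le_of_forall_lead hk hH he hq (M := M + k) (γ := (E : ℝ)⁻¹)
    (add_nonneg (Nat.cast_nonneg _) (Nat.cast_nonneg _))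
    (inv_le_one_of_one_le₀ (by exact_mod_cast hE0)) ?_
    (by rw [hq] at hG; exact_mod_cast hG)
  · have h4 : (M : ℝ) ≤ (k + 1) * n + (k + 1) := by
      rw [hd] at h2
      exact_mod_cast h1.trans (by omega)
    have h5 : (k : ℝ) - 1 ≤ (E : ℝ)⁻¹ * √(q + 1) / 2 := by
      rw [hq] at hG
      push_cast at hG
      have h6 : 2 * (E : ℝ) ≤ k := by exact_mod_cast h3
      have h7 : (1 : ℝ) ≤ k := by exact_mod_cast hk1
      rw [inv_mul_eq_div, div_div, le_div_iff₀ (by positivity)]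
      nlinarith
    have h6 : (1 : ℝ) ≤ Nat.gcd k (Fintype.card F - 1) := by
      exact_mod_cast Nat.gcd_pos_of_pos_left _ hk1
    rw [hq] at h6 ⊢
    push_cast at h6 ⊢
    linarith
  · intro B _ _ _ u y h z hz0 hz n i D x hx0 hxD hlead hx
    obtain ⟨J, hxJ, huJ, hJ⟩ := h.exists_ideal_of_isLead hk1 hH he hkF hH' hζ hζk hroot hz0 hz hlead
    have h4 : ∃ r, (∀ j < r, E * j < i) ∧ i ≤ E * r := by
      refine ⟨(i + E - 1) / E, fun j hj => ?_, ?_⟩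
      · have := (Nat.mul_le_mul_left E (Nat.succ_le_of_lt hj)).trans (Nat.mul_div_le (i + E - 1) E)
        rw [Nat.mul_succ] at this
        omega
      · have := Nat.lt_mul_div_succ (i + E - 1) hE0
        rw [Nat.mul_add_one] at this
        omega
    obtain ⟨r, hr1, hr2⟩ := h4
    have h5 := h.le_of_mem_ideal hk1 hH hq hx0 hxD hx hxJ huJ (hJ r hr1)
    rw [← hM] at h5
    have h6 : ((n * (q * k) + r : ℕ) : ℝ) ≤ (D + n * M : ℕ) := by exact_mod_cast h5
    have h7 : (E : ℝ)⁻¹ * i ≤ r := by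
      rw [inv_mul_le_iff₀ hE0']
      exact_mod_cast hr2
    push_cast at h6
    linarith

end

lemma coef_bound_one {F : Type v} [Field F] [Fintype F] {H : F[X]} {e : F}
    (hd : H.natDegree = 1) (hH : H.coeff 1 = 1)
    (he : e ≠ 0) {T : Finset F} (hT : (0 : F) ∉ T)
    (hinj : Set.InjOn (fun t => H.eval t + e / t) T) {n : ℕ}
    (hn : Fintype.card F ≤ T.card + (n + 1)) : Fintype.card F ≤ 2 * (n + 1) + 1 := by
  classical
  have h1 := sum_rootMultiplicity_fiberPoly_le le_rfl hd hH he hT hinj hn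
  have h2 := natDegree_ramPoly_le hd.ge e
  have h3 : ∑ a ∈ (Finset.univ : Finset F).erase 0, 1 ≤
      ∑ a ∈ Finset.univ.erase 0, ∑ b : F, (fiberPoly 1 (coef 1 H e) a).rootMultiplicity b := by
    refine Finset.sum_le_sum fun a _ => ?_
    obtain ⟨hm, hp⟩ := fiberPoly_monic le_rfl (coef_zero_self le_rfl hH e) a
    obtain ⟨b, hb⟩ := exists_root_of_degree_eq_one
      ((degree_eq_iff_natDegree_eq hm.ne_zero).2 hp)
    exact ((rootMultiplicity_pos hm.ne_zero).2 hb).trans_le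
      (Finset.single_le_sum (f := fun b : F => (fiberPoly 1 (coef 1 H e) a).rootMultiplicity b)
        (fun _ _ => Nat.zero_le _) (Finset.mem_univ b))
  rw [Finset.sum_const, smul_eq_mul, mul_one, Finset.card_erase_of_mem (Finset.mem_univ _),
    Finset.card_univ] at h3
  omega

/-- If `H + e / t` is injective on a large set then `k = deg H` is large. -/
theorem coef_bound {F : Type v} [Field F] [Fintype F] {k : ℕ} {H : F[X]} {e : F} (hk : 1 ≤ k)
    (hd : H.natDegree = k) (hH : H.coeff k = 1)
    (he : e ≠ 0) {T : Finset F} (hT : (0 : F) ∉ T)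
    (hinj : Set.InjOn (fun t => H.eval t + e / t) T) {n : ℕ}
    (hn : Fintype.card F ≤ T.card + (n + 1)) :
    (Fintype.card F : ℝ) - k * (k - 1) * √(Fintype.card F) ≤
      (k + 1) * (n + 1) + Nat.gcd k (Fintype.card F - 1) := by
  obtain rfl | hk2 : k = 1 ∨ 2 ≤ k := by omega
  · have h1 : (Fintype.card F : ℝ) ≤ 2 * (n + 1) + 1 := by
      exact_mod_cast coef_bound_one hd hH he hT hinj hn
    norm_num
    linarith
  rcases le_total ((k : ℝ) * (k - 1)) (√(Fintype.card F)) with hG | hG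
  · by_cases hgood : ∀ b : F, b ≠ 1 → b ^ k = 1 → (k : F) ≠ 0 ∨ H.coeff (k - 1) ≠ 0
    · exact coef_bound_of_good hk2 hd hH he hT hinj hn hgood hG
    · push Not at hgood
      obtain ⟨b, hb, hbk, hkF, hH'⟩ := hgood
      exact coef_bound_of_bad hk2 hd hH he hT hinj hn hkF hH' hb hbk hG
  · have h1 : (Fintype.card F : ℝ) = √(Fintype.card F) * √(Fintype.card F) :=
      (Real.mul_self_sqrt (Nat.cast_nonneg _)).symm
    have h2 := mul_le_mul_of_nonneg_right hG (Real.sqrt_nonneg (Fintype.card F))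
    have h3 : (0 : ℝ) ≤ (k + 1) * (n + 1) + Nat.gcd k (Fintype.card F - 1) := by positivity
    linarith

end PlaneCurve

open OnePoint

theorem difference_bound_fractional_approximation
    {F : Type*} [Field F] [Fintype F] (q n k : ℕ)
    (hq : Fintype.card F = q) (hq3 : 3 ≤ q)
    (f : F → F) (g : Polynomial F)
    (hf : Function.Bijective f)
    (hfg : Function.Bijective fun x => f x + g.eval x)
    (hn1 : 1 ≤ n) (hk1 : 1 ≤ k) (hk2 : k < q - 1) (hdeg : g.natDegree = k)
    (a b d : F) (habd : a * d - b ≠ 0)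
    (S : Finset (OnePoint F)) (hScard : S.card ≤ n) (hdS : ((-d : F) : OnePoint F) ∈ S)
    (hfS : ∀ z : F, ((z : OnePoint F) ∉ S) → f z = (a * z + b) / (z + d)) :
    (n : ℝ) * k + (k : ℝ) * ((k : ℝ) - 1) * Real.sqrt q ≥
      (q : ℝ) - (Nat.gcd k (q - 1) : ℝ) - (n : ℝ) := by
  classical
  obtain ⟨m, rfl⟩ := Nat.exists_eq_add_of_le' hn1
  have hg0 : g ≠ 0 := by
    rintro rfl
    simp at hdeg
    omega
  set l := g.leadingCoeff with hl
  have hl0 : l ≠ 0 := Polynomial.leadingCoeff_ne_zero.2 hg0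
  have hc : (g.comp (Polynomial.X - Polynomial.C d)).natDegree = k := by
    rw [Polynomial.natDegree_comp, Polynomial.natDegree_X_sub_C, mul_one, hdeg]
  have hlc : (g.comp (Polynomial.X - Polynomial.C d)).coeff k = l := by
    rw [← hc, Polynomial.coeff_natDegree, Polynomial.leadingCoeff_comp (by simp),
      Polynomial.leadingCoeff_X_sub_C, one_pow, mul_one]
  set H : Polynomial F := Polynomial.C l⁻¹ *
    (g.comp (Polynomial.X - Polynomial.C d) + Polynomial.C a) with hH
  set T : Finset F := Finset.univ.filter fun t => ((t - d : F) : OnePoint F) ∉ S with hT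
  have hT0 : (0 : F) ∉ T := by simp [hT, hdS]
  have hval : ∀ t ∈ T, H.eval t + (l⁻¹ * (b - a * d)) / t =
      l⁻¹ * (f (t - d) + g.eval (t - d)) := by
    intro t ht
    have ht0 : t ≠ 0 := fun h => hT0 (h ▸ ht)
    rw [hfS _ (Finset.mem_filter.1 ht).2, sub_add_cancel, hH]
    simp only [Polynomial.eval_mul, Polynomial.eval_C, Polynomial.eval_add, Polynomial.eval_comp,
      Polynomial.eval_sub, Polynomial.eval_X]
    field_simp
    ring
  have hcard : Fintype.card F ≤ T.card + (m + 1) := by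
    rw [← Finset.card_univ,
      ← Finset.card_filter_add_card_filter_not (s := Finset.univ)
        (fun t : F => ((t - d : F) : OnePoint F) ∉ S)]
    refine Nat.add_le_add_left (le_trans ?_ hScard) _
    refine Finset.card_le_card_of_injOn (fun t => ((t - d : F) : OnePoint F)) ?_ ?_
    · intro t ht
      simpa using ht
    · intro t _ t' _ h
      exact sub_left_injective (OnePoint.coe_injective h)
  have main := PlaneCurve.coef_bound (H := H) (e := l⁻¹ * (b - a * d)) (T := T) hk1 ?_ ?_
    (mul_ne_zero (inv_ne_zero hl0) fun h => habd (by linear_combination -h)) hT0 ?_ hcard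
  · rw [hq] at main
    push_cast at main ⊢
    linarith
  · rw [hH, Polynomial.natDegree_C_mul (inv_ne_zero hl0), Polynomial.natDegree_add_C, hc]
  · rw [hH, Polynomial.coeff_C_mul, Polynomial.coeff_add, hlc,
      Polynomial.coeff_C_of_ne_zero (by omega), add_zero, inv_mul_cancel₀ hl0]
  · intro t ht t' ht' h
    simp only [hval t ht, hval t' ht'] at h
    exact sub_left_injective (hfg.injective (mul_left_cancel₀ (inv_ne_zero hl0) h))
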